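/- For every integer d ≥ 2 there exists a real constant C = C(d) with the following property. Let F_q be a finite field with q elements and characteristic p, and let f ∈ F_q[T,X] be an absolutely irreducible polynomial of total degree d such that p does not divide d(d − 1) and the projective plane curve defined by the homogenization of f is smooth. Let N be the number of pairs (a_1, a_2) ∈ F_q × F_q such that f(T, a_1·T + a_2) is irreducible in F_q[T]. Then |N − q²/d| ≤ C · q^{3/2}. -/

import Mathlib

open MvPolynomial

/-- The univariate polynomial `f(T, a₁·T + a₂) ∈ K[T]` obtained from `f ∈ K[T,X]`
(variable `0` is `T`, variable `1` is `X`) by substituting `X := a₁·T + a₂`. -/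
noncomputable def lineSub {K : Type*} [CommSemiring K] (f : MvPolynomial (Fin 2) K)
    (a₁ a₂ : K) : Polynomial K :=
  MvPolynomial.aeval ![Polynomial.X, Polynomial.C a₁ * Polynomial.X + Polynomial.C a₂] f

/-- `f ∈ K[T,X]` is absolutely irreducible: it is irreducible over an algebraic
closure of `K`. -/
def AbsolutelyIrreducible {K : Type*} [Field K] (f : MvPolynomial (Fin 2) K) : Prop :=
  Irreducible (MvPolynomial.map (algebraMap K (AlgebraicClosure K)) f)

/-- `F ∈ K[X₀,X₁,X₂]` is the degree-`d` homogenization of `f ∈ K[T,X]`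
(so `F` is homogeneous of degree `d` with `F(1,T,X) = f(T,X)`) and the projective
plane curve `F = 0` is smooth: `F` and its three partial derivatives have no common
zero `≠ (0,0,0)` with coordinates in an algebraic closure of `K`. -/
def IsSmoothHomogenization {K : Type*} [Field K] (F : MvPolynomial (Fin 3) K)
    (f : MvPolynomial (Fin 2) K) (d : ℕ) : Prop :=
  F.IsHomogeneous d ∧
  MvPolynomial.aeval ![1, MvPolynomial.X 0, MvPolynomial.X 1] F = f ∧
  ∀ x : Fin 3 → AlgebraicClosure K, x ≠ 0 →
    MvPolynomial.eval x (F.map (algebraMap K (AlgebraicClosure K))) = 0 →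
    ∃ j : Fin 3, MvPolynomial.eval x ((MvPolynomial.pderiv j F).map
      (algebraMap K (AlgebraicClosure K))) ≠ 0

namespace Polynomial

set_option linter.unusedSectionVars false
set_option linter.unusedVariables false
set_option linter.style.longLine false

namespace LineIrr

section Core

variable {k F L : Type} [Field k] [Field F] [Field L]
  [Algebra k[X] F] [IsFractionRing k[X] F] [Algebra k L] [Algebra k[X] L] [Algebra F L]
  [IsScalarTower k k[X] L] [IsScalarTower k[X] F L]

lemma prod_perm {d : ℕ} {k : Type} [Field k] {t s : Fin d → k} (hts : ∏ i, (X - C (t i)) = ∏ i, (X - C (s i))) :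
    ∃ π : Equiv.Perm (Fin d), ∀ i, t i = s (π i) := by
  have h1 : Multiset.map t Finset.univ.val = Multiset.map s Finset.univ.val := by
    have := congrArg roots hts
    have key : ∀ u : Fin d → k, (∏ i, (X - C (u i))).roots = Multiset.map u Finset.univ.val := by
      intro u
      have := roots_multiset_prod_X_sub_C (Multiset.map u Finset.univ.val)
      rw [Multiset.map_map] at this
      exact this
    rwa [key, key] at this
  classical
  have h2 : ∀ c, Nonempty ({i // t i = c} ≃ {i // s i = c}) := by
    intro c
    have := congrArg (Multiset.count c) h1
    rw [Multiset.count_map, Multiset.count_map] at this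
    refine ⟨Fintype.equivOfCardEq ?_⟩
    rw [Fintype.card_subtype, Fintype.card_subtype]
    simp only [eq_comm (a := c)] at this
    exact this
  let e := fun c => (h2 c).some
  exact ⟨Equiv.ofFiberEquiv e, fun i => (Equiv.ofFiberEquiv_map e i).symm⟩

/-- The basic data: a monic polynomial `h` in `k[x][T]` and its roots. -/
structure Core (k F L : Type) [Field k] [Field F] [Field L]
    [Algebra k[X] L] [Algebra F L] {d : ℕ} (h : k[X][X]) (T : Fin d → L) : Prop where
  wt : ∀ i, i ≤ d → (h.coeff i).natDegree ≤ d - i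
  split : h.map (algebraMap k[X] L) = ∏ i, (X - C (T i))
  gen : Algebra.adjoin F (Set.range T) = ⊤

variable (k L) in
/-- the coordinate function -/
noncomputable def xx : L := algebraMap k[X] L X

variable (k) in
/-- the basic space -/
noncomputable def VV {d : ℕ} (T : Fin d → L) : Submodule k L :=
  Submodule.span k (insert 1 (insert (xx k L) (Set.range T)))

variable {d : ℕ} {h : k[X][X]} {T : Fin d → L}

lemma algMap_inj (k F L : Type) [Field k] [Field F] [Field L]
    [Algebra k[X] F] [IsFractionRing k[X] F] [Algebra k[X] L] [Algebra F L]
    [IsScalarTower k[X] F L] : Function.Injective (algebraMap k[X] L) := by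
  rw [IsScalarTower.algebraMap_eq k[X] F L]
  exact (algebraMap F L).injective.comp (IsFractionRing.injective k[X] F)

lemma one_mem_VV : (1 : L) ∈ VV k T := Submodule.subset_span (by simp)
lemma xx_mem_VV : xx k L ∈ VV k T := Submodule.subset_span (by simp)
lemma T_mem_VV (i : Fin d) : T i ∈ VV k T := Submodule.subset_span (by simp)
lemma one_le_VV : 1 ≤ VV k T := Submodule.one_le.2 one_mem_VV
lemma VV_mono {m n : ℕ} (hmn : m ≤ n) : VV k T ^ m ≤ VV k T ^ n :=
  pow_le_pow_right₀ one_le_VV hmn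
lemma VV_mul {m n : ℕ} {a b : L} (ha : a ∈ VV k T ^ m) (hb : b ∈ VV k T ^ n) :
    a * b ∈ VV k T ^ (m + n) := by
  rw [pow_add]; exact Submodule.mul_mem_mul ha hb
lemma VV_pow {m n : ℕ} {a : L} (ha : a ∈ VV k T ^ m) : a ^ n ∈ VV k T ^ (m * n) := by
  rw [pow_mul]; exact Submodule.pow_mem_pow _ ha n
lemma VV_one {m : ℕ} : (1 : L) ∈ VV k T ^ m :=
  VV_mono (Nat.zero_le m) (by simp)
lemma VV_const {m : ℕ} (c : k) : algebraMap k L c ∈ VV k T ^ m := by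
  rw [Algebra.algebraMap_eq_smul_one]; exact Submodule.smul_mem _ _ VV_one
lemma VV_prod {ι : Type} (s : Finset ι) (f : ι → L) (n : ι → ℕ)
    (hf : ∀ i ∈ s, f i ∈ VV k T ^ n i) : ∏ i ∈ s, f i ∈ VV k T ^ (∑ i ∈ s, n i) := by
  classical
  induction s using Finset.induction_on with
  | empty => simpa using VV_one (k := k) (T := T) (m := 0)
  | insert a s ha ih =>
    rw [Finset.prod_insert ha, Finset.sum_insert ha]
    exact VV_mul (hf a (by simp)) (ih fun i hi => hf i (by simp [hi]))
lemma VV_fg : (VV k T).FG :=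
  Submodule.fg_span (by
    apply Set.Finite.insert; apply Set.Finite.insert; exact Set.finite_range T)
instance VV_fin (m : ℕ) : FiniteDimensional k ↥(VV k T ^ m) :=
  Module.Finite.iff_fg.2 (VV_fg.pow m)

lemma poly_eq (P : k[X]) : algebraMap k[X] L P = aeval (xx k L) P := by
  have : (aeval (xx k L) : k[X] →ₐ[k] L) = IsScalarTower.toAlgHom k k[X] L := by
    ext; simp [xx]
  rw [this]; rfl

lemma VV_poly (P : k[X]) {m : ℕ} (hP : P.natDegree ≤ m) : algebraMap k[X] L P ∈ VV k T ^ m := by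
  rw [poly_eq, aeval_eq_sum_range]
  refine Submodule.sum_mem _ fun i hi => Submodule.smul_mem _ _ ?_
  have : xx k L ^ i ∈ VV k T ^ (1 * i) := VV_pow (by simpa using xx_mem_VV)
  refine VV_mono ?_ this
  simp at hi; omega

/-- Galois group acts on roots. -/
lemma gal_perm (hc : Core k F L h T) (g : L ≃ₐ[F] L) :
    ∃ π : Equiv.Perm (Fin d), ∀ i, g (T i) = T (π i) := by
  have h1 := congrArg (Polynomial.map (g : L →+* L)) hc.split
  have h2 : (g : L →+* L).comp (algebraMap k[X] L) = algebraMap k[X] L := by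
    ext a
    · simp only [RingHom.comp_apply, RingHom.coe_coe]
      rw [IsScalarTower.algebraMap_apply k[X] F L]; simp
    · simp only [RingHom.comp_apply, RingHom.coe_coe]
      rw [IsScalarTower.algebraMap_apply k[X] F L]; simp
  rw [Polynomial.map_map, h2, hc.split, Polynomial.map_prod] at h1
  simp only [Polynomial.map_sub, map_X, map_C] at h1
  exact prod_perm h1.symm

lemma gal_poly (g : L ≃ₐ[F] L) (P : k[X]) :
    g (algebraMap k[X] L P) = algebraMap k[X] L P := by
  rw [IsScalarTower.algebraMap_apply k[X] F L]; simp

lemma gal_const (g : L ≃ₐ[F] L) (c : k) : g (algebraMap k L c) = algebraMap k L c := by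
  rw [IsScalarTower.algebraMap_apply k k[X] L, gal_poly]

lemma gal_VV (hc : Core k F L h T) (g : L ≃ₐ[F] L) {m : ℕ} {y : L} (hy : y ∈ VV k T ^ m) :
    g y ∈ VV k T ^ m := by
  let g' : L →ₐ[k] L := { (g : L →+* L) with commutes' := fun c => gal_const g c }
  have h1 : (VV k T).map g'.toLinearMap ≤ VV k T := by
    rw [VV, Submodule.map_span, Submodule.span_le]
    rintro _ ⟨z, hz, rfl⟩
    obtain ⟨π, hπ⟩ := gal_perm hc g
    rcases hz with rfl | rfl | ⟨i, rfl⟩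
    · simp only [AlgHom.coe_toLinearMap, map_one]; exact one_mem_VV (k := k) (T := T)
    · have : g' (xx k L) = xx k L := gal_poly g X
      simp only [AlgHom.coe_toLinearMap, this]; exact xx_mem_VV
    · have : g' (T i) = T (π i) := hπ i
      simp only [AlgHom.coe_toLinearMap, this]; exact T_mem_VV _
  have h2 : (VV k T ^ m).map g'.toLinearMap ≤ VV k T ^ m := by
    rw [Submodule.map_pow]; exact pow_le_pow_left₀ (by simp) h1 m
  exact h2 ⟨y, hy, rfl⟩

lemma T_integral (hc : Core k F L h T) (i : Fin d) : IsIntegral k[X] (T i) := by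
  refine ⟨h, ?_, ?_⟩
  · have : (h.map (algebraMap k[X] L)).Monic := by
      rw [hc.split]; exact monic_prod_of_monic _ _ fun i _ => monic_X_sub_C _
    exact Polynomial.monic_of_injective (algMap_inj k F L) this
  · rw [← eval_map, hc.split, eval_prod]
    exact Finset.prod_eq_zero (Finset.mem_univ i) (by simp)

lemma core_monic (hc : Core k F L h T) : h.Monic := by
  have : (h.map (algebraMap k[X] L)).Monic := by
    rw [hc.split]; exact monic_prod_of_monic _ _ fun i _ => monic_X_sub_C _
  exact Polynomial.monic_of_injective (algMap_inj k F L) this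

lemma core_natDegree (hc : Core k F L h T) : h.natDegree = d := by
  rw [← natDegree_map_eq_of_injective (algMap_inj k F L), hc.split, natDegree_prod_of_monic _ _
    (fun i _ => monic_X_sub_C _)]
  simp

lemma core_root (hc : Core k F L h T) (i : Fin d) : eval₂ (algebraMap k[X] L) (T i) h = 0 := by
  rw [← eval_map, hc.split, eval_prod]
  exact Finset.prod_eq_zero (Finset.mem_univ i) (by simp)

lemma VV_integral (hc : Core k F L h T) {m : ℕ} {y : L} (hy : y ∈ VV k T ^ m) :
    IsIntegral k[X] y := by
  have h1 : VV k T ≤ Subalgebra.toSubmodule ((integralClosure k[X] L).restrictScalars k) := by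
    rw [VV, Submodule.span_le]
    rintro _ (rfl | rfl | ⟨i, rfl⟩)
    · exact isIntegral_one
    · exact isIntegral_algebraMap
    · exact T_integral hc i
  induction hy using Submodule.pow_induction_on_left' with
  | algebraMap r => rw [IsScalarTower.algebraMap_apply k k[X] L]; exact isIntegral_algebraMap
  | add x y i hx hy h1 h2 => exact h1.add h2
  | mem_mul m hm i x hx ih => exact IsIntegral.mul (h1 hm) ih

lemma xx_transc {k F L : Type} [Field k] [Field F] [Field L]
    [Algebra k[X] F] [IsFractionRing k[X] F] [Algebra k L] [Algebra k[X] L] [Algebra F L]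
    [IsScalarTower k k[X] L] [IsScalarTower k[X] F L] : Transcendental k (xx k L) := by
  rw [transcendental_iff]
  intro p hp
  rw [← poly_eq] at hp
  exact (map_eq_zero_iff _ (algMap_inj k F L)).1 hp

lemma xx_ne {k F L : Type} [Field k] [Field F] [Field L]
    [Algebra k[X] F] [IsFractionRing k[X] F] [Algebra k L] [Algebra k[X] L] [Algebra F L]
    [IsScalarTower k k[X] L] [IsScalarTower k[X] F L] : xx k L ≠ 0 := fun h0 => xx_transc (F := F) (h0 ▸ isAlgebraic_zero)

/-- a place at infinity -/
lemma exists_place (hc : Core k F L h T) : ∃ A : ValuationSubring L,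
    (∀ c : k, algebraMap k L c ∈ A) ∧ (xx k L)⁻¹ ∈ A.nonunits ∧
    ∀ i, T i / xx k L ∈ A := by
  set u : L := (xx k L)⁻¹ with hu
  have hut : Transcendental k u := by
    intro hh
    have := hh.inv
    rw [hu, inv_inv] at this
    exact xx_transc (F := F) this
  let S : Subring L := (aeval u : k[X] →ₐ[k] L).toRingHom.range
  have huS : u ∈ S := ⟨X, by simp⟩
  let I : Ideal S := Ideal.span {⟨u, huS⟩}
  have hI : I ≠ ⊤ := by
    rw [Ne, Ideal.span_singleton_eq_top, isUnit_iff_exists_inv]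
    rintro ⟨⟨_, P, rfl⟩, hP⟩
    have h1 : u * aeval u P = 1 := congrArg Subtype.val hP
    have h2 : aeval u (X * P - 1) = 0 := by simp [h1]
    have h3 := (transcendental_iff.1 hut) _ h2
    have := congrArg (eval 0) h3
    simp at this
  obtain ⟨A, hA, hA2⟩ := Ideal.image_subset_nonunits_valuationSubring I hI
  have hk : ∀ c : k, algebraMap k L c ∈ A := fun c => hA ⟨C c, by simp⟩
  have hu' : u ∈ A.nonunits := hA2 ⟨⟨u, huS⟩, Ideal.subset_span rfl, rfl⟩
  refine ⟨A, hk, hu', fun i => ?_⟩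
  -- integrality of T i / x
  have huA : u ∈ A := hA huS
  have hx0 : xx k L ≠ 0 := xx_ne (F := F)
  have hcoef : ∀ P : k[X], ∀ m, P.natDegree ≤ m → u ^ m * algebraMap k[X] L P ∈ A := by
    intro P m hm
    rw [poly_eq, aeval_eq_sum_range, Finset.mul_sum]
    refine sum_mem fun j hj => ?_
    have hj' : j ≤ m := by simp at hj; omega
    have : u ^ m * P.coeff j • xx k L ^ j = algebraMap k L (P.coeff j) * u ^ (m - j) := by
      rw [Algebra.smul_def, mul_left_comm]
      congr 1
      obtain ⟨l, rfl⟩ := Nat.exists_eq_add_of_le hj'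
      rw [Nat.add_sub_cancel_left, pow_add, hu, inv_pow, inv_pow]
      field_simp
    rw [this]
    exact mul_mem (hk _) (pow_mem huA _)
  -- polynomial over A
  have hIntg : IsIntegral A (T i / xx k L) := by
    let P : A[X] := X ^ d + ∑ j : Fin d, C ⟨u ^ (d - j) * algebraMap k[X] L (h.coeff j),
      hcoef _ _ (hc.wt j j.2.le)⟩ * X ^ (j : ℕ)
    refine ⟨P, ?_, ?_⟩
    · apply monic_X_pow_add
      refine (degree_sum_fin_lt _)
    · simp only [P, eval₂_add, eval₂_pow, eval₂_X, eval₂_finsetSum, eval₂_mul, eval₂_C]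
      have h1 := core_root hc i
      rw [eval₂_eq_sum_range, core_natDegree hc, Finset.sum_range_succ] at h1
      have h2 : h.coeff d = 1 := by
        have := core_monic hc
        rwa [Monic, leadingCoeff, core_natDegree hc] at this
      rw [h2, map_one, one_mul, add_comm] at h1
      have h3 := congrArg (fun z => u ^ d * z) h1
      simp only [mul_add, mul_zero, Finset.mul_sum] at h3
      rw [← h3]
      congr 1
      · rw [hu, div_pow, inv_pow]; field_simp
      · rw [Finset.sum_range]
        refine Finset.sum_congr rfl fun j _ => ?_
        show (u ^ (d - j) * algebraMap k[X] L (h.coeff j)) * _ = _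
        obtain ⟨l, hl⟩ := Nat.exists_eq_add_of_le j.2.le
        have : d - (j : ℕ) = l := by omega
        have h4 : u ^ d = u ^ (j : ℕ) * u ^ l := by rw [← pow_add, ← hl]
        rw [this, h4, hu, inv_pow, inv_pow, div_pow]
        field_simp
  obtain ⟨y, hy⟩ := (IsIntegrallyClosed.isIntegral_iff (R := A) (K := L)).1 hIntg
  rw [← hy]; exact y.2

end Core
end LineIrr
set_option linter.unusedSectionVars false
set_option linter.unusedVariables false

namespace LineIrr

section Core

variable {k F L : Type} [Field k] [Field F] [Field L]
  [Algebra k[X] F] [IsFractionRing k[X] F] [Algebra k L] [Algebra k[X] L] [Algebra F L]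
  [IsScalarTower k k[X] L] [IsScalarTower k[X] F L]
variable {d : ℕ} {h : k[X][X]} {T : Fin d → L}

/-- valuation formulation of the place at infinity -/
structure Place (A : ValuationSubring L) (T : Fin d → L) (k : Type) [Field k] [Algebra k L]
    [Algebra k[X] L] : Prop where
  const : ∀ c : k, c ≠ 0 → A.valuation (algebraMap k L c) = 1
  big : 1 < A.valuation (xx k L)
  T_le : ∀ i, A.valuation (T i) ≤ A.valuation (xx k L)

lemma place_exists (hc : Core k F L h T) : ∃ A : ValuationSubring L, Place A T k := by
  obtain ⟨A, h1, h2, h3⟩ := exists_place hc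
  have hx0 : xx k L ≠ 0 := xx_ne (F := F)
  refine ⟨A, ?_, ?_, ?_⟩
  · intro c hc
    apply le_antisymm ((A.valuation_le_one_iff _).2 (h1 c))
    have := (A.valuation_le_one_iff _).2 (h1 c⁻¹)
    rw [map_inv₀, map_inv₀] at this
    have h0 : A.valuation (algebraMap k L c) ≠ 0 := by simpa using hc
    exact (inv_le_one₀ (zero_lt_iff.2 h0)).1 this
  · rw [ValuationSubring.mem_nonunits_iff, map_inv₀] at h2
    have h0 : A.valuation (xx k L) ≠ 0 := by simpa using hx0
    exact (inv_lt_one₀ (zero_lt_iff.2 h0)).1 h2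
  · intro i
    have := (A.valuation_le_one_iff _).2 (h3 i)
    rw [map_div₀] at this
    have h0 : A.valuation (xx k L) ≠ 0 := by simpa using hx0
    exact (div_le_one₀ (zero_lt_iff.2 h0)).1 this

lemma place_const_le {A : ValuationSubring L} (hA : Place A T k) (c : k) :
    A.valuation (algebraMap k L c) ≤ 1 := by
  by_cases h : c = 0
  · simp [h]
  · exact (hA.const c h).le

lemma place_poly {A : ValuationSubring L} (hA : Place A T k) (P : k[X]) (hP : P ≠ 0) :
    A.valuation (algebraMap k[X] L P) = A.valuation (xx k L) ^ P.natDegree := by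
  induction hn : P.natDegree using Nat.strong_induction_on generalizing P with
  | _ n ih =>
    have h1 := eraseLead_add_C_mul_X_pow P
    have h2 : A.valuation (algebraMap k[X] L (C P.leadingCoeff * X ^ P.natDegree)) =
        A.valuation (xx k L) ^ P.natDegree := by
      rw [map_mul, map_pow, map_mul, map_pow]
      have : algebraMap k[X] L (C P.leadingCoeff) = algebraMap k L P.leadingCoeff :=
        (IsScalarTower.algebraMap_apply k k[X] L _).symm
      rw [this, hA.const _ (by simpa using hP), one_mul, xx]
    rw [← h1, map_add]
    by_cases h0 : P.eraseLead = 0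
    · rw [h0, map_zero, zero_add, h2, hn]
    · have h3 : P.eraseLead.natDegree < n := by
        rcases eraseLead_natDegree_lt_or_eraseLead_eq_zero P with h | h
        · omega
        · exact absurd h h0
      have h4 := ih _ h3 _ h0 rfl
      rw [Valuation.map_add_eq_of_lt_right, h2, hn]
      rw [h4, h2, hn]
      exact pow_lt_pow_right₀ hA.big h3

lemma place_VV {A : ValuationSubring L} (hA : Place A T k) {m : ℕ} {y : L}
    (hy : y ∈ VV k T ^ m) : A.valuation y ≤ A.valuation (xx k L) ^ m := by
  have hV : ∀ y ∈ VV k T, A.valuation y ≤ A.valuation (xx k L) := by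
    intro y hy
    induction hy using Submodule.span_induction with
    | mem x hx =>
      rcases hx with rfl | rfl | ⟨i, rfl⟩
      · rw [map_one]; exact hA.big.le
      · exact le_rfl
      · exact hA.T_le i
    | zero => simp
    | add x y _ _ h1 h2 => exact Valuation.map_add_le _ h1 h2
    | smul a x _ h1 =>
      rw [Algebra.smul_def, map_mul]
      exact (mul_le_mul' (place_const_le hA a) h1).trans_eq (one_mul _)
  induction hy using Submodule.pow_induction_on_left' with
  | algebraMap r => simpa using place_const_le hA r
  | add x y i hx hy h1 h2 => exact Valuation.map_add_le _ h1 h2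
  | mem_mul m hm i x hx ih =>
    rw [map_mul, pow_succ']
    exact mul_le_mul' (hV m hm) ih

lemma deg_le (hc : Core k F L h T) (P : k[X]) {m : ℕ}
    (hP : algebraMap k[X] L P ∈ VV k T ^ m) : P.natDegree ≤ m := by
  obtain ⟨A, hA⟩ := place_exists hc
  by_cases h0 : P = 0
  · simp [h0]
  have := place_VV hA hP
  rw [place_poly hA P h0] at this
  exact (pow_le_pow_iff_right₀ hA.big).1 this

lemma desc_int [FiniteDimensional F L] [IsGalois F L] {y : L} (hi : IsIntegral k[X] y)
    (hy : ∀ g : L ≃ₐ[F] L, g y = y) : ∃ P : k[X], algebraMap k[X] L P = y := by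
  have h1 := (IsGalois.mem_bot_iff_fixed (F := F) y).2 hy
  obtain ⟨z, rfl⟩ := h1
  have h2 : IsIntegral k[X] z := by
    have : algebraMap F L z = Algebra.ofId F L z := rfl
    exact (isIntegral_algebraMap_iff (algebraMap F L).injective).1 hi
  obtain ⟨P, rfl⟩ := (IsIntegrallyClosed.isIntegral_iff (R := k[X]) (K := F)).1 h2
  exact ⟨P, IsScalarTower.algebraMap_apply k[X] F L P⟩

lemma desc [FiniteDimensional F L] [IsGalois F L] (hc : Core k F L h T) {m : ℕ} {y : L}
    (hm : y ∈ VV k T ^ m) (hy : ∀ g : L ≃ₐ[F] L, g y = y) :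
    ∃ P : k[X], P.natDegree ≤ m ∧ algebraMap k[X] L P = y := by
  obtain ⟨P, hP⟩ := desc_int (VV_integral hc hm) hy
  exact ⟨P, deg_le hc P (by rwa [hP]), hP⟩

lemma core_eval (hc : Core k F L h T) (P : k[X]) :
    algebraMap k[X] L (h.eval P) = ∏ i, (algebraMap k[X] L P - T i) := by
  have h2 := congrArg (eval (algebraMap k[X] L P)) hc.split
  rw [eval_prod] at h2
  simp only [eval_sub, eval_X, eval_C] at h2
  rw [← h2, eval_map, eval₂_at_apply]

/-- The points at infinity are distinct. -/
def TopSep (d : ℕ) (h : k[X][X]) : Prop :=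
  ∃ s : Fin d → k, Function.Injective s ∧
    ∀ j, ∑ i ∈ Finset.range (d + 1), (h.coeff i).coeff (d - i) * s j ^ i = 0

lemma place_top {A : ValuationSubring L} (hc : Core k F L h T) (hA : Place A T k)
    (hB : TopSep d h) {i j : Fin d} (hij : i ≠ j) :
    A.valuation (T i - T j) = A.valuation (xx k L) := by
  obtain ⟨s, hs, hs0⟩ := hB
  set v := A.valuation
  set x := xx k L
  have hx0 : x ≠ 0 := xx_ne (F := F)
  have key : ∀ j, ∃ i, v (algebraMap k L (s j) * x - T i) < v x := by
    intro j
    by_contra hcon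
    push Not at hcon
    have h1 : algebraMap k[X] L (h.eval (C (s j) * X)) =
        ∏ i, (algebraMap k L (s j) * x - T i) := by
      rw [core_eval hc, map_mul, ← xx]
      have : algebraMap k[X] L (C (s j)) = algebraMap k L (s j) :=
        (IsScalarTower.algebraMap_apply k k[X] L _).symm
      rw [this]
    have h2 : (h.eval (C (s j) * X)).natDegree < d ∨ h.eval (C (s j) * X) = 0 := by
      have hd : (h.eval (C (s j) * X)).natDegree ≤ d := by
        rw [eval_eq_sum_range, core_natDegree hc]
        refine natDegree_sum_le_of_forall_le _ _ fun i hi => ?_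
        simp only [Finset.mem_range] at hi
        rw [mul_pow, ← C_pow]
        refine natDegree_mul_le.trans ?_
        have h5 := hc.wt i (by omega)
        have h6 := natDegree_C_mul_X_pow_le (s j ^ i) i
        omega
      have hd2 : (h.eval (C (s j) * X)).coeff d = 0 := by
        rw [eval_eq_sum_range, core_natDegree hc, finsetSum_coeff, ← hs0 j]
        refine Finset.sum_congr rfl fun i hi => ?_
        simp only [Finset.mem_range] at hi
        rw [mul_pow, ← C_pow, mul_left_comm, coeff_C_mul, coeff_mul_X_pow', if_pos (by omega)]
        ring
      rcases hd.lt_or_eq with hlt | heq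
      · exact Or.inl hlt
      · right
        rwa [← heq, coeff_natDegree, leadingCoeff_eq_zero] at hd2
    have h3 : v x ^ d ≤ v (algebraMap k[X] L (h.eval (C (s j) * X))) := by
      rw [h1, map_prod]
      calc v x ^ d = ∏ i : Fin d, v x := by simp
        _ ≤ _ := Finset.prod_le_prod' fun i _ => hcon i
    rcases h2 with h2 | h2
    · by_cases h0 : h.eval (C (s j) * X) = 0
      · rw [h0] at h3
        simp at h3
        exact hx0 h3.1
      rw [place_poly hA _ h0] at h3
      have := (pow_le_pow_iff_right₀ hA.big).1 h3
      omega
    · rw [h2] at h3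
      simp at h3
      exact hx0 h3.1
  choose τ hτ using key
  have hvs : ∀ a b, a ≠ b → v (algebraMap k L (s a) * x - algebraMap k L (s b) * x) = v x := by
    intro a b hab
    rw [← sub_mul, map_mul, ← map_sub, hA.const _ (sub_ne_zero.2 fun h => hab (hs h)), one_mul]
  have τinj : Function.Injective τ := by
    intro a b hab
    by_contra hne
    have h1 := hvs a b hne
    have h2 : algebraMap k L (s a) * x - algebraMap k L (s b) * x =
      (algebraMap k L (s a) * x - T (τ a)) - (algebraMap k L (s b) * x - T (τ b)) := by
      rw [hab]; ring
    rw [h2] at h1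
    have := Valuation.map_sub_lt v (hτ a) (hτ b)
    exact absurd h1 this.ne
  have τsurj := (Finite.injective_iff_surjective.1 τinj)
  obtain ⟨a, rfl⟩ := τsurj i
  obtain ⟨b, rfl⟩ := τsurj j
  have hab : a ≠ b := fun h => hij (h ▸ rfl)
  have h2 : T (τ a) - T (τ b) = (algebraMap k L (s a) * x - algebraMap k L (s b) * x) -
     ((algebraMap k L (s a) * x - T (τ a)) - (algebraMap k L (s b) * x - T (τ b))) := by ring
  have h3 := Valuation.map_sub_lt v (hτ a) (hτ b)
  rw [h2, Valuation.map_sub_eq_of_lt_left]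
  · exact hvs a b hab
  · rw [hvs a b hab]; exact h3

end Core
end LineIrr
set_option linter.unusedSectionVars false
set_option linter.unusedVariables false

namespace LineIrr

section Core

variable {k F L : Type} [Field k] [Field F] [Field L]
  [Algebra k[X] F] [IsFractionRing k[X] F] [Algebra k L] [Algebra k[X] L] [Algebra F L]
  [IsScalarTower k k[X] L] [IsScalarTower k[X] F L]
variable {d : ℕ} {h : k[X][X]} {T : Fin d → L}

variable (k) in
/-- the ring of functions -/
noncomputable def RR (T : Fin d → L) : Subalgebra k[X] L := Algebra.adjoin k[X] (Set.range T)

lemma T_mem_RR (i : Fin d) : T i ∈ RR k T := Algebra.subset_adjoin ⟨i, rfl⟩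
lemma poly_mem_RR (P : k[X]) : algebraMap k[X] L P ∈ RR k T := (RR k T).algebraMap_mem P
lemma xx_mem_RR : xx k L ∈ RR k T := poly_mem_RR X

lemma VV_le_RR {m : ℕ} {y : L} (hy : y ∈ VV k T ^ m) : y ∈ RR k T := by
  have h1 : ∀ y ∈ VV k T, y ∈ RR k T := by
    intro y hy
    induction hy using Submodule.span_induction with
    | mem x hx =>
      rcases hx with rfl | rfl | ⟨i, rfl⟩
      · exact one_mem _
      · exact xx_mem_RR
      · exact T_mem_RR i
    | zero => exact zero_mem _
    | add x y _ _ h1 h2 => exact add_mem h1 h2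
    | smul a x _ h1 =>
      rw [Algebra.smul_def, IsScalarTower.algebraMap_apply k k[X] L]
      exact mul_mem (poly_mem_RR _) h1
  induction hy using Submodule.pow_induction_on_left' with
  | algebraMap r => rw [IsScalarTower.algebraMap_apply k k[X] L]; exact poly_mem_RR _
  | add x y i hx hy h1 h2 => exact add_mem h1 h2
  | mem_mul m hm i x hx ih => exact mul_mem (h1 m hm) ih

lemma RR_mem {y : L} (hy : y ∈ RR k T) : ∃ m, y ∈ VV k T ^ m := by
  induction hy using Algebra.adjoin_induction with
  | mem x hx => obtain ⟨i, rfl⟩ := hx; exact ⟨1, by simpa using T_mem_VV i⟩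
  | algebraMap P => exact ⟨P.natDegree, VV_poly P le_rfl⟩
  | add x y _ _ h1 h2 =>
    obtain ⟨m, hm⟩ := h1
    obtain ⟨n, hn⟩ := h2
    exact ⟨max m n, add_mem (VV_mono (le_max_left _ _) hm) (VV_mono (le_max_right _ _) hn)⟩
  | mul x y _ _ h1 h2 =>
    obtain ⟨m, hm⟩ := h1
    obtain ⟨n, hn⟩ := h2
    exact ⟨m + n, VV_mul hm hn⟩

/-- monomials in the roots -/
noncomputable def mon (T : Fin d → L) (β : Fin d → Fin d) : L := ∏ i, T i ^ (β i : ℕ)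

lemma mon_mem (β : Fin d → Fin d) : mon T β ∈ VV k T ^ (d * d) := by
  have h1 : mon T β ∈ VV k T ^ (∑ i, (β i : ℕ)) :=
    VV_prod _ _ _ fun i _ => by
      have := VV_pow (k := k) (T := T) (m := 1) (n := β i) (a := T i) (by simpa using T_mem_VV i)
      simpa using this
  refine VV_mono ?_ h1
  calc ∑ i, (β i : ℕ) ≤ ∑ i : Fin d, d := Finset.sum_le_sum fun i _ => (β i).2.le
    _ = d * d := by simp

lemma mon_span (hc : Core k F L h T) : Submodule.span F (Set.range (mon T)) = ⊤ := by
  set S := Submodule.span F (Set.range (mon T)) with hS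
  have hmul : ∀ i, ∀ y ∈ S, T i * y ∈ S := by
    intro i y hy
    induction hy using Submodule.span_induction with
    | mem x hx =>
      obtain ⟨β, rfl⟩ := hx
      set m' : L := ∏ j ∈ Finset.univ.erase i, T j ^ (β j : ℕ) with hm'
      have hmon : ∀ c : Fin d, mon T (Function.update β i c) = T i ^ (c : ℕ) * m' := by
        intro c
        rw [mon, ← Finset.mul_prod_erase _ _ (Finset.mem_univ i)]
        congr 1
        · simp
        · refine Finset.prod_congr rfl fun j hj => ?_
          rw [Function.update_of_ne (Finset.ne_of_mem_erase hj)]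
      have hall : ∀ n, n < d → T i ^ n * m' ∈ S := fun n hn =>
        Submodule.subset_span ⟨Function.update β i ⟨n, hn⟩, hmon _⟩
      have hb : mon T β = T i ^ (β i : ℕ) * m' := by
        rw [← hmon, Function.update_eq_self]
      rw [hb, ← mul_assoc, ← pow_succ']
      by_cases hlt : (β i : ℕ) + 1 < d
      · exact hall _ hlt
      · have heq : (β i : ℕ) + 1 = d := by have := (β i).2; omega
        rw [heq]
        have h1 := core_root hc i
        rw [eval₂_eq_sum_range, core_natDegree hc, Finset.sum_range_succ] at h1
        have h2 : h.coeff d = 1 := by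
          have := core_monic hc
          rwa [Monic, leadingCoeff, core_natDegree hc] at this
        rw [h2, map_one, one_mul] at h1
        rw [eq_neg_of_add_eq_zero_right h1, neg_mul, Finset.sum_mul]
        refine neg_mem (Submodule.sum_mem _ fun j hj => ?_)
        rw [mul_assoc, IsScalarTower.algebraMap_apply k[X] F L, ← Algebra.smul_def]
        exact Submodule.smul_mem _ _ (hall j (Finset.mem_range.1 hj))
    | zero => simp
    | add x y _ _ h1 h2 => rw [mul_add]; exact add_mem h1 h2
    | smul a x _ h1 => rw [mul_smul_comm]; exact Submodule.smul_mem _ _ h1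
  have h1S : (1 : L) ∈ S ∨ d = 0 ∧ True := by
    rcases Nat.eq_zero_or_pos d with h0 | hpos
    · exact Or.inr ⟨h0, trivial⟩
    · left
      refine Submodule.subset_span ⟨fun _ => ⟨0, hpos⟩, by simp [mon]⟩
  have h1S : (1 : L) ∈ S := by
    rcases h1S with h | ⟨rfl, -⟩
    · exact h
    · exact Submodule.subset_span ⟨fun i => i.elim0, by simp [mon]⟩
  rw [eq_top_iff]
  intro y _
  have hy : y ∈ Algebra.adjoin F (Set.range T) := by rw [hc.gen]; trivial
  have : ∀ y ∈ Algebra.adjoin F (Set.range T), ∀ z ∈ S, y * z ∈ S := by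
    intro y hy
    induction hy using Algebra.adjoin_induction with
    | mem x hx => obtain ⟨i, rfl⟩ := hx; exact hmul i
    | algebraMap a => intro z hz; rw [← Algebra.smul_def]; exact Submodule.smul_mem _ _ hz
    | add x y _ _ h1 h2 => intro z hz; rw [add_mul]; exact add_mem (h1 z hz) (h2 z hz)
    | mul x y _ _ h1 h2 => intro z hz; rw [mul_assoc]; exact h1 _ (h2 z hz)
  simpa using this y hy 1 h1S

lemma finrank_le (hc : Core k F L h T) : Module.finrank F L ≤ d ^ d := by
  have h1 := finrank_range_le_card (R := F) (mon T)
  rw [Set.finrank, mon_span hc, finrank_top] at h1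
  simpa using h1

lemma exists_basis [FiniteDimensional F L] (hc : Core k F L h T) :
    ∃ β : Fin (Module.finrank F L) → Fin d → Fin d, LinearIndependent F (fun l => mon T (β l)) := by
  obtain ⟨b, hb1, hb2, hb3⟩ := exists_linearIndependent F (Set.range (mon T))
  rw [mon_span hc] at hb2
  let B : Module.Basis b F L := Module.Basis.mk hb3 (by simp [hb2])
  have hfin : Finite b := Module.Finite.finite_basis B
  have hcard : Nat.card b = Module.finrank F L := (Module.finrank_eq_nat_card_basis B).symm
  let eq := Finite.equivFinOfCardEq hcard
  have : ∀ z : b, ∃ β, mon T β = z := fun z => hb1 z.2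
  choose f hf using this
  refine ⟨fun l => f (eq.symm l), ?_⟩
  have h5 := hb3.comp eq.symm eq.symm.injective
  have heq : (fun l => mon T (f (eq.symm l))) = Subtype.val ∘ eq.symm := _root_.funext fun l => hf _
  rw [heq]
  exact h5

end Core
end LineIrr
set_option linter.unusedSectionVars false
set_option linter.unusedVariables false

namespace LineIrr

section Core

variable {k F L : Type} [Field k] [Field F] [Field L]
  [Algebra k[X] F] [IsFractionRing k[X] F] [Algebra k L] [Algebra k[X] L] [Algebra F L]
  [IsScalarTower k k[X] L] [IsScalarTower k[X] F L]
variable {d : ℕ} {h : k[X][X]} {T : Fin d → L}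

/-- explicit linearly independent family -/
lemma basis_indep {ι : Type} {e : ι → L} (he : LinearIndependent F e) (n : ℕ) :
    LinearIndependent k (fun p : Fin n × ι => xx k L ^ (p.1 : ℕ) * e p.2) := by
  have h1 : LinearIndependent k[X] e := (LinearIndependent.iff_fractionRing k[X] F).2 he
  have h2 : LinearIndependent k (fun j : Fin n => (X : k[X]) ^ (j : ℕ)) := by
    have := (Polynomial.basisMonomials k).linearIndependent.comp (fun j : Fin n => (j : ℕ))
      Fin.val_injective
    have heq : (fun j : Fin n => (X : k[X]) ^ (j : ℕ)) =
      (Polynomial.basisMonomials k) ∘ (fun j : Fin n => (j : ℕ)) := by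
      funext j; simp [monomial_one_right_eq_X_pow]
    rw [heq]; exact this
  have h3 := linearIndependent_smul h2 h1
  have heq : (fun p : Fin n × ι => xx k L ^ (p.1 : ℕ) * e p.2) =
      fun p : Fin n × ι => (X : k[X]) ^ (p.1 : ℕ) • e p.2 := by
    funext p; rw [Algebra.smul_def, map_pow, xx]
  rw [heq]; exact h3

lemma VV_xpow_mul {w n : ℕ} {e : L} (he : e ∈ VV k T ^ w) (j : Fin n) :
    xx k L ^ (j : ℕ) * e ∈ VV k T ^ (n - 1 + w) := by
  have h1 : xx k L ^ (j : ℕ) ∈ VV k T ^ (1 * (j : ℕ)) := VV_pow (by simpa using xx_mem_VV)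
  have h2 : xx k L ^ (j : ℕ) ∈ VV k T ^ (n - 1) := VV_mono (by have := j.2; omega) h1
  exact VV_mul h2 he

lemma dim_lower [FiniteDimensional F L] (hc : Core k F L h T) (m : ℕ) :
    Module.finrank F L * (m - d * d) ≤ Module.finrank k ↥(VV k T ^ m) := by
  obtain ⟨β, hβ⟩ := exists_basis hc
  rcases Nat.lt_or_ge (d * d) m with hm | hm
  swap
  · rw [Nat.sub_eq_zero_of_le hm]; simp
  have h1 := basis_indep (k := k) hβ (m - d * d)
  let f : Fin (m - d * d) × Fin (Module.finrank F L) → ↥(VV k T ^ m) := fun p =>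
    ⟨xx k L ^ (p.1 : ℕ) * mon T (β p.2), VV_mono (by omega) (VV_xpow_mul (mon_mem (β p.2)) p.1)⟩
  have h2 : LinearIndependent k f := by
    apply LinearIndependent.of_comp (VV k T ^ m).subtype
    exact h1
  have := h2.fintype_card_le_finrank
  simpa [mul_comm] using this

lemma trL_mem [FiniteDimensional F L] [IsGalois F L] (hc : Core k F L h T) {m : ℕ} {y : L}
    (hy : y ∈ VV k T ^ m) : ∃ P : k[X], P.natDegree ≤ m ∧
      algebraMap k[X] L P = ∑ g : L ≃ₐ[F] L, g y := by
  apply desc hc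
  · exact Submodule.sum_mem _ fun g _ => gal_VV hc g hy
  · intro g
    rw [map_sum]
    exact Fintype.sum_equiv (Equiv.mulLeft g) _ _ fun g' => rfl

lemma trL_zero [FiniteDimensional F L] [IsGalois F L] {y : L} {ι : Type} {e : ι → L}
    (he : Submodule.span F (Set.range e) = ⊤)
    (hy : ∀ l, ∑ g : L ≃ₐ[F] L, g (y * e l) = 0) : y = 0 := by
  have h1 : ∀ l, Algebra.trace F L (y * e l) = 0 := by
    intro l
    apply (algebraMap F L).injective
    rw [trace_eq_sum_automorphisms, map_zero, hy]
  refine (traceForm_nondegenerate F L).1 y fun z => ?_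
  rw [Algebra.traceForm_apply]
  have hz : z ∈ Submodule.span F (Set.range e) := by rw [he]; trivial
  induction hz using Submodule.span_induction with
  | mem x hx => obtain ⟨l, rfl⟩ := hx; exact h1 l
  | zero => simp
  | add a b _ _ h1 h2 => rw [mul_add, map_add, h1, h2, add_zero]
  | smul a x _ h1 => rw [mul_smul_comm, map_smul, h1, smul_zero]

lemma dim_upper [FiniteDimensional F L] [IsGalois F L] (hc : Core k F L h T) (m : ℕ) :
    Module.finrank k ↥(VV k T ^ m) ≤ Module.finrank F L * (m + d * d + 1) := by
  obtain ⟨β, hβ⟩ := exists_basis hc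
  have hspan : Submodule.span F (Set.range (fun l => mon T (β l))) = ⊤ :=
    hβ.span_eq_top_of_card_eq_finrank' (by simp)
  let U : Submodule k L := (degreeLT k (m + d * d + 1)).map
    (IsScalarTower.toAlgHom k k[X] L).toLinearMap
  have hUfin : FiniteDimensional k (degreeLT k (m + d * d + 1)) :=
    Module.Finite.equiv (degreeLTEquiv k _).symm
  have hU : Module.finrank k U ≤ m + d * d + 1 := by
    refine (Submodule.finrank_map_le _ _).trans ?_
    rw [(degreeLTEquiv k _).finrank_eq]; simp
  have hmem : ∀ (y : ↥(VV k T ^ m)) l, ∑ g : L ≃ₐ[F] L, g (y.1 * mon T (β l)) ∈ U := by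
    intro y l
    obtain ⟨P, hP, hP2⟩ := trL_mem hc (VV_mul y.2 (mon_mem (β l)))
    rw [← hP2]
    refine ⟨P, ?_, rfl⟩
    rw [SetLike.mem_coe, mem_degreeLT]
    exact lt_of_le_of_lt degree_le_natDegree (by exact_mod_cast Nat.lt_succ_of_le hP)
  let f : ↥(VV k T ^ m) →ₗ[k] (Fin (Module.finrank F L) → U) :=
    { toFun := fun y l => ⟨_, hmem y l⟩
      map_add' := fun y z => by
        funext l; apply Subtype.ext
        simp [add_mul, Finset.sum_add_distrib]
      map_smul' := fun c y => by
        funext l; apply Subtype.ext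
        simp only [Submodule.coe_smul, RingHom.id_apply, Pi.smul_apply]
        rw [Finset.smul_sum]
        refine Finset.sum_congr rfl fun g _ => ?_
        rw [Algebra.smul_def, Algebra.smul_def, mul_assoc, map_mul, gal_const] }
  have hf : Function.Injective f := by
    rw [injective_iff_map_eq_zero]
    intro y hy
    apply Subtype.ext
    refine trL_zero hspan fun l => ?_
    have := congrFun hy l
    exact congrArg Subtype.val this
  refine (LinearMap.finrank_le_finrank_of_injective hf).trans ?_
  rw [Module.finrank_pi_fintype]
  simp only [Finset.sum_const, Finset.card_univ, Fintype.card_fin, smul_eq_mul]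
  exact Nat.mul_le_mul le_rfl hU

/-- the zero lemma -/
lemma zero_lemma [FiniteDimensional F L] [IsGalois F L] (hc : Core k F L h T) {n : ℕ}
    (y : RR k T) (hy0 : y ≠ 0) (hy : (y : L) ∈ VV k T ^ n) (I : Ideal (RR k T)) (hI : y ∈ I) :
    Module.rank k (RR k T ⧸ I) ≤ (Module.finrank F L * (n + 2 * (d * d) + 1) : ℕ) := by
  apply rank_le
  intro s hs
  have h1 : ∀ z : RR k T ⧸ I, ∃ m, ∃ u : RR k T, (u : L) ∈ VV k T ^ m ∧ Ideal.Quotient.mk I u = z := by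
    intro z
    obtain ⟨u, rfl⟩ := Ideal.Quotient.mk_surjective z
    obtain ⟨m, hm⟩ := RR_mem u.2
    exact ⟨m, u, hm, rfl⟩
  choose M u hu1 hu2 using h1
  set m := s.sup M + n + d * d with hm
  let incl : ↥(VV k T ^ m) →ₗ[k] RR k T :=
    { toFun := fun z => ⟨z.1, VV_le_RR z.2⟩
      map_add' := fun _ _ => rfl
      map_smul' := fun _ _ => rfl }
  let f : ↥(VV k T ^ m) →ₗ[k] (RR k T ⧸ I) := (Ideal.Quotient.mkₐ k I).toLinearMap ∘ₗ incl
  have hfin : FiniteDimensional k (LinearMap.range f) := inferInstance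
  have hcard : s.card ≤ Module.finrank k (LinearMap.range f) := by
    let t : s → LinearMap.range f := fun z => ⟨z.1, ⟨⟨u z.1, VV_mono
      (by have := Finset.le_sup (f := M) z.2; omega) (hu1 z.1)⟩, hu2 z.1⟩⟩
    have ht : LinearIndependent k t := by
      apply LinearIndependent.of_comp (LinearMap.range f).subtype
      exact hs
    have h9 := ht.fintype_card_le_finrank
    rwa [Fintype.card_coe] at h9
  have hker : Module.finrank k ↥(VV k T ^ (m - n)) ≤ Module.finrank k (LinearMap.ker f) := by
    let g : ↥(VV k T ^ (m - n)) →ₗ[k] LinearMap.ker f :=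
      { toFun := fun z => ⟨⟨y.1 * z.1, by
            have := VV_mul hy z.2
            rwa [Nat.add_sub_cancel' (by omega)] at this⟩, by
            rw [LinearMap.mem_ker]
            show Ideal.Quotient.mk I ⟨y.1 * z.1, _⟩ = 0
            rw [Ideal.Quotient.eq_zero_iff_mem]
            exact I.mul_mem_right ⟨z.1, VV_le_RR z.2⟩ hI⟩
        map_add' := fun a b => by
          apply Subtype.ext; apply Subtype.ext; simp [mul_add]
        map_smul' := fun a b => by
          apply Subtype.ext; apply Subtype.ext; simp }
    apply LinearMap.finrank_le_finrank_of_injective (f := g)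
    intro a b hab
    have h2 : y.1 * a.1 = y.1 * b.1 := congrArg (fun z => z.1.1) hab
    exact Subtype.ext (mul_left_cancel₀ (fun h => hy0 (Subtype.ext h)) h2)
  have hrn := LinearMap.finrank_range_add_finrank_ker f
  have hup := dim_upper hc m
  have hlo := dim_lower hc (m - n)
  have e1 : m - n - d * d = s.sup M := by omega
  rw [e1] at hlo
  have e2 : Module.finrank F L * (m + d * d + 1) = Module.finrank F L * s.sup M +
     Module.finrank F L * (n + 2 * (d * d) + 1) := by rw [hm]; ring
  omega

end Core
end LineIrr
set_option linter.unusedSectionVars false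
set_option linter.unusedVariables false

namespace LineIrr

section Core

variable {k F L : Type} [Field k] [Field F] [Field L]
  [Algebra k[X] F] [IsFractionRing k[X] F] [Algebra k L] [Algebra k[X] L] [Algebra F L]
  [IsScalarTower k k[X] L] [IsScalarTower k[X] F L]
variable {d : ℕ} {h : k[X][X]} {T : Fin d → L}

lemma exists_point {A : Type} [CommRing A] [Algebra k A] [Algebra.FiniteType k A] [IsAlgClosed k]
    (I : Ideal A) (hI : I ≠ ⊤) : ∃ φ : A →ₐ[k] k, ∀ a ∈ I, φ a = 0 := by
  obtain ⟨𝔪, hm, hle⟩ := Ideal.exists_le_maximal I hI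
  let _ : Field (A ⧸ 𝔪) := Ideal.Quotient.field 𝔪
  have : Algebra.FiniteType k (A ⧸ 𝔪) :=
    Algebra.FiniteType.of_surjective (Ideal.Quotient.mkₐ k 𝔪) (Ideal.Quotient.mkₐ_surjective k 𝔪)
  have : Module.Finite k (A ⧸ 𝔪) := finite_of_finite_type_of_isJacobsonRing k (A ⧸ 𝔪)
  have hb : Function.Bijective (algebraMap k (A ⧸ 𝔪)) :=
    IsAlgClosed.algebraMap_bijective_of_isIntegral
  let e : k ≃ₐ[k] (A ⧸ 𝔪) := AlgEquiv.ofBijective (Algebra.ofId k (A ⧸ 𝔪)) hb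
  refine ⟨e.symm.toAlgHom.comp (Ideal.Quotient.mkₐ k 𝔪), fun a ha => ?_⟩
  have : Ideal.Quotient.mkₐ k 𝔪 a = 0 := Ideal.Quotient.eq_zero_iff_mem.2 (hle ha)
  show e.symm (Ideal.Quotient.mkₐ k 𝔪 a) = 0
  rw [this, map_zero]

lemma chain_le {A : Type} [CommRing A] [Algebra k A] (J : ℕ → Ideal A) (n : ℕ)
    (hJ : ∀ i < n, J (i + 1) < J i) (hfin : Module.Finite k (A ⧸ J n)) :
    n ≤ Module.finrank k (A ⧸ J n) := by
  induction n with
  | zero => simp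
  | succ n ih =>
    have hlt := hJ n (Nat.lt_succ_self n)
    let f : (A ⧸ J (n + 1)) →ₐ[k] (A ⧸ J n) := Ideal.Quotient.factorₐ k hlt.le
    have hf : Function.Surjective f := Ideal.Quotient.factor_surjective hlt.le
    have hfin' : Module.Finite k (A ⧸ J n) := Module.Finite.of_surjective f.toLinearMap hf
    have h1 := ih (fun i hi => hJ i (hi.trans (Nat.lt_succ_self n))) hfin'
    have h2 := LinearMap.finrank_range_add_finrank_ker f.toLinearMap
    rw [LinearMap.range_eq_top.2 hf, finrank_top] at h2
    have h3 : 0 < Module.finrank k (LinearMap.ker f.toLinearMap) := by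
      obtain ⟨a, ha1, ha2⟩ := SetLike.exists_of_lt hlt
      have : Nontrivial (LinearMap.ker f.toLinearMap) := by
        refine ⟨⟨⟨Ideal.Quotient.mk _ a, ?_⟩, 0, ?_⟩⟩
        · rw [LinearMap.mem_ker]
          exact Ideal.Quotient.eq_zero_iff_mem.2 ha1
        · intro h0
          exact ha2 (Ideal.Quotient.eq_zero_iff_mem.1 (congrArg Subtype.val h0))
      exact Module.finrank_pos
    omega

lemma crt_le {A : Type} [CommRing A] [Algebra k A] {ι : Type} [Fintype ι] (f : ι → Ideal A)
    (hf : Pairwise (Function.onFun IsCoprime f)) (M : ℕ)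
    (hfin : Module.Finite k (A ⧸ ⨅ i, f i))
    (hM : ∀ i, Module.Finite k (A ⧸ f i) → M ≤ Module.finrank k (A ⧸ f i)) :
    Fintype.card ι * M ≤ Module.finrank k (A ⧸ ⨅ i, f i) := by
  have hfi : ∀ i, Module.Finite k (A ⧸ f i) := fun i =>
    Module.Finite.of_surjective (Ideal.Quotient.factorₐ k (iInf_le f i)).toLinearMap
      (Ideal.Quotient.factor_surjective (iInf_le f i))
  let g : (A ⧸ ⨅ i, f i) →ₗ[k] ((i : ι) → A ⧸ f i) :=
    LinearMap.pi fun i => (Ideal.Quotient.factorₐ k (iInf_le f i)).toLinearMap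
  have hg : Function.Surjective g := by
    intro z
    obtain ⟨a, ha⟩ := Ideal.quotientInfToPiQuotient_surj hf z
    refine ⟨a, ?_⟩
    rw [← ha]
    obtain ⟨b, rfl⟩ := Ideal.Quotient.mk_surjective a
    rfl
  have h1 := LinearMap.finrank_le_finrank_of_surjective hg
  rw [Module.finrank_pi_fintype] at h1
  refine le_trans ?_ h1
  calc Fintype.card ι * M = ∑ i : ι, M := by simp
    _ ≤ _ := Finset.sum_le_sum fun i _ => hM i (hfi i)

instance RR_ft : Algebra.FiniteType k[X] (RR k T) :=
  Subalgebra.fg_iff_finiteType _ |>.1 ⟨(Set.finite_range T).toFinset, by simp [RR]⟩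

instance RR_ftk : Algebra.FiniteType k (RR k T) :=
  Algebra.FiniteType.trans (S := k[X]) inferInstance inferInstance

instance RR_noeth : IsNoetherianRing (RR k T) := Algebra.FiniteType.isNoetherianRing k _

variable (k T) in
/-- x as an element of R -/
noncomputable def xR : RR k T := algebraMap k[X] (RR k T) X

variable (k T) in
/-- T as element of R -/
noncomputable def tR (i : Fin d) : RR k T := ⟨T i, T_mem_RR i⟩

lemma phi_poly (φ : RR k T →ₐ[k] k) (P : k[X]) :
    φ (algebraMap k[X] (RR k T) P) = P.eval (φ (xR k T)) := by
  have : φ.comp (IsScalarTower.toAlgHom k k[X] (RR k T)) = aeval (φ (xR k T)) := by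
    ext; simp [xR]
  have h2 := DFunLike.congr_fun this P
  simpa [aeval_def, eval₂_eq_eval_map] using h2

lemma phi_poly' (φ : RR k T →ₐ[k] k) (P : k[X]) (y : RR k T)
    (hy : (y : L) = algebraMap k[X] L P) : φ y = P.eval (φ (xR k T)) := by
  rw [← phi_poly]; congr 1; exact Subtype.ext hy

/-- action of the Galois group on R -/
noncomputable def galR (hc : Core k F L h T) (g : L ≃ₐ[F] L) : RR k T →ₐ[k] RR k T where
  toFun y := ⟨g y.1, by obtain ⟨m, hm⟩ := RR_mem y.2; exact VV_le_RR (gal_VV hc g hm)⟩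
  map_one' := Subtype.ext (map_one g)
  map_zero' := Subtype.ext (map_zero g)
  map_mul' a b := Subtype.ext (map_mul g _ _)
  map_add' a b := Subtype.ext (map_add g _ _)
  commutes' c := Subtype.ext (gal_const g c)

@[simp] lemma galR_coe (hc : Core k F L h T) (g : L ≃ₐ[F] L) (y : RR k T) :
    (galR hc g y : L) = g y := rfl

lemma galR_xR (hc : Core k F L h T) (g : L ≃ₐ[F] L) : galR hc g (xR k T) = xR k T :=
  Subtype.ext (gal_poly g X)

lemma RR_integral (hc : Core k F L h T) (y : RR k T) : IsIntegral k[X] (y : L) := by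
  obtain ⟨m, hm⟩ := RR_mem y.2
  exact VV_integral hc hm

lemma exists_phi [IsAlgClosed k] [FiniteDimensional F L] [IsGalois F L] (hc : Core k F L h T)
    (x0 : k) : ∃ φ : RR k T →ₐ[k] k, φ (xR k T) = x0 := by
  let I : Ideal (RR k T) := Ideal.span {xR k T - algebraMap k _ x0}
  have hI : I ≠ ⊤ := by
    rw [Ne, Ideal.span_singleton_eq_top, isUnit_iff_exists_inv]
    rintro ⟨u, hu⟩
    have hu' : algebraMap k[X] L (X - C x0) * u = 1 := by
      have := congrArg Subtype.val hu
      have hC : algebraMap k[X] L (C x0) = algebraMap k L x0 := (IsScalarTower.algebraMap_apply k k[X] L _).symm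
      rw [map_sub, hC]; exact this
    have hinv : ∀ g : L ≃ₐ[F] L, g u = u := by
      intro g
      have h1 := congrArg g hu'
      rw [map_mul, map_one, gal_poly, ← hu'] at h1
      refine mul_left_cancel₀ ?_ h1
      intro h0; rw [h0, zero_mul] at hu'; exact zero_ne_one hu'
    obtain ⟨P, hP⟩ := desc_int (RR_integral hc u) hinv
    rw [← hP, ← map_mul, ← map_one (algebraMap k[X] L)] at hu'
    have := congrArg (eval x0) (algMap_inj k F L hu')
    simp at this
  obtain ⟨φ, hφ⟩ := exists_point (k := k) I hI
  refine ⟨φ, ?_⟩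
  have := hφ _ (Ideal.subset_span rfl)
  rw [map_sub, sub_eq_zero] at this
  simpa using this

/-- norm lemma -/
lemma norm_lemma [FiniteDimensional F L] [IsGalois F L] (hc : Core k F L h T) {n : ℕ}
    (y : RR k T) (hy0 : y ≠ 0) (hy : (y : L) ∈ VV k T ^ n) :
    ∃ P : k[X], P ≠ 0 ∧ P.natDegree ≤ Module.finrank F L * n ∧
      ∀ φ : RR k T →ₐ[k] k, φ y = 0 → P.eval (φ (xR k T)) = 0 := by
  classical
  let z : RR k T := ∏ g : L ≃ₐ[F] L, galR hc g y
  have hz : (z : L) = ∏ g : L ≃ₐ[F] L, g y := by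
    simp [z]
  have hzV : (z : L) ∈ VV k T ^ (Module.finrank F L * n) := by
    rw [hz]
    have := VV_prod (k := k) (T := T) Finset.univ (fun g : L ≃ₐ[F] L => g y) (fun _ => n)
      fun g _ => gal_VV hc g hy
    rwa [Finset.sum_const, Finset.card_univ, smul_eq_mul, ← Nat.card_eq_fintype_card,
      IsGalois.card_aut_eq_finrank] at this
  obtain ⟨P, hP, hP2⟩ := desc hc hzV (by
    intro g
    rw [hz, map_prod]
    exact Fintype.prod_equiv (Equiv.mulLeft g) _ _ fun g' => rfl)
  refine ⟨P, ?_, hP, ?_⟩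
  · rintro rfl
    rw [map_zero, hz, eq_comm, Finset.prod_eq_zero_iff] at hP2
    obtain ⟨g, -, hg⟩ := hP2
    rw [map_eq_zero] at hg
    exact hy0 (Subtype.ext hg)
  · intro φ hφ
    rw [← phi_poly' φ P z hP2.symm, map_prod]
    exact Finset.prod_eq_zero (Finset.mem_univ 1) (by
      have : galR hc 1 y = y := Subtype.ext rfl
      rw [this, hφ])

lemma ker_ne_top (φ : RR k T →ₐ[k] k) : RingHom.ker φ ≠ ⊤ := RingHom.ker_ne_top φ

lemma xR_sub_ne (hc : Core k F L h T) (x0 : k) : xR k T - algebraMap k _ x0 ≠ 0 := by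
  intro h0
  have h1 : algebraMap k[X] L (X - C x0) = 0 := by
    have := congrArg Subtype.val h0
    have hC : algebraMap k[X] L (C x0) = algebraMap k L x0 := (IsScalarTower.algebraMap_apply k k[X] L _).symm
    rw [map_sub, hC]; exact this
  have h2 := (map_eq_zero_iff _ (algMap_inj k F L)).1 h1
  exact X_sub_C_ne_zero x0 h2

lemma ker_pow_lt (hc : Core k F L h T) (φ : RR k T →ₐ[k] k) (i : ℕ) :
    RingHom.ker φ ^ (i + 1) < RingHom.ker φ ^ i := by
  refine lt_of_le_of_ne (Ideal.pow_le_pow_right (Nat.le_succ i)) fun heq => ?_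
  have h1 := Ideal.iInf_pow_eq_bot_of_isDomain (RingHom.ker φ) (ker_ne_top φ)
  have h2 : ∀ j, RingHom.ker φ ^ i ≤ RingHom.ker φ ^ j := by
    intro j
    induction j with
    | zero => simp
    | succ j ih =>
      calc RingHom.ker φ ^ i = RingHom.ker φ ^ i * RingHom.ker φ := by rw [← pow_succ, heq]
        _ ≤ RingHom.ker φ ^ j * RingHom.ker φ := Ideal.mul_mono_left ih
        _ = _ := (pow_succ _ _).symm
  have h3 : RingHom.ker φ ^ i ≤ ⊥ := h1 ▸ le_iInf h2
  have h4 : (xR k T - algebraMap k _ (φ (xR k T))) ^ i ∈ RingHom.ker φ ^ i :=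
    Ideal.pow_mem_pow (by simp [RingHom.mem_ker]) i
  exact xR_sub_ne hc _ (eq_zero_of_pow_eq_zero (n := i) ((Submodule.mem_bot _).1 (h3 h4)))

end Core
end LineIrr
set_option linter.unusedSectionVars false
set_option linter.unusedVariables false
set_option linter.style.haveILetI false

namespace LineIrr

section Core

variable {k F L : Type} [Field k] [Field F] [Field L]
  [Algebra k[X] F] [IsFractionRing k[X] F] [Algebra k L] [Algebra k[X] L] [Algebra F L]
  [IsScalarTower k k[X] L] [IsScalarTower k[X] F L]
variable {d : ℕ} {h : k[X][X]} {T : Fin d → L}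


/-- specialization at `x0` -/
noncomputable def sp (h : k[X][X]) (x0 : k) : k[X] := h.map (evalRingHom x0)

lemma core_split_R (hc : Core k F L h T) :
    h.map (algebraMap k[X] (RR k T)) = ∏ i, (X - C (tR k T i)) := by
  apply map_injective (algebraMap (RR k T) L) Subtype.val_injective
  rw [map_map, ← IsScalarTower.algebraMap_eq k[X] (RR k T) L, hc.split, Polynomial.map_prod]
  refine Finset.prod_congr rfl fun i _ => ?_
  rw [Polynomial.map_sub, map_X, map_C]; rfl

lemma phi_split (hc : Core k F L h T) (φ : RR k T →ₐ[k] k) :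
    sp h (φ (xR k T)) = ∏ i, (X - C (φ (tR k T i))) := by
  have h1 := congrArg (Polynomial.map (φ : RR k T →+* k)) (core_split_R hc)
  rw [map_map, Polynomial.map_prod] at h1
  have h2 : (φ : RR k T →+* k).comp (algebraMap k[X] (RR k T)) = evalRingHom (φ (xR k T)) := by
    ext P
    · have := phi_poly φ (C P)
      simpa using this
    · simp [xR]
  rw [h2] at h1
  rw [sp, h1]
  refine Finset.prod_congr rfl fun i _ => ?_
  rw [Polynomial.map_sub, map_X, map_C]; rfl

/-- At most two of the roots coincide. -/
def AtMostOneDouble (t : Fin d → k) : Prop :=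
  ∀ i j a b, i ≠ j → a ≠ b → t i = t j → t a = t b → (a = i ∧ b = j) ∨ (a = j ∧ b = i)

/-- smooth affine curve (in the relevant weak form) -/
def SmoothH (h : k[X][X]) : Prop :=
  ∀ x0 t : k, (sp h x0).eval t = 0 → (derivative (sp h x0)).eval t = 0 →
    (derivative (h.eval (C t))).eval x0 ≠ 0

/-- only simple branching -/
def SimpleBr (d : ℕ) (h : k[X][X]) : Prop :=
  ∀ (x0 : k) (t : Fin d → k), sp h x0 = ∏ i, (X - C (t i)) → AtMostOneDouble t

/-- realized permutation -/
def Rlz (F : Type) [Field F] [Algebra F L] (T : Fin d → L) (σ : Equiv.Perm (Fin d)) : Prop :=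
  ∃ g : L ≃ₐ[F] L, ∀ i, g (T i) = T (σ i)

lemma gal_one_of (hc : Core k F L h T) (g : L ≃ₐ[F] L) (hg : ∀ i, g (T i) = T i) : g = 1 := by
  have h1 : (g : L →ₐ[F] L) = AlgHom.id F L := by
    apply AlgHom.ext_of_adjoin_eq_top hc.gen
    rintro _ ⟨i, rfl⟩
    exact hg i
  ext y
  exact DFunLike.congr_fun h1 y

lemma ker_inj {A : Type} [CommRing A] [Algebra k A] (φ ψ : A →ₐ[k] k)
    (hk : RingHom.ker φ ≤ RingHom.ker ψ) : φ = ψ := by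
  ext a
  have h1 : a - algebraMap k A (φ a) ∈ RingHom.ker φ := by simp [RingHom.mem_ker]
  have h2 := hk h1
  rw [RingHom.mem_ker, map_sub, AlgHom.commutes, sub_eq_zero] at h2
  simpa using h2.symm

lemma ker_max {A : Type} [CommRing A] [Algebra k A] (φ : A →ₐ[k] k) :
    (RingHom.ker φ).IsMaximal :=
  RingHom.ker_isMaximal_of_surjective φ fun c => ⟨algebraMap k A c, by simp⟩

lemma ker_coprime {A : Type} [CommRing A] [Algebra k A] (φ ψ : A →ₐ[k] k) (hne : φ ≠ ψ) :
    IsCoprime (RingHom.ker φ) (RingHom.ker ψ) := by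
  have h1 := ker_max φ
  have h2 := ker_max ψ
  rw [Ideal.isCoprime_iff_sup_eq]
  refine Ideal.IsMaximal.coprime_of_ne h1 h2 fun h => hne (ker_inj φ ψ h.le)

/-- the pieces of the argument at a ramified point with trivial stabilizer -/
lemma no_trivial_stab [FiniteDimensional F L] [IsGalois F L] (hc : Core k F L h T)
    (hs : SmoothH h) (φ : RR k T →ₐ[k] k) {i j : Fin d} (hij : i ≠ j)
    (hφ : φ (tR k T i) = φ (tR k T j))
    (hst : ∀ g : L ≃ₐ[F] L, φ.comp (galR hc g) = φ → g = 1) : False := by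
  classical
  set m := RingHom.ker φ with hm
  set x1 := φ (xR k T) with hx1
  set t := φ (tR k T i) with ht
  -- x - x1 in m^2
  have hprod : algebraMap k[X] (RR k T) (h.eval (C t)) = ∏ a, (algebraMap k (RR k T) t - tR k T a) := by
    apply Subtype.ext
    have := core_eval hc (C t)
    have hC : algebraMap k[X] L (C t) = algebraMap k L t :=
      (IsScalarTower.algebraMap_apply k k[X] L _).symm
    rw [hC] at this
    have h9 := map_prod (RR k T).val (fun a => algebraMap k (RR k T) t - tR k T a) Finset.univ
    exact this.trans h9.symm
  have hmem : algebraMap k[X] (RR k T) (h.eval (C t)) ∈ m ^ 2 := by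
    rw [hprod, ← Finset.mul_prod_erase _ _ (Finset.mem_univ i),
      ← Finset.mul_prod_erase _ _ (Finset.mem_erase.2 ⟨hij.symm, Finset.mem_univ j⟩), ← mul_assoc]
    apply Ideal.mul_mem_right
    rw [pow_two]
    apply Ideal.mul_mem_mul
    · rw [hm, RingHom.mem_ker]; simp [ht]
    · rw [hm, RingHom.mem_ker]; simp [← hφ]
  have hsp := phi_split hc φ
  have hroot : (sp h x1).eval t = 0 := by
    rw [hsp, eval_prod]; exact Finset.prod_eq_zero (Finset.mem_univ i) (by simp [ht])
  have hder : (derivative (sp h x1)).eval t = 0 := by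
    rw [hsp, ← Finset.mul_prod_erase _ _ (Finset.mem_univ i),
      ← Finset.mul_prod_erase _ _ (Finset.mem_erase.2 ⟨hij.symm, Finset.mem_univ j⟩), ← mul_assoc]
    rw [derivative_mul, derivative_mul]
    simp [← ht, ← hφ]
  have hv := hs x1 t hroot hder
  have hroot' : (h.eval (C t)).IsRoot x1 := by
    have : (h.eval (C t)).eval x1 = (sp h x1).eval t := by
      rw [sp, eval_map, ← coe_evalRingHom, eval, hom_eval₂]
      simp
    rw [IsRoot, this, hroot]
  obtain ⟨v, hv2⟩ := dvd_iff_isRoot.2 hroot'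
  rw [hv2, derivative_mul] at hv
  simp at hv
  have hxm : xR k T - algebraMap k _ x1 ∈ m := by simp [hm, RingHom.mem_ker, hx1]
  have hXC : algebraMap k[X] (RR k T) (X - C x1) = xR k T - algebraMap k _ x1 := by
    have hC : algebraMap k[X] (RR k T) (C x1) = algebraMap k (RR k T) x1 :=
      (IsScalarTower.algebraMap_apply k k[X] (RR k T) _).symm
    rw [map_sub, hC]; rfl
  have hx2 : xR k T - algebraMap k _ x1 ∈ m ^ 2 := by
    rw [hv2, map_mul, hXC] at hmem
    have h3 : algebraMap k[X] (RR k T) v - algebraMap k _ (v.eval x1) ∈ m := by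
      rw [hm, RingHom.mem_ker, map_sub, phi_poly]; simp [hx1]
    have h4 : (xR k T - algebraMap k _ x1) * (algebraMap k[X] (RR k T) v - algebraMap k _ (v.eval x1))
        ∈ m ^ 2 := by rw [pow_two]; exact Ideal.mul_mem_mul hxm h3
    have h5 := Ideal.mul_mem_right (algebraMap k (RR k T) (v.eval x1)⁻¹) _ (Ideal.sub_mem _ hmem h4)
    have h6 : algebraMap k (RR k T) (v.eval x1) * algebraMap k (RR k T) (v.eval x1)⁻¹ = 1 := by
      rw [← map_mul, mul_inv_cancel₀ hv, map_one]
    convert h5 using 1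
    linear_combination -(xR k T - algebraMap k (RR k T) x1) * h6
  -- the idempotent-like element
  have hcop : IsCoprime m (∏ g ∈ Finset.univ.erase (1 : L ≃ₐ[F] L),
      (RingHom.ker (φ.comp (galR hc g))) ^ 2) := by
    apply IsCoprime.prod_right
    intro g hg
    apply IsCoprime.pow_right
    apply ker_coprime
    intro h0
    exact (Finset.mem_erase.1 hg).1 (hst g h0.symm)
  obtain ⟨a, ha, e, he, hae⟩ := (Ideal.isCoprime_iff_exists).1 hcop
  have hge : ∀ g : L ≃ₐ[F] L, g ≠ 1 → galR hc g e ∈ m ^ 2 := by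
    intro g hg
    have h1 : e ∈ RingHom.ker (φ.comp (galR hc g)) ^ 2 := by
      have := Ideal.prod_le_inf he
      exact (Finset.inf_le (f := fun g => (RingHom.ker (φ.comp (galR hc g))) ^ 2)
        (Finset.mem_erase.2 ⟨hg, Finset.mem_univ g⟩)) this
    have h2 := Ideal.mem_map_of_mem (galR hc g) h1
    rw [Ideal.map_pow] at h2
    refine Ideal.pow_right_mono ?_ 2 h2
    rw [Ideal.map_le_iff_le_comap]
    intro z hz
    exact hz
  have key : m ≤ m ^ 2 := by
    intro y hy
    let z : RR k T := ∑ g : L ≃ₐ[F] L, galR hc g (e * y)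
    have hz : (z : L) = ∑ g : L ≃ₐ[F] L, g (e * y : RR k T) := by simp [z]
    obtain ⟨Q, hQ⟩ := desc_int (F := F) (RR_integral hc z) (by
      intro g
      rw [hz, map_sum]
      exact Fintype.sum_equiv (Equiv.mulLeft g) _ _ fun g' => rfl)
    have hz2 : z = e * y + ∑ g ∈ Finset.univ.erase (1 : L ≃ₐ[F] L), galR hc g (e * y) := by
      simp only [z]
      rw [← Finset.add_sum_erase _ _ (Finset.mem_univ 1)]
      congr 1
    have hrest : ∑ g ∈ Finset.univ.erase (1 : L ≃ₐ[F] L), galR hc g (e * y) ∈ m ^ 2 := by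
      refine Ideal.sum_mem _ fun g hg => ?_
      rw [map_mul]
      exact Ideal.mul_mem_right _ _ (hge g (Finset.mem_erase.1 hg).1)
    have hzm : z ∈ m := by
      rw [hz2]
      exact Ideal.add_mem _ (Ideal.mul_mem_left _ _ hy) (Ideal.pow_le_self two_ne_zero hrest)
    have hQ1 : Q.eval x1 = 0 := by
      rw [← phi_poly' φ Q z hQ.symm]; exact hzm
    obtain ⟨W, hW⟩ := dvd_iff_isRoot.2 hQ1
    have hz3 : z ∈ m ^ 2 := by
      have : z = algebraMap k[X] (RR k T) Q := Subtype.ext hQ.symm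
      rw [this, hW, map_mul, hXC]
      exact Ideal.mul_mem_right _ _ hx2
    have hey : e * y ∈ m ^ 2 := by
      have := Ideal.sub_mem _ hz3 hrest
      rwa [hz2, add_sub_cancel_right] at this
    have hay : a * y ∈ m ^ 2 := by rw [pow_two]; exact Ideal.mul_mem_mul ha hy
    have := Ideal.add_mem _ hay hey
    rwa [← add_mul, hae, one_mul] at this
  have := ker_pow_lt hc φ 1
  rw [pow_one] at this
  exact absurd key (not_le_of_gt this)

lemma real_mul {σ τ : Equiv.Perm (Fin d)} (hσ : Rlz F T σ) (hτ : Rlz F T τ) : Rlz F T (σ * τ) := by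
  obtain ⟨g, hg⟩ := hσ
  obtain ⟨g', hg'⟩ := hτ
  exact ⟨g * g', fun i => by rw [AlgEquiv.mul_apply, hg', hg]; rfl⟩

lemma real_inv {σ : Equiv.Perm (Fin d)} (hσ : Rlz F T σ) : Rlz F T σ⁻¹ := by
  obtain ⟨g, hg⟩ := hσ
  refine ⟨g⁻¹, fun i => ?_⟩
  have := hg (σ⁻¹ i)
  rw [show σ (σ⁻¹ i) = i from σ.apply_symm_apply i] at this
  rw [← this]
  exact g.symm_apply_apply _

/-- products of differences over an invariant set have a zero -/
lemma exists_phi_coll [IsAlgClosed k] [FiniteDimensional F L] [IsGalois F L]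
    (hc : Core k F L h T) (hB : TopSep d h) (S : Finset (Fin d × Fin d)) (hS : S.Nonempty)
    (hne : ∀ p ∈ S, p.1 ≠ p.2)
    (hinv : ∀ π : Equiv.Perm (Fin d), Rlz F T π → ∀ p ∈ S, (π p.1, π p.2) ∈ S) :
    ∃ φ : RR k T →ₐ[k] k, ∃ p ∈ S, φ (tR k T p.1) = φ (tR k T p.2) := by
  classical
  let y : RR k T := ∏ p ∈ S, (tR k T p.1 - tR k T p.2)
  have hy : (y : L) = ∏ p ∈ S, (T p.1 - T p.2) := by
    simp [y, tR]
  obtain ⟨P, hP⟩ := desc_int (F := F) (RR_integral hc y) (by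
    intro g
    obtain ⟨π, hπ⟩ := gal_perm hc g
    rw [hy, map_prod]
    refine Finset.prod_bij (fun p _ => (π p.1, π p.2)) ?_ ?_ ?_ ?_
    · intro p hp; exact hinv π ⟨g, hπ⟩ p hp
    · rintro ⟨a, b⟩ _ ⟨a', b'⟩ _ h; simpa using h
    · intro p hp
      exact ⟨(π⁻¹ p.1, π⁻¹ p.2), hinv _ (real_inv ⟨g, hπ⟩) p hp, by simp⟩
    · intro p hp
      simp [hπ])
  obtain ⟨A, hA⟩ := place_exists hc
  have hv : A.valuation (y : L) = A.valuation (xx k L) ^ S.card := by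
    rw [hy, map_prod, ← Finset.prod_const]
    exact Finset.prod_congr rfl fun p hp => place_top hc hA hB (hne p hp)
  have hP0 : P ≠ 0 := by
    rintro rfl
    rw [map_zero] at hP
    rw [← hP, map_zero] at hv
    exact pow_ne_zero S.card (zero_lt_one.trans hA.big).ne' hv.symm
  have hdeg : P.natDegree = S.card := by
    rw [← hP, place_poly hA P hP0] at hv
    exact (pow_right_injective₀ (zero_lt_one.trans hA.big) hA.big.ne') hv
  obtain ⟨x1, hx1⟩ := IsAlgClosed.exists_root P (by
    rw [degree_eq_natDegree hP0, hdeg]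
    exact_mod_cast (Finset.card_pos.2 hS).ne')
  obtain ⟨φ, hφ⟩ := exists_phi hc x1
  refine ⟨φ, ?_⟩
  have h1 : φ y = 0 := by rw [phi_poly' φ P y hP.symm, hφ]; exact hx1
  simp only [y] at h1
  rw [map_prod, Finset.prod_eq_zero_iff] at h1
  obtain ⟨p, hp, h2⟩ := h1
  exact ⟨p, hp, by rwa [map_sub, sub_eq_zero] at h2⟩

theorem monodromy [IsAlgClosed k] [FiniteDimensional F L] [IsGalois F L]
    (hc : Core k F L h T) (hB : TopSep d h) (hs : SmoothH h) (hbr : SimpleBr d h)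
    (σ : Equiv.Perm (Fin d)) : Rlz F T σ := by
  classical
  have hswap : ∀ i j : Fin d, i ≠ j → Rlz F T (Equiv.swap i j) := by
    by_contra hcon
    push Not at hcon
    obtain ⟨i0, j0, hij0, hn0⟩ := hcon
    let S : Finset (Fin d × Fin d) :=
      Finset.univ.filter fun p => p.1 ≠ p.2 ∧ ¬ Rlz F T (Equiv.swap p.1 p.2)
    obtain ⟨φ, ⟨i, j⟩, hp, hφ⟩ := exists_phi_coll hc hB S ⟨(i0, j0), by simp [S, hij0, hn0]⟩
      (fun p hp => (Finset.mem_filter.1 hp).2.1) (by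
        rintro π hπ ⟨a, b⟩ hp
        obtain ⟨-, h1, h2⟩ := Finset.mem_filter.1 hp
        refine Finset.mem_filter.2 ⟨Finset.mem_univ _, fun h => h1 (π.injective h), fun h => h2 ?_⟩
        have := real_mul (real_mul (real_inv hπ) h) hπ
        convert this using 1
        simp only
        rw [Equiv.swap_apply_apply]
        group)
    obtain ⟨-, hij, hn⟩ := Finset.mem_filter.1 hp
    simp only at hij hn hφ
    refine no_trivial_stab hc hs φ hij hφ fun g hg => ?_
    obtain ⟨π, hπ⟩ := gal_perm hc g
    have hb := hbr _ _ (phi_split hc φ)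
    have h1 : ∀ a, φ (tR k T (π a)) = φ (tR k T a) := by
      intro a
      have h2 : galR hc g (tR k T a) = tR k T (π a) := Subtype.ext (hπ a)
      rw [← h2]
      exact DFunLike.congr_fun hg _
    have h3 : ∀ a, π a ≠ a → (a = i ∧ π a = j) ∨ (a = j ∧ π a = i) := by
      intro a ha
      exact hb i j a (π a) hij ha.symm hφ (h1 a).symm
    by_cases hi : π i = i
    · apply gal_one_of hc
      intro a
      rw [hπ]
      by_contra hne
      have hne' : π a ≠ a := fun h => hne (by rw [h])
      rcases h3 a hne' with ⟨rfl, h⟩ | ⟨rfl, h⟩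
      · exact hne' hi
      · rw [← hi] at h
        exact hij (π.injective h).symm
    · exfalso
      have hi' : π i = j := by rcases h3 i hi with h | h; exact h.2; exact absurd h.1 hij
      have hj : π j ≠ j := fun h => hij (π.injective (hi'.trans h.symm))
      have hj' : π j = i := by rcases h3 j hj with h | h; exact absurd h.1.symm hij; exact h.2
      apply hn
      have : Equiv.swap i j = π := by
        ext a
        by_cases hai : a = i
        · rw [hai, Equiv.swap_apply_left, hi']
        by_cases haj : a = j
        · rw [haj, Equiv.swap_apply_right, hj']
        rw [Equiv.swap_apply_of_ne_of_ne hai haj]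
        by_contra hne
        have hne' : π a ≠ a := fun h => hne (by rw [h])
        rcases h3 a hne' with h | h
        exact hai h.1; exact haj h.1
      rw [this]
      exact ⟨g, hπ⟩
  refine Equiv.Perm.swap_induction_on σ ⟨1, fun i => rfl⟩ fun f x y hxy hf => real_mul (hswap x y hxy) hf

end Core
end LineIrr
set_option linter.unusedSectionVars false
set_option linter.unusedVariables false
set_option linter.style.haveILetI false

namespace LineIrr

section Core

variable {k F L : Type} [Field k] [Field F] [Field L]
  [Algebra k[X] F] [IsFractionRing k[X] F] [Algebra k L] [Algebra k[X] L] [Algebra F L]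
  [IsScalarTower k k[X] L] [IsScalarTower k[X] F L]
variable {d : ℕ} {h : k[X][X]} {T : Fin d → L}


lemma exists_phi_t [IsAlgClosed k] [FiniteDimensional F L] [IsGalois F L] (hc : Core k F L h T)
    (hG : ∀ σ : Equiv.Perm (Fin d), Rlz F T σ)
    (x0 : k) (t : Fin d → k) (ht : sp h x0 = ∏ i, (X - C (t i))) :
    ∃ φ : RR k T →ₐ[k] k, φ (xR k T) = x0 ∧ ∀ i, φ (tR k T i) = t i := by
  obtain ⟨φ, hφ⟩ := exists_phi hc x0
  have h1 := phi_split hc φ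
  rw [hφ, ht] at h1
  obtain ⟨π, hπ⟩ := prod_perm h1
  obtain ⟨g, hg⟩ := hG π
  refine ⟨φ.comp (galR hc g), ?_, fun i => ?_⟩
  · rw [AlgHom.comp_apply, galR_xR, hφ]
  · rw [AlgHom.comp_apply, hπ]
    congr 1
    exact Subtype.ext (hg i)

lemma exists_der [Algebra.IsSeparable F L] : ∃ D : Derivation k L L,
    ∀ P : k[X], D (algebraMap k[X] L P) = algebraMap k[X] L (derivative P) := by
  have h1 : Algebra.FormallyEtale k[X] F := Algebra.FormallyEtale.of_isLocalization (nonZeroDivisors k[X])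
  have h2 : Algebra.FormallyEtale F L := Algebra.FormallyEtale.of_isSeparable F L
  have h3 : Algebra.FormallyEtale k[X] L := Algebra.FormallyEtale.comp k[X] F L
  let e := KaehlerDifferential.tensorKaehlerEquivOfFormallyEtale k k[X] L
  let dd : Derivation k k[X] k[X] := Polynomial.derivative'
  let f := dd.liftKaehlerDifferential
  let g := (TensorProduct.AlgebraTensorModule.rid k[X] L L).toLinearMap ∘ₗ (f.baseChange L) ∘ₗ e.symm.toLinearMap
  refine ⟨g.compDer (KaehlerDifferential.D k L), fun P => ?_⟩
  show g (KaehlerDifferential.D k L (algebraMap k[X] L P)) = _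
  simp only [g, LinearMap.comp_apply, LinearEquiv.coe_coe]
  have := KaehlerDifferential.tensorKaehlerEquivOfFormallyEtale_symm_D_algebraMap k k[X] L P
  simp only [e]
  rw [this, LinearMap.baseChange_tmul, TensorProduct.AlgebraTensorModule.rid_tmul]
  simp [f, dd, Algebra.smul_def]

end Core
end LineIrr
set_option linter.unusedSectionVars false
set_option linter.unusedVariables false
set_option linter.style.haveILetI false

namespace LineIrr

section Core

variable {k F L : Type} [Field k] [Field F] [Field L]
  [Algebra k[X] F] [IsFractionRing k[X] F] [Algebra k L] [Algebra k[X] L] [Algebra F L]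
  [IsScalarTower k k[X] L] [IsScalarTower k[X] F L]
variable {d : ℕ} {h : k[X][X]} {T : Fin d → L} [hinj : Fact (Function.Injective T)]


/-- derivative with respect to the inner variable -/
noncomputable def dx (P : k[X][X]) : k[X][X] :=
  ∑ j ∈ Finset.range (P.natDegree + 1), monomial j (derivative (P.coeff j))

lemma coeff_dx (P : k[X][X]) (j : ℕ) : (dx P).coeff j = derivative (P.coeff j) := by
  rw [dx, finsetSum_coeff]
  simp only [coeff_monomial]
  rw [Finset.sum_ite_eq' (Finset.range (P.natDegree + 1)) j]
  split_ifs with h1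
  · rfl
  · rw [coeff_eq_zero_of_natDegree_lt (by simpa using h1), derivative_zero]

lemma dx_add (P Q : k[X][X]) : dx (P + Q) = dx P + dx Q := by
  ext1 j; simp [coeff_dx]

lemma dx_monomial (n : ℕ) (a : k[X]) : dx (monomial n a) = monomial n (derivative a) := by
  ext1 j; rw [coeff_dx, coeff_monomial, coeff_monomial]; split_ifs <;> simp

lemma D_eval₂ (D : Derivation k L L)
    (hD : ∀ P : k[X], D (algebraMap k[X] L P) = algebraMap k[X] L (derivative P)) (P : k[X][X]) (y : L) :
    D (eval₂ (algebraMap k[X] L) y P) = eval₂ (algebraMap k[X] L) y (dx P) +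
      eval₂ (algebraMap k[X] L) y (derivative P) * D y := by
  induction P using Polynomial.induction_on' with
  | add P Q hP hQ =>
    rw [eval₂_add, map_add, hP, hQ, dx_add, derivative_add, eval₂_add, eval₂_add]; ring
  | monomial n a =>
    rw [dx_monomial, derivative_monomial, eval₂_monomial, eval₂_monomial, eval₂_monomial,
      Derivation.leibniz, hD, Derivation.leibniz_pow]
    simp only [smul_eq_mul, nsmul_eq_mul, map_mul, map_natCast]
    ring

lemma derivative_eval_C (P : k[X][X]) (t : k) : derivative (P.eval (C t)) = (dx P).eval (C t) := by
  induction P using Polynomial.induction_on' with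
  | add P Q hP hQ => rw [eval_add, derivative_add, hP, hQ, dx_add, eval_add]
  | monomial n a =>
    rw [dx_monomial, eval_monomial, eval_monomial, derivative_mul, ← C_pow, derivative_C]; simp

lemma hT_eq (hc : Core k F L h T) (i : Fin d) :
    eval₂ (algebraMap k[X] L) (T i) (derivative h) = ∏ b ∈ Finset.univ.erase i, (T i - T b) := by
  rw [← eval_map, ← derivative_map, hc.split, ← Finset.mul_prod_erase _ _ (Finset.mem_univ i),
    derivative_mul]
  simp [eval_prod]

lemma hT_ne (hc : Core k F L h T) (i : Fin d) :
    eval₂ (algebraMap k[X] L) (T i) (derivative h) ≠ 0 := by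
  rw [hT_eq hc, Finset.prod_ne_zero_iff]
  intro b hb
  rw [sub_ne_zero]
  intro h0
  exact (Finset.mem_erase.1 hb).1 (hinj.out h0).symm

lemma D_T (hc : Core k F L h T) (D : Derivation k L L)
    (hD : ∀ P : k[X], D (algebraMap k[X] L P) = algebraMap k[X] L (derivative P)) (i : Fin d) :
    eval₂ (algebraMap k[X] L) (T i) (derivative h) * D (T i) = - eval₂ (algebraMap k[X] L) (T i) (dx h) := by
  have h1 := D_eval₂ D hD h (T i)
  rw [core_root hc, map_zero] at h1
  linear_combination -h1

variable (k T) in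
/-- the discriminant -/
noncomputable def DelR : RR k T := ∏ p ∈ (Finset.univ : Finset (Fin d)).offDiag, (tR k T p.1 - tR k T p.2)

lemma DelR_coe : (DelR k T : L) = ∏ p ∈ (Finset.univ : Finset (Fin d)).offDiag, (T p.1 - T p.2) := by
  simp [DelR, tR]

lemma Tsub_mem (i j : Fin d) : T i - T j ∈ VV k T ^ 1 := by
  rw [pow_one]; exact Submodule.sub_mem _ (T_mem_VV i) (T_mem_VV j)

lemma DelR_mem : (DelR k T : L) ∈ VV k T ^ (d * d) := by
  rw [DelR_coe]
  have := VV_prod (k := k) (T := T) ((Finset.univ : Finset (Fin d)).offDiag) (fun p => T p.1 - T p.2)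
    (fun _ => 1) fun p _ => Tsub_mem p.1 p.2
  refine VV_mono ?_ this
  simp [Finset.offDiag_card]

lemma DelR_ne (hc : Core k F L h T) : DelR k T ≠ 0 := by
  intro h0
  have h1 := congrArg Subtype.val h0
  rw [DelR_coe] at h1
  obtain ⟨p, hp, h2⟩ := Finset.prod_eq_zero_iff.1 h1
  exact (Finset.mem_offDiag.1 hp).2.2 (hinj.out (sub_eq_zero.1 h2))

lemma phi_DelR (φ : RR k T →ₐ[k] k) (hφ : Function.Injective fun i => φ (tR k T i)) :
    φ (DelR k T) ≠ 0 := by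
  rw [DelR, map_prod, Finset.prod_ne_zero_iff]
  intro p hp
  rw [map_sub, sub_ne_zero]
  exact fun h0 => (Finset.mem_offDiag.1 hp).2.2 (hφ h0)

lemma hx_mem (hc : Core k F L h T) (i : Fin d) :
    eval₂ (algebraMap k[X] L) (T i) (dx h) ∈ VV k T ^ d := by
  have hdeg : (dx h).natDegree ≤ d := by
    rw [natDegree_le_iff_coeff_eq_zero]
    intro n hn
    rw [coeff_dx, coeff_eq_zero_of_natDegree_lt (by rw [core_natDegree hc]; exact hn), derivative_zero]
  rw [eval₂_eq_sum_range' _ (Nat.lt_succ_of_le hdeg)]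
  refine Submodule.sum_mem _ fun j hj => ?_
  have hj' : j ≤ d := by simpa [Nat.lt_succ_iff] using hj
  rw [coeff_dx]
  have h1 : algebraMap k[X] L (derivative (h.coeff j)) ∈ VV k T ^ (d - j) :=
    VV_poly _ ((natDegree_derivative_le _).trans ((Nat.sub_le _ _).trans (hc.wt j hj')))
  have h2 : T i ^ j ∈ VV k T ^ j := Submodule.pow_mem_pow _ (T_mem_VV i) j
  have := VV_mul h1 h2
  rwa [Nat.sub_add_cancel hj'] at this

lemma DelD_T (hc : Core k F L h T) (D : Derivation k L L)
    (hD : ∀ P : k[X], D (algebraMap k[X] L P) = algebraMap k[X] L (derivative P)) (i : Fin d) :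
    (DelR k T : L) * D (T i) ∈ VV k T ^ (d * d + 1) := by
  classical
  let s := (Finset.univ : Finset (Fin d)).offDiag.filter (fun p => p.1 = i)
  let s' := (Finset.univ : Finset (Fin d)).offDiag.filter (fun p => ¬ p.1 = i)
  have h1 : (DelR k T : L) = (∏ p ∈ s, (T p.1 - T p.2)) * ∏ p ∈ s', (T p.1 - T p.2) := by
    rw [DelR_coe, Finset.prod_filter_mul_prod_filter_not]
  have h2 : ∏ p ∈ s, (T p.1 - T p.2) = ∏ b ∈ Finset.univ.erase i, (T i - T b) := by
    refine Finset.prod_bij (fun p _ => p.2) ?_ ?_ ?_ ?_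
    · rintro ⟨a, b⟩ hp
      obtain ⟨h3, h4⟩ := Finset.mem_filter.1 hp
      simp only at h4
      subst h4
      exact Finset.mem_erase.2 ⟨(Finset.mem_offDiag.1 h3).2.2.symm, Finset.mem_univ _⟩
    · rintro ⟨a, b⟩ hp ⟨a', b'⟩ hp' hh
      have h4 := (Finset.mem_filter.1 hp).2
      have h5 := (Finset.mem_filter.1 hp').2
      simp only at h4 h5 hh
      rw [h4, h5, hh]
    · intro b hb
      refine ⟨(i, b), Finset.mem_filter.2 ⟨Finset.mem_offDiag.2 ⟨Finset.mem_univ _, Finset.mem_univ _, (Finset.mem_erase.1 hb).1.symm⟩, rfl⟩, rfl⟩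
    · rintro ⟨a, b⟩ hp
      have h4 := (Finset.mem_filter.1 hp).2
      simp only at h4
      rw [h4]
  have hs : s.card = d - 1 := by
    have : s.card = (Finset.univ.erase i).card := by
      refine Finset.card_bij (fun p _ => p.2) ?_ ?_ ?_
      · rintro ⟨a, b⟩ hp
        obtain ⟨h3, h4⟩ := Finset.mem_filter.1 hp
        simp only at h4
        subst h4
        exact Finset.mem_erase.2 ⟨(Finset.mem_offDiag.1 h3).2.2.symm, Finset.mem_univ _⟩
      · rintro ⟨a, b⟩ hp ⟨a', b'⟩ hp' hh
        have h4 := (Finset.mem_filter.1 hp).2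
        have h5 := (Finset.mem_filter.1 hp').2
        simp only at h4 h5 hh
        rw [h4, h5, hh]
      · intro b hb
        exact ⟨(i, b), Finset.mem_filter.2 ⟨Finset.mem_offDiag.2 ⟨Finset.mem_univ _, Finset.mem_univ _, (Finset.mem_erase.1 hb).1.symm⟩, rfl⟩, rfl⟩
    rw [this, Finset.card_erase_of_mem (Finset.mem_univ _)]; simp
  have hss : s.card + s'.card = d * d - d := by
    have := Finset.card_filter_add_card_filter_not (s := (Finset.univ : Finset (Fin d)).offDiag) (fun p => p.1 = i)
    rw [Finset.offDiag_card] at this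
    simpa using this
  have h3 : (DelR k T : L) * D (T i) = - ((∏ p ∈ s', (T p.1 - T p.2)) * eval₂ (algebraMap k[X] L) (T i) (dx h)) := by
    rw [h1, h2, ← hT_eq hc]
    linear_combination (∏ p ∈ s', (T p.1 - T p.2)) * D_T hc D hD i
  rw [h3]
  apply Submodule.neg_mem
  have h4 := VV_prod (k := k) (T := T) s' (fun p => T p.1 - T p.2) (fun _ => 1) fun p _ => Tsub_mem p.1 p.2
  refine VV_mono ?_ (VV_mul h4 (hx_mem hc i))
  have hd : 0 < d := i.pos
  have := Nat.mul_le_mul_left d hd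
  simp only [Finset.sum_const, smul_eq_mul, mul_one] at *
  omega

lemma exists_Dp [Algebra.IsSeparable F L] (hc : Core k F L h T) :
    ∃ D' : Derivation k (RR k T) (RR k T), D' (xR k T) = DelR k T ∧
      ∀ (m : ℕ) (y : RR k T), (y : L) ∈ VV k T ^ m → (D' y : L) ∈ VV k T ^ (m + d * d) := by
  obtain ⟨D, hD⟩ := exists_der (k := k) (F := F) (L := L)
  have hV : ∀ y ∈ VV k T, (DelR k T : L) * D y ∈ VV k T ^ (d * d + 1) := by
    intro y hy
    induction hy using Submodule.span_induction with
    | mem x hx =>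
      rcases hx with rfl | rfl | ⟨i, rfl⟩
      · simp
      · rw [xx, hD]; simp only [derivative_X, map_one, mul_one]
        exact VV_mono (Nat.le_succ _) DelR_mem
      · exact DelD_T hc D hD i
    | zero => simp
    | add x y _ _ hx hy => rw [map_add, mul_add]; exact Submodule.add_mem _ hx hy
    | smul c x _ hx => rw [D.map_smul, mul_smul_comm]; exact Submodule.smul_mem _ _ hx
  have hVm : ∀ (m : ℕ) (y : L), y ∈ VV k T ^ m → (DelR k T : L) * D y ∈ VV k T ^ (m + d * d) := by
    intro m y hy
    induction hy using Submodule.pow_induction_on_left' with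
    | algebraMap r => simp
    | add x y i hx hy ihx ihy => rw [map_add, mul_add]; exact Submodule.add_mem _ ihx ihy
    | mem_mul u hu i x hx ih =>
      have h1 : (DelR k T : L) * D (u * x) = u * ((DelR k T : L) * D x) + ((DelR k T : L) * D u) * x := by
        rw [Derivation.leibniz]; simp only [smul_eq_mul]; ring
      rw [h1]
      apply Submodule.add_mem
      · have := VV_mul (m := 1) (by rwa [pow_one]) ih
        convert this using 2; omega
      · have := VV_mul (hV u hu) hx
        convert this using 2; omega
  let f : RR k T →ₗ[k] RR k T :=
    { toFun := fun y => ⟨DelR k T * D y, by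
        obtain ⟨m, hm⟩ := RR_mem y.2; exact VV_le_RR (hVm m y hm)⟩
      map_add' := fun a b => Subtype.ext (by simp [mul_add])
      map_smul' := fun c a => Subtype.ext (by
        show (DelR k T : L) * D (c • (a : L)) = c • ((DelR k T : L) * D a)
        rw [D.map_smul, mul_smul_comm]) }
  refine ⟨Derivation.mk' f fun a b => Subtype.ext ?_, Subtype.ext ?_, fun m y hy => hVm m y hy⟩
  · show (DelR k T : L) * D ((a : L) * b) = a * ((DelR k T : L) * D b) + b * ((DelR k T : L) * D a)
    rw [Derivation.leibniz]; simp only [smul_eq_mul]; ring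
  · show (DelR k T : L) * D (xx k L) = DelR k T
    rw [xx, hD]; simp

end Core
end LineIrr
set_option linter.unusedSectionVars false
set_option linter.unusedVariables false
set_option linter.style.haveILetI false

namespace LineIrr

section Core

variable {k F L : Type} [Field k] [Field F] [Field L]
  [Algebra k[X] F] [IsFractionRing k[X] F] [Algebra k L] [Algebra k[X] L] [Algebra F L]
  [IsScalarTower k k[X] L] [IsScalarTower k[X] F L]
variable {d : ℕ} {h : k[X][X]} {T : Fin d → L} [hinj : Fact (Function.Injective T)]


/-- vanishing ideals -/
noncomputable def WW (D' : Derivation k (RR k T) (RR k T)) (φ : RR k T →ₐ[k] k) : ℕ → Ideal (RR k T)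
  | 0 => ⊤
  | M + 1 =>
    { carrier := {y | φ y = 0 ∧ D' y ∈ WW D' φ M ∧ y ∈ WW D' φ M}
      add_mem' := by
        rintro a b ⟨h1, h2, h3⟩ ⟨h4, h5, h6⟩
        exact ⟨by rw [map_add, h1, h4, add_zero], by rw [map_add]; exact Ideal.add_mem _ h2 h5,
          Ideal.add_mem _ h3 h6⟩
      zero_mem' := ⟨map_zero _, by rw [map_zero]; exact Ideal.zero_mem _, Ideal.zero_mem _⟩
      smul_mem' := by
        rintro c a ⟨h1, h2, h3⟩
        refine ⟨by rw [smul_eq_mul, map_mul, h1, mul_zero], ?_, Ideal.mul_mem_left _ _ h3⟩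
        rw [smul_eq_mul, Derivation.leibniz]
        simp only [smul_eq_mul]
        exact Ideal.add_mem _ (Ideal.mul_mem_left _ _ h2) (Ideal.mul_mem_right _ _ h3) }

lemma mem_WW_succ (D' : Derivation k (RR k T) (RR k T)) (φ : RR k T →ₐ[k] k) (M : ℕ) (y : RR k T) :
    y ∈ WW D' φ (M + 1) ↔ φ y = 0 ∧ D' y ∈ WW D' φ M ∧ y ∈ WW D' φ M := Iff.rfl

lemma mem_WW_of (D' : Derivation k (RR k T) (RR k T)) (φ : RR k T →ₐ[k] k) (M : ℕ) (y : RR k T)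
    (hy : ∀ i < M, φ ((D' : RR k T → RR k T)^[i] y) = 0) : y ∈ WW D' φ M := by
  induction M generalizing y with
  | zero => trivial
  | succ M ih =>
    rw [mem_WW_succ]
    refine ⟨hy 0 (Nat.succ_pos M), ih _ fun i hi => ?_, ih _ fun i hi => hy i (by omega)⟩
    exact hy (i + 1) (by omega)

lemma D_pow_ker (D' : Derivation k (RR k T) (RR k T)) (I : Ideal (RR k T)) (M : ℕ) (y : RR k T)
    (hy : y ∈ I ^ (M + 1)) : D' y ∈ I ^ M := by
  induction M generalizing y with
  | zero => simp
  | succ M ih =>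
    rw [pow_succ'] at hy
    induction hy using Submodule.mul_induction_on' with
    | mem_mul_mem a ha b hb =>
      rw [Derivation.leibniz]
      simp only [smul_eq_mul]
      refine Ideal.add_mem _ ?_ (Ideal.mul_mem_right _ _ hb)
      rw [pow_succ']
      exact Ideal.mul_mem_mul ha (ih b hb)
    | add a _ b _ ha hb => rw [map_add]; exact Ideal.add_mem _ ha hb

lemma ker_pow_le_WW (D' : Derivation k (RR k T) (RR k T)) (φ : RR k T →ₐ[k] k) (M : ℕ) :
    RingHom.ker φ ^ M ≤ WW D' φ M := by
  induction M with
  | zero => exact le_top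
  | succ M ih =>
    intro y hy
    rw [mem_WW_succ]
    exact ⟨Ideal.pow_le_self (Nat.succ_ne_zero M) hy, ih (D_pow_ker D' _ M y hy),
      ih (Ideal.pow_le_pow_right (Nat.le_succ M) hy)⟩

lemma WW_not_mem {p : ℕ} [CharP k p] (D' : Derivation k (RR k T) (RR k T))
    (hD' : D' (xR k T) = DelR k T) (φ : RR k T →ₐ[k] k) (hφ : φ (DelR k T) ≠ 0) (M : ℕ) (hM : M < p)
    (c : RR k T) (hcφ : φ c ≠ 0) :
    (xR k T - algebraMap k _ (φ (xR k T))) ^ M * c ∉ WW D' φ (M + 1) := by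
  induction M generalizing c with
  | zero => intro h0; rw [mem_WW_succ] at h0; simp at h0; exact hcφ h0.1
  | succ M ih =>
    intro h0
    rw [mem_WW_succ] at h0
    set u := xR k T - algebraMap k _ (φ (xR k T)) with hu
    have hDu : D' u = DelR k T := by rw [hu, map_sub, hD', D'.map_algebraMap, sub_zero]
    have h1 : D' (u ^ (M + 1) * c) = u ^ M * ((M + 1 : ℕ) * DelR k T * c + u * D' c) := by
      rw [Derivation.leibniz, Derivation.leibniz_pow, hDu]
      simp only [smul_eq_mul, nsmul_eq_mul, Nat.add_sub_cancel]
      ring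
    rw [h1] at h0
    refine ih (by omega) _ ?_ h0.2.1
    have hu0 : φ u = 0 := by simp [hu]
    rw [map_add, map_mul, map_mul, map_mul, hu0, zero_mul, add_zero, map_natCast]
    refine mul_ne_zero (mul_ne_zero ?_ hφ) hcφ
    intro h2
    rw [CharP.cast_eq_zero_iff k p] at h2
    exact absurd (Nat.le_of_dvd (Nat.succ_pos M) h2) (by omega)

lemma WW_lt {p : ℕ} [CharP k p] (D' : Derivation k (RR k T) (RR k T))
    (hD' : D' (xR k T) = DelR k T) (φ : RR k T →ₐ[k] k) (hφ : φ (DelR k T) ≠ 0) (M : ℕ) (hM : M < p) :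
    WW D' φ (M + 1) < WW D' φ M := by
  refine lt_of_le_of_ne (fun y hy => ((mem_WW_succ _ _ _ _).1 hy).2.2) fun h0 => ?_
  refine WW_not_mem D' hD' φ hφ M hM 1 (by simp) ?_
  rw [h0, mul_one]
  refine ker_pow_le_WW D' φ M (Ideal.pow_mem_pow ?_ M)
  simp [RingHom.mem_ker]

lemma step_family [FiniteDimensional F L] (hc : Core k F L h T) (n : ℕ) :
    ∃ tt : Fin n × Fin (Module.finrank F L) → RR k T, LinearIndependent k tt ∧
      (∀ p, (tt p : L) ∈ VV k T ^ (n + d * d)) ∧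
      ∀ (φ : RR k T →ₐ[k] k) (g : L ≃ₐ[F] L) (q : ℕ), φ (xR k T) ^ q = φ (xR k T) →
        (∀ i, φ (tR k T i) ^ q = φ (galR hc g (tR k T i))) →
        ∀ p, φ (tt p) ^ q = φ (galR hc g (tt p)) := by
  obtain ⟨β, hβ⟩ := exists_basis hc
  have h1 := basis_indep (k := k) hβ n
  have hval : ∀ p : Fin n × Fin (Module.finrank F L),
      ((xR k T ^ (p.1 : ℕ) * ∏ i, tR k T i ^ (β p.2 i : ℕ) : RR k T) : L) =
        xx k L ^ (p.1 : ℕ) * mon T (β p.2) := by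
    intro p
    rw [mon]
    have h9 := map_prod (RR k T).val (fun i => tR k T i ^ (β p.2 i : ℕ)) Finset.univ
    have h8 : ((∏ i, tR k T i ^ (β p.2 i : ℕ) : RR k T) : L) = ∏ i, T i ^ (β p.2 i : ℕ) := by
      refine h9.trans (Finset.prod_congr rfl fun i _ => ?_)
      rfl
    rw [← h8]; rfl
  refine ⟨fun p => xR k T ^ (p.1 : ℕ) * ∏ i, tR k T i ^ (β p.2 i : ℕ), ?_, ?_, ?_⟩
  · refine LinearIndependent.of_comp ((RR k T).val.toLinearMap.restrictScalars k) ?_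
    convert h1 using 1
    funext p
    exact hval p
  · intro p
    rw [hval]
    exact VV_mono (by omega) (VV_xpow_mul (mon_mem _) p.1)
  · intro φ g q hx ht p
    simp only [map_mul, map_pow, map_prod, mul_pow, ← Finset.prod_pow, galR_xR]
    congr 1
    · rw [← pow_mul, mul_comm, pow_mul, hx]
    · refine Finset.prod_congr rfl fun i _ => ?_
      rw [← ht, ← pow_mul, mul_comm, pow_mul]

instance RR_charP (p : ℕ) [CharP k p] : CharP (RR k T) p :=
  charP_of_injective_algebraMap (algebraMap k (RR k T)).injective p

lemma D_iter_mem {D' : Derivation k (RR k T) (RR k T)}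
    (hV : ∀ (m : ℕ) (y : RR k T), (y : L) ∈ VV k T ^ m → (D' y : L) ∈ VV k T ^ (m + d * d))
    (i m : ℕ) (y : RR k T) (hy : (y : L) ∈ VV k T ^ m) :
    (((D' : RR k T → RR k T)^[i] y : RR k T) : L) ∈ VV k T ^ (m + i * (d * d)) := by
  induction i with
  | zero => simpa using hy
  | succ i ih =>
    rw [Function.iterate_succ_apply']
    have := hV _ _ ih
    convert this using 2; ring

lemma D_iter_sum {D' : Derivation k (RR k T) (RR k T)} {ι : Type} (s : Finset ι) (i : ℕ)
    (c : ι → k) (f : ι → RR k T) :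
    (D' : RR k T → RR k T)^[i] (∑ j ∈ s, c j • f j) = ∑ j ∈ s, c j • (D' : RR k T → RR k T)^[i] (f j) := by
  induction i with
  | zero => simp
  | succ i ih =>
    rw [Function.iterate_succ_apply', ih, map_sum]
    refine Finset.sum_congr rfl fun j _ => ?_
    rw [Function.iterate_succ_apply', D'.map_smul]

lemma D_iter_mul_pow {p : ℕ} [CharP k p] {D' : Derivation k (RR k T) (RR k T)} (i b : ℕ) (hb : b ≠ 0)
    (y z : RR k T) :
    (D' : RR k T → RR k T)^[i] (y * z ^ p ^ b) = (D' : RR k T → RR k T)^[i] y * z ^ p ^ b := by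
  induction i with
  | zero => simp
  | succ i ih =>
    rw [Function.iterate_succ_apply', ih, Derivation.leibniz, Derivation.leibniz_pow,
      Function.iterate_succ_apply']
    have : (p ^ b) • z ^ (p ^ b - 1) • D' z = 0 := by
      rw [nsmul_eq_mul]
      have : ((p ^ b : ℕ) : RR k T) = 0 := by
        rw [Nat.cast_pow, CharP.cast_eq_zero, zero_pow hb]
      rw [this, zero_mul]
    rw [this]; simp only [smul_eq_mul]; ring

end Core
end LineIrr
set_option linter.unusedSectionVars false
set_option linter.unusedVariables false
set_option linter.style.haveILetI false

namespace LineIrr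

section Core

variable {k F L : Type} [Field k] [Field F] [Field L]
  [Algebra k[X] F] [IsFractionRing k[X] F] [Algebra k L] [Algebra k[X] L] [Algebra F L]
  [IsScalarTower k k[X] L] [IsScalarTower k[X] F L]
variable {d : ℕ} {h : k[X][X]} {T : Fin d → L} [hinj : Fact (Function.Injective T)]


lemma fin_of_rank_le {E W : Type} [Field E] [AddCommGroup W] [Module E W] {n : ℕ}
    (h1 : Module.rank E W ≤ (n : ℕ)) : Module.Finite E W :=
  Module.rank_lt_aleph0_iff.1 (lt_of_le_of_lt h1 (Cardinal.natCast_lt_aleph0))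

lemma exists_point_ne [IsAlgClosed k] [FiniteDimensional F L] [IsGalois F L] (hc : Core k F L h T)
    (y : RR k T) (hy : y ≠ 0) : ∃ φ : RR k T →ₐ[k] k, φ y ≠ 0 := by
  obtain ⟨m, hm⟩ := RR_mem y.2
  obtain ⟨P, hP0, -, hP⟩ := norm_lemma hc y hy hm
  obtain ⟨x0, hx0⟩ : ∃ x0, P.eval x0 ≠ 0 := by
    by_contra hcon
    push Not at hcon
    exact hP0 (Polynomial.funext fun x => by rw [hcon x, eval_zero])
  obtain ⟨φ, hφ⟩ := exists_phi hc x0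
  exact ⟨φ, fun h0 => hx0 (by rw [← hφ]; exact hP φ h0)⟩

lemma ker_pow_dim [FiniteDimensional F L] [IsGalois F L] (hc : Core k F L h T) {n : ℕ}
    (y : RR k T) (hy0 : y ≠ 0) (hy : (y : L) ∈ VV k T ^ n) (φ : RR k T →ₐ[k] k) (Q : ℕ)
    (hQ : y ∈ RingHom.ker φ ^ Q) : Q ≤ Module.finrank F L * (n + 2 * (d * d) + 1) := by
  have h1 := zero_lemma hc y hy0 hy _ hQ
  have hfin : Module.Finite k (RR k T ⧸ RingHom.ker φ ^ Q) := fin_of_rank_le h1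
  have h2 := chain_le (k := k) (fun i => RingHom.ker φ ^ i) Q (fun i _ => ker_pow_lt hc φ i) hfin
  refine h2.trans ?_
  rw [← Module.finrank_eq_rank] at h1
  exact_mod_cast h1

lemma nonvanish [IsAlgClosed k] [FiniteDimensional F L] [IsGalois F L] (hc : Core k F L h T)
    {p : ℕ} [Fact p.Prime] [CharP k p] {P J : Type} [Fintype P] [Fintype J] (b m : ℕ)
    (hQ : Module.finrank F L * (m + 2 * (d * d) + 1) < p ^ b)
    (tt : P → RR k T) (htt : LinearIndependent k tt)
    (bb : J → RR k T) (hbb : LinearIndependent k bb) (hbV : ∀ j, (bb j : L) ∈ VV k T ^ m)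
    (γ : P → J → k) (hγ : ∃ i j, γ i j ≠ 0) :
    ∑ i, (∑ j, γ i j • bb j) * tt i ^ p ^ b ≠ 0 := by
  intro h0
  have hroot : ∀ c : k, ∃ z, z ^ p ^ b = c := fun c =>
    IsAlgClosed.exists_pow_nat_eq c (pow_pos (Fact.out : p.Prime).pos b)
  choose rt hrt using hroot
  let y : J → RR k T := fun j => ∑ i, rt (γ i j) • tt i
  have hy : ∀ j, y j ^ p ^ b = ∑ i, γ i j • tt i ^ p ^ b := by
    intro j
    simp only [y]
    rw [sum_pow_char_pow]
    refine Finset.sum_congr rfl fun i _ => ?_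
    rw [_root_.smul_pow, hrt]
  have h1 : ∑ j, bb j * y j ^ p ^ b = 0 := by
    rw [← h0]
    simp only [hy, Finset.mul_sum, Finset.sum_mul]
    rw [Finset.sum_comm]
    refine Finset.sum_congr rfl fun i _ => Finset.sum_congr rfl fun j _ => ?_
    rw [mul_smul_comm, smul_mul_assoc]
  obtain ⟨i0, j0, hij⟩ := hγ
  have hyj : y j0 ≠ 0 := by
    intro hy0
    have := (Fintype.linearIndependent_iff.1 htt) (fun i => rt (γ i j0)) hy0 i0
    apply hij
    rw [← hrt (γ i0 j0), this, zero_pow (pow_pos (Fact.out : p.Prime).pos b).ne']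
  obtain ⟨φ, hφ⟩ := exists_point_ne hc _ hyj
  let s : RR k T := ∑ j, (φ (y j)) ^ p ^ b • bb j
  have hs0 : s ≠ 0 := by
    intro hs
    have := (Fintype.linearIndependent_iff.1 hbb) (fun j => (φ (y j)) ^ p ^ b) hs j0
    exact hφ (eq_zero_of_pow_eq_zero this)
  have hsV : (s : L) ∈ VV k T ^ m := by
    have : (s : L) = ∑ j, (φ (y j)) ^ p ^ b • (bb j : L) := by
      simp only [s]
      have h9 := map_sum (RR k T).val (fun j => (φ (y j)) ^ p ^ b • bb j) Finset.univ
      exact h9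
    rw [this]
    exact Submodule.sum_mem _ fun j _ => Submodule.smul_mem _ _ (hbV j)
  have hsm : s ∈ RingHom.ker φ ^ p ^ b := by
    have : s = - ∑ j, bb j * (y j - algebraMap k _ (φ (y j))) ^ p ^ b := by
      have h2 : ∀ j, bb j * (y j - algebraMap k _ (φ (y j))) ^ p ^ b =
          bb j * y j ^ p ^ b - (φ (y j)) ^ p ^ b • bb j := by
        intro j
        rw [sub_pow_char_pow, mul_sub, ← map_pow, mul_comm (bb j) (algebraMap k _ _), ← Algebra.smul_def]
      simp only [h2]
      rw [Finset.sum_sub_distrib, h1]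
      simp [s]
    rw [this]
    refine Submodule.neg_mem _ (Ideal.sum_mem _ fun j _ => Ideal.mul_mem_left _ _ (Ideal.pow_mem_pow ?_ _))
    simp [RingHom.mem_ker]
  exact absurd (ker_pow_dim hc s hs0 hsV φ _ hsm) (by omega)

theorem stepanov [IsAlgClosed k] [FiniteDimensional F L] [IsGalois F L] (hc : Core k F L h T)
    {p : ℕ} [Fact p.Prime] [CharP k p] (a b M m n : ℕ) (hb : b ≠ 0) (hM : M ≤ p)
    (h1 : Module.finrank F L * (m + 2 * (d * d) + 1) < p ^ b)
    (h2 : M * (p ^ a * (m + M * (d * d)) + n + 2 * (d * d) + 1) < Module.finrank F L * n * (m - d * d))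
    (g : L ≃ₐ[F] L) {ι : Type} [Fintype ι] (Φ : ι → (RR k T →ₐ[k] k)) (hΦ : Function.Injective Φ)
    (hx : ∀ i, Φ i (xR k T) ^ p ^ (a + b) = Φ i (xR k T))
    (ht : ∀ i j, Φ i (tR k T j) ^ p ^ (a + b) = Φ i (galR hc g (tR k T j)))
    (hinj : ∀ i, Function.Injective fun j => Φ i (tR k T j)) :
    Fintype.card ι * M ≤ Module.finrank F L * (m + p ^ b * (n + d * d) + 2 * (d * d) + 1) := by
  classical
  obtain ⟨D', hD', hDV⟩ := exists_Dp (F := F) hc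
  obtain ⟨r, hr⟩ : ∃ r, r = Module.finrank F L := ⟨_, rfl⟩
  obtain ⟨tt, htt, httV, httφ⟩ := step_family hc n
  rw [← hr] at h1 h2
  rw [← hr]
  revert tt htt httV httφ
  rw [← hr]
  intro tt htt httV httφ
  set N := Module.finrank k ↥(VV k T ^ m) with hN
  let B := Module.finBasis k ↥(VV k T ^ m)
  let bb : Fin N → RR k T := fun j => ⟨B j, VV_le_RR (B j).2⟩
  have hbb : LinearIndependent k bb := by
    refine LinearIndependent.of_comp ((RR k T).val.toLinearMap.restrictScalars k) ?_
    exact B.linearIndependent.map' (VV k T ^ m).subtype (Submodule.ker_subtype _)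
  have hbV : ∀ j, (bb j : L) ∈ VV k T ^ m := fun j => (B j).2
  set U := p ^ a * (m + M * (d * d)) + (n + d * d) with hU
  have hvV : ∀ (x : (Fin n × Fin r) × Fin N) (i : Fin M),
      ((((D' : RR k T → RR k T)^[i] (bb x.2)) ^ p ^ a * galR hc g (tt x.1) : RR k T) : L) ∈ VV k T ^ U := by
    intro x i
    have h3 := D_iter_mem hDV i m (bb x.2) (hbV x.2)
    have h4 := VV_pow (n := p ^ a) h3
    have h5 : ((galR hc g (tt x.1) : RR k T) : L) ∈ VV k T ^ (n + d * d) := gal_VV hc g (httV x.1)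
    refine VV_mono ?_ (VV_mul h4 h5)
    rw [hU, mul_comm (p ^ a)]
    gcongr
    exact i.2.le
  let v : (Fin n × Fin r) × Fin N → (Fin M → ↥(VV k T ^ U)) := fun x i => ⟨_, hvV x i⟩
  have hdep : ¬ LinearIndependent k v := by
    intro hli
    have h3 := hli.fintype_card_le_finrank
    rw [Module.finrank_pi_fintype] at h3
    simp only [Finset.sum_const, Finset.card_univ, Fintype.card_fin, Fintype.card_prod, smul_eq_mul] at h3
    have h4 := dim_upper hc U
    have h5 := dim_lower hc m
    rw [← hN] at h5
    rw [← hr] at h4 h5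
    have h6 : n * r * (r * (m - d * d)) ≤ M * (r * (U + d * d + 1)) :=
      (Nat.mul_le_mul_left _ h5).trans (h3.trans (Nat.mul_le_mul_left _ h4))
    have hrpos : 0 < r := hr ▸ Module.finrank_pos
    have h7 : r * (r * n * (m - d * d)) ≤ r * (M * (U + d * d + 1)) := by
      calc r * (r * n * (m - d * d)) = n * r * (r * (m - d * d)) := by ring
        _ ≤ _ := h6
        _ = _ := by ring
    have h8 := Nat.le_of_mul_le_mul_left h7 hrpos
    have h9 : U + d * d + 1 = p ^ a * (m + M * (d * d)) + n + 2 * (d * d) + 1 := by rw [hU]; ring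
    rw [h9] at h8
    omega
  obtain ⟨c, hc0, ⟨x0, hx0⟩⟩ := Fintype.not_linearIndependent_iff.1 hdep
  have hroot : ∀ c : k, ∃ z, z ^ p ^ a = c := fun c =>
    IsAlgClosed.exists_pow_nat_eq c (pow_pos (Fact.out : p.Prime).pos a)
  choose rt hrt using hroot
  let γ : Fin n × Fin r → Fin N → k := fun i j => rt (c (i, j))
  have hγ : ∃ i j, γ i j ≠ 0 := by
    refine ⟨x0.1, x0.2, fun h0 => hx0 ?_⟩
    rw [← hrt (c x0)]
    have : rt (c x0) = 0 := h0
    rw [this, zero_pow (pow_pos (Fact.out : p.Prime).pos a).ne']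
  let G : RR k T := ∑ i, (∑ j, γ i j • bb j) * tt i ^ p ^ b
  have hG0 : G ≠ 0 := nonvanish hc b m (hr ▸ h1) tt htt bb hbb hbV γ hγ
  have hGV : (G : L) ∈ VV k T ^ (m + p ^ b * (n + d * d)) := by
    have : (G : L) = ∑ i, (∑ j, γ i j • (bb j : L)) * (tt i : L) ^ p ^ b := by
      have h9 := map_sum (RR k T).val (fun i => (∑ j, γ i j • bb j) * tt i ^ p ^ b) Finset.univ
      refine h9.trans (Finset.sum_congr rfl fun i _ => ?_)
      rw [map_mul, map_pow, map_sum]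
      rfl
    rw [this]
    refine Submodule.sum_mem _ fun i _ => VV_mul
      (Submodule.sum_mem _ fun j _ => Submodule.smul_mem _ _ (hbV j)) ?_
    rw [mul_comm]
    exact VV_pow (httV i)
  have hGW : ∀ l, G ∈ WW D' (Φ l) M := by
    intro l
    apply mem_WW_of
    intro i hi
    have hpa : (0 : ℕ) < p ^ a := pow_pos (Fact.out : p.Prime).pos a
    refine eq_zero_of_pow_eq_zero (n := p ^ a) ?_
    have h3 : (D' : RR k T → RR k T)^[i] G =
        ∑ s, (∑ j, γ s j • (D' : RR k T → RR k T)^[i] (bb j)) * tt s ^ p ^ b := by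
      have h4 := D_iter_sum (D' := D') Finset.univ i (fun _ : Fin n × Fin r => (1 : k))
        (fun s => (∑ j, γ s j • bb j) * tt s ^ p ^ b)
      simp only [one_smul] at h4
      rw [h4]
      refine Finset.sum_congr rfl fun s _ => ?_
      rw [D_iter_mul_pow i b hb, D_iter_sum]
    have h4 : ∑ x, c x • ((((D' : RR k T → RR k T)^[i] (bb x.2)) ^ p ^ a * galR hc g (tt x.1) : RR k T)) = 0 := by
      have h5 := congrArg (fun z => ((z ⟨i, hi⟩ : ↥(VV k T ^ U)) : L)) hc0
      simp only [Finset.sum_apply, Pi.smul_apply, Pi.zero_apply] at h5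
      apply Subtype.ext
      have h9 := map_sum (RR k T).val (fun x => c x • ((((D' : RR k T → RR k T)^[i] (bb x.2)) ^ p ^ a * galR hc g (tt x.1) : RR k T))) Finset.univ
      refine h9.trans (Eq.trans ?_ h5)
      have h10 := map_sum (VV k T ^ U).subtype (fun x => c x • v x ⟨i, hi⟩) Finset.univ
      exact h10.symm
    rw [← map_pow, h3, sum_pow_char_pow, map_sum]
    have h6 := congrArg (Φ l) h4
    rw [map_zero, map_sum, Fintype.sum_prod_type] at h6
    rw [← h6]
    refine Finset.sum_congr rfl fun s _ => ?_
    rw [mul_pow, sum_pow_char_pow, map_mul, map_pow, map_pow, ← pow_mul, ← pow_add, add_comm b a,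
      httφ (Φ l) g _ (hx l) (ht l), map_sum, Finset.sum_mul]
    refine Finset.sum_congr rfl fun j _ => ?_
    rw [_root_.smul_pow, hrt, map_smul, map_smul, map_mul]
    simp only [smul_eq_mul]
    ring
  have hGi : G ∈ ⨅ l, WW D' (Φ l) M := by rw [Ideal.mem_iInf]; exact hGW
  have h3 := zero_lemma hc G hG0 hGV _ hGi
  have hfin : Module.Finite k (RR k T ⧸ ⨅ l, WW D' (Φ l) M) := fin_of_rank_le h3
  have h4 := crt_le (k := k) (fun l => WW D' (Φ l) M) (by
      intro l l' hll
      have h5 := (ker_coprime (Φ l) (Φ l') (fun h0 => hll (hΦ h0))).pow (m := M) (n := M)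
      rw [Function.onFun, Ideal.isCoprime_iff_sup_eq]
      rw [Ideal.isCoprime_iff_sup_eq] at h5
      rw [eq_top_iff, ← h5]
      exact sup_le_sup (ker_pow_le_WW D' _ M) (ker_pow_le_WW D' _ M)) M hfin
    (fun l hl => chain_le (WW D' (Φ l)) M
      (fun i hi => WW_lt D' hD' (Φ l) (phi_DelR _ (hinj l)) i (by omega)) hl)
  rw [← Module.finrank_eq_rank, ← hr] at h3
  exact h4.trans (by exact_mod_cast h3)

end Core
end LineIrr
set_option linter.unusedSectionVars false
set_option linter.unusedVariables false
set_option linter.style.haveILetI false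

namespace LineIrr

section Core

variable {k F L : Type} [Field k] [Field F] [Field L]
  [Algebra k[X] F] [IsFractionRing k[X] F] [Algebra k L] [Algebra k[X] L] [Algebra F L]
  [IsScalarTower k k[X] L] [IsScalarTower k[X] F L]
variable {d : ℕ} {h : k[X][X]} {T : Fin d → L} [hinj : Fact (Function.Injective T)]


lemma params_aux (r w A Q M : ℕ) (hr : 0 < r) (hA : 0 < A) (hM : 0 < M) (h1 : M * M * A ≤ Q)
    (h2 : Q ≤ 4 * (M * M * A)) (hB : r * (2 * w + 3) * (3 * w + 2) + (r * (2 * w + 3) + r + 2 * w + 1) ^ 2 + r * (2 * w + 1) < Q) :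
    ∃ m n, r * (m + 2 * w + 1) < Q ∧ M * (A * (m + M * w) + n + 2 * w + 1) < r * n * (m - w) ∧
      ∀ N, N * M ≤ r * (m + Q * (n + w) + 2 * w + 1) →
        (N : ℝ) ≤ A * Q + (2 * (1 + r * (2 * w + 3) + r + r * w) : ℕ) * √(A * Q) := by
  obtain ⟨C', hC'⟩ : ∃ C', C' = r * (2 * w + 3) := ⟨_, rfl⟩
  obtain ⟨B, hBd⟩ : ∃ B, B = C' + r + 2 * w + 1 := ⟨_, rfl⟩
  rw [← hC'] at hB ⊢
  rw [← hBd] at hB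
  have hdiv := Nat.div_add_mod (Q - 1) r
  have hmod := Nat.mod_lt (Q - 1) hr
  obtain ⟨u, hu⟩ : ∃ u, u = (Q - 1) / r := ⟨_, rfl⟩
  rw [← hu] at hdiv
  have hBsq : B ^ 2 ≤ Q := by omega
  have hCQ : C' * (3 * w + 2) < Q := by
    have := Nat.zero_le (B ^ 2); omega
  have hu1 : 2 * w + 1 ≤ u := by
    rw [hu, Nat.le_div_iff_mul_le hr, mul_comm]
    have := Nat.zero_le (B ^ 2)
    have := Nat.zero_le (C' * (3 * w + 2))
    omega
  obtain ⟨m, hm⟩ := Nat.exists_eq_add_of_le hu1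
  have hm1 : r * (m + 2 * w + 1) < Q := by
    have : r * (m + 2 * w + 1) = r * u := by rw [hm]; ring
    omega
  have hm2 : Q ≤ r * (m + 2 * w + 2) := by
    have : r * (m + 2 * w + 2) = r * u + r := by rw [hm]; ring
    omega
  have hdn := Nat.div_add_mod (M * A + C') r
  have hmn := Nat.mod_lt (M * A + C') hr
  obtain ⟨n, hn⟩ : ∃ n, n = (M * A + C') / r + 1 := ⟨_, rfl⟩
  have hn1 : M * A + C' ≤ r * n := by
    have : r * n = r * ((M * A + C') / r) + r := by rw [hn]; ring
    omega
  have hn2 : r * n ≤ M * A + C' + r := by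
    have : r * n = r * ((M * A + C') / r) + r := by rw [hn]; ring
    omega
  have hMB : M * B ≤ Q := by
    have hMM : M * M ≤ Q := le_trans (Nat.le_mul_of_pos_right _ hA) h1
    by_contra hcon
    push Not at hcon
    have : Q * Q < (M * B) * (M * B) := Nat.mul_self_lt_mul_self hcon
    have h3 : (M * B) * (M * B) = (M * M) * B ^ 2 := by ring
    have h4 := Nat.mul_le_mul hMM hBsq
    omega
  have hwm : w ≤ m := by
    by_contra hcon
    push Not at hcon
    have h3 : r * (m + 2 * w + 2) ≤ r * (3 * w + 2) := Nat.mul_le_mul_left _ (by omega)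
    have h4 : r * (3 * w + 2) ≤ C' * (3 * w + 2) := by
      rw [hC']; gcongr; exact Nat.le_mul_of_pos_right _ (by omega)
    omega
  obtain ⟨z, hz⟩ := Nat.exists_eq_add_of_le hwm
  refine ⟨m, n, hm1, ?_, ?_⟩
  · have e1 : m - w = z := by omega
    rw [e1]
    have h3 : (M * A + C') * z ≤ r * n * z := Nat.mul_le_mul_right _ hn1
    refine lt_of_lt_of_le ?_ h3
    have h4 : M * n ≤ M * (M * A + C' + r) := Nat.mul_le_mul_left _ (le_trans (Nat.le_mul_of_pos_left _ hr) hn2)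
    have h5 : (2 * w + 3) * Q ≤ C' * (z + 3 * w + 2) := by
      rw [hC']
      calc (2 * w + 3) * Q ≤ (2 * w + 3) * (r * (m + 2 * w + 2)) := Nat.mul_le_mul_left _ hm2
        _ = _ := by rw [hz]; ring
    have h6 : M * A ≤ Q := le_trans (by nlinarith) h1
    have h6w : M * A * w ≤ Q * w := Nat.mul_le_mul_right _ h6
    have h7w : M * M * A * w ≤ Q * w := Nat.mul_le_mul_right _ h1
    have e2 : M * B = M * C' + M * r + 2 * (M * w) + M := by rw [hBd]; ring
    have e3 : M * (A * (m + M * w) + n + 2 * w + 1) = M * A * z + M * A * w + M * M * A * w + M * n + 2 * (M * w) + M := by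
      rw [hz]; ring
    have e4 : M * (M * A + C' + r) = M * M * A + M * C' + M * r := by ring
    have e5 : C' * (z + 3 * w + 2) = C' * z + C' * (3 * w + 2) := by ring
    have e6 : (2 * w + 3) * Q = 2 * (Q * w) + 3 * Q := by ring
    have e7 : (M * A + C') * z = M * A * z + C' * z := by ring
    rw [e3, e7]
    omega
  · intro N hN
    have h3 : N * M ≤ M * (A * Q) + (1 + C' + r + r * w) * Q := by
      have e1 : r * (m + Q * (n + w) + 2 * w + 1) = r * (m + 2 * w + 1) + Q * (r * n) + Q * (r * w) := by ring
      have e2 : Q * (r * n) ≤ Q * (M * A + C' + r) := Nat.mul_le_mul_left _ hn2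
      have e3 : M * (A * Q) + (1 + C' + r + r * w) * Q = Q + Q * (M * A + C' + r) + Q * (r * w) := by ring
      omega
    have hq : 0 ≤ (A : ℝ) * Q := by positivity
    have h4 : (Q : ℝ) ≤ 2 * M * √(A * Q) := by
      refine abs_le_of_sq_le_sq' ?_ (by positivity) |>.2
      rw [mul_pow, Real.sq_sqrt hq]
      have h2' : (Q : ℝ) ≤ 4 * (M * M * A) := by exact_mod_cast h2
      nlinarith [(Nat.cast_nonneg Q : (0 : ℝ) ≤ Q)]
    have h3' : (N : ℝ) * M ≤ M * (A * Q) + (1 + C' + r + r * w : ℕ) * Q := by exact_mod_cast h3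
    have hM' : (0 : ℝ) < M := by exact_mod_cast hM
    refine le_of_mul_le_mul_right (h3'.trans ?_) hM'
    have h5 : ((1 + C' + r + r * w : ℕ) : ℝ) * Q ≤ (1 + C' + r + r * w : ℕ) * (2 * M * √(A * Q)) := by gcongr
    refine (add_le_add_right h5 _).trans (le_of_eq ?_)
    push_cast
    ring

lemma params (r w : ℕ) (hr : 0 < r) : ∃ C Q0 : ℕ, ∀ p e : ℕ, p.Prime → Q0 ≤ p ^ e →
    ∃ a b M m n, a + b = e ∧ b ≠ 0 ∧ M ≤ p ∧ 0 < M ∧ r * (m + 2 * w + 1) < p ^ b ∧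
      M * (p ^ a * (m + M * w) + n + 2 * w + 1) < r * n * (m - w) ∧
      ∀ N, N * M ≤ r * (m + p ^ b * (n + w) + 2 * w + 1) →
        (N : ℝ) ≤ (p ^ e : ℕ) + C * √((p ^ e : ℕ)) := by
  obtain ⟨S, hS⟩ : ∃ S, S = r * (2 * w + 3) * (3 * w + 2) + (r * (2 * w + 3) + r + 2 * w + 1) ^ 2 + r * (2 * w + 1) := ⟨_, rfl⟩
  refine ⟨2 * (1 + r * (2 * w + 3) + r + r * w), (S + 1) ^ 2, fun p e hp hQ => ?_⟩
  have hS0 : 0 < S := by rw [hS]; positivity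
  obtain ⟨a, b, M, hab, hb, hM, hM0, h1, h2, hle⟩ : ∃ a b M, a + b = e ∧ b ≠ 0 ∧ M ≤ p ∧ 0 < M ∧
      M * M * p ^ a ≤ p ^ b ∧ p ^ b ≤ 4 * (M * M * p ^ a) ∧ a ≤ b := by
    have he0 : e ≠ 0 := by
      rintro rfl
      rw [pow_zero] at hQ
      nlinarith
    rcases Nat.even_or_odd' e with ⟨a, ha | ha⟩
    · exact ⟨a, a, 1, by omega, by omega, hp.one_lt.le, one_pos, by simp, by omega, le_rfl⟩
    · refine ⟨a, a + 1, Nat.sqrt p, by omega, by omega, Nat.sqrt_le_self p, Nat.sqrt_pos.2 hp.pos, ?_, ?_, by omega⟩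
      · rw [pow_succ, mul_comm (p ^ a)]
        exact Nat.mul_le_mul_right _ (Nat.sqrt_le p)
      · rw [pow_succ, mul_comm (p ^ a), ← mul_assoc]
        refine Nat.mul_le_mul_right _ ?_
        have h3 := Nat.lt_succ_sqrt p
        have h4 : 0 < Nat.sqrt p := Nat.sqrt_pos.2 hp.pos
        simp only [Nat.succ_eq_add_one] at h3
        nlinarith
  have hSb : S < p ^ b := by
    have h3 : p ^ e ≤ p ^ b * p ^ b := by
      rw [← pow_add]; exact Nat.pow_le_pow_right hp.pos (by omega)
    by_contra hcon
    push Not at hcon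
    have h4 := Nat.mul_le_mul hcon hcon
    nlinarith
  obtain ⟨m, n, h3, h4, h5⟩ := params_aux r w (p ^ a) (p ^ b) M hr (pow_pos hp.pos _) hM0 h1 h2 (by rw [← hS]; exact hSb)
  refine ⟨a, b, M, m, n, hab, hb, hM, hM0, h3, h4, fun N hN => ?_⟩
  have h6 := h5 N hN
  have e1 : ((p ^ e : ℕ) : ℝ) = ((p ^ a : ℕ) : ℝ) * ((p ^ b : ℕ) : ℝ) := by
    rw [← hab, pow_add]; push_cast; ring
  rw [e1]
  exact h6

theorem stepanov_bound (d : ℕ) : ∃ C Q0 : ℕ, ∀ (k F L : Type) [Field k] [Field F] [Field L]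
  [Algebra k[X] F] [IsFractionRing k[X] F] [Algebra k L] [Algebra k[X] L] [Algebra F L]
  [IsScalarTower k k[X] L] [IsScalarTower k[X] F L] (h : k[X][X]) (T : Fin d → L)
  [Fact (Function.Injective T)]
  [IsAlgClosed k] [FiniteDimensional F L] [IsGalois F L] (hc : Core k F L h T)
    (p : ℕ) [Fact p.Prime] [CharP k p] (e : ℕ) (he : Q0 ≤ p ^ e)
    (g : L ≃ₐ[F] L) (ι : Type) [Fintype ι] (Φ : ι → (RR k T →ₐ[k] k)) (hΦ : Function.Injective Φ)
    (hx : ∀ i, Φ i (xR k T) ^ p ^ e = Φ i (xR k T))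
    (ht : ∀ i j, Φ i (tR k T j) ^ p ^ e = Φ i (galR hc g (tR k T j)))
    (hinj : ∀ i, Function.Injective fun j => Φ i (tR k T j)),
    (Fintype.card ι : ℝ) ≤ (p ^ e : ℕ) + C * √((p ^ e : ℕ)) := by
  have hp : ∀ r : ℕ, ∃ C Q0 : ℕ, 0 < r → ∀ p e : ℕ, p.Prime → Q0 ≤ p ^ e →
    ∃ a b M m n, a + b = e ∧ b ≠ 0 ∧ M ≤ p ∧ 0 < M ∧ r * (m + 2 * (d * d) + 1) < p ^ b ∧
      M * (p ^ a * (m + M * (d * d)) + n + 2 * (d * d) + 1) < r * n * (m - (d * d)) ∧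
      ∀ N, N * M ≤ r * (m + p ^ b * (n + (d * d)) + 2 * (d * d) + 1) →
        (N : ℝ) ≤ (p ^ e : ℕ) + C * √((p ^ e : ℕ)) := by
    intro r
    rcases Nat.eq_zero_or_pos r with hr | hr
    · exact ⟨0, 0, fun h0 => absurd h0 (by omega)⟩
    · obtain ⟨C, Q0, h1⟩ := params r (d * d) hr
      exact ⟨C, Q0, fun _ => h1⟩
  choose C Q0 hCQ using hp
  refine ⟨∑ r ∈ Finset.range (d ^ d + 1), C r, ∑ r ∈ Finset.range (d ^ d + 1), Q0 r, ?_⟩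
  intro k F L _ _ _ _ _ _ _ _ _ _ h T _ _ _ _ hc p _ _ e he g ι _ Φ hΦ hx ht hinj
  have hrm : Module.finrank F L ∈ Finset.range (d ^ d + 1) := by
    rw [Finset.mem_range]; have := finrank_le hc; omega
  have hC := Finset.single_le_sum (f := C) (fun i _ => Nat.zero_le _) hrm
  have hQ := Finset.single_le_sum (f := Q0) (fun i _ => Nat.zero_le _) hrm
  obtain ⟨a, b, M, m, n, rfl, hb, hM, hM0, h1, h2, h3⟩ :=
    hCQ (Module.finrank F L) Module.finrank_pos p e Fact.out (hQ.trans he)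
  refine (h3 _ (stepanov hc a b M m n hb hM h1 h2 g Φ hΦ hx ht hinj)).trans ?_
  gcongr

end Core
end LineIrr
set_option linter.unusedSectionVars false
set_option linter.unusedVariables false
set_option linter.style.haveILetI false

namespace LineIrr

lemma exists_roots {E : Type} [Field E] {d : ℕ} (f : E[X]) (hm : f.Monic) (hd : f.natDegree = d)
    (hs : f.Splits) : ∃ t : Fin d → E, f = ∏ i, (X - C (t i)) := by
  have h1 := hs.eq_prod_roots
  rw [hm.leadingCoeff, C_1, one_mul] at h1
  have h2 : f.roots.toList.length = d := by
    rw [Multiset.length_toList, ← hd]; exact hs.natDegree_eq_card_roots.symm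
  refine ⟨fun i => f.roots.toList.get (i.cast h2.symm), ?_⟩
  conv_lhs => rw [h1]
  subst h2
  conv_lhs => rw [← Multiset.coe_toList f.roots, Multiset.map_coe, Multiset.prod_coe]
  rw [← Fin.prod_univ_fun_getElem]
  rfl

/-- packaged data -/
structure Pack (k : Type) [Field k] (d : ℕ) (h : k[X][X]) where
  L : Type
  [fL : Field L]
  [akL : Algebra k L]
  [axL : Algebra k[X] L]
  [aFL : Algebra (FractionRing k[X]) L]
  [t1 : IsScalarTower k k[X] L]
  [t2 : IsScalarTower k[X] (FractionRing k[X]) L]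
  T : Fin d → L
  [hfin : FiniteDimensional (FractionRing k[X]) L]
  [hgal : IsGalois (FractionRing k[X]) L]
  [hinj : Fact (Function.Injective T)]
  core : Core k (FractionRing k[X]) L h T

attribute [instance] Pack.fL Pack.akL Pack.axL Pack.aFL Pack.t1 Pack.t2 Pack.hfin Pack.hgal Pack.hinj

lemma inj_of_top {k F L : Type} [Field k] [Field F] [Field L]
  [Algebra k[X] F] [IsFractionRing k[X] F] [Algebra k L] [Algebra k[X] L] [Algebra F L]
  [IsScalarTower k k[X] L] [IsScalarTower k[X] F L] {d : ℕ} {h : k[X][X]} {T : Fin d → L}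
  (hc : Core k F L h T) (hB : TopSep d h) : Function.Injective T := by
  obtain ⟨A, hA⟩ := place_exists hc
  intro i j hij
  by_contra hne
  have h1 := place_top hc hA hB hne
  rw [hij, sub_self, map_zero] at h1
  have := hA.big
  rw [← h1] at this
  exact absurd this (not_lt.2 zero_le_one)

lemma sep_of_inj {E : Type} [Field E] {d : ℕ} {t : Fin d → E} (ht : Function.Injective t) :
    (∏ i, (X - C (t i))).Separable :=
  separable_prod_X_sub_C_iff.2 ht

lemma exists_pack {k : Type} [Field k] {d : ℕ} (h : k[X][X]) (hm : h.Monic) (hd : h.natDegree = d)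
    (hw : ∀ i, i ≤ d → (h.coeff i).natDegree ≤ d - i)
    (hs : TopSep d h ∨ (h.map (algebraMap k[X] (FractionRing k[X]))).Separable) : Nonempty (Pack k d h) := by
  let f := h.map (algebraMap k[X] (FractionRing k[X]))
  let L := f.SplittingField
  have hsp : (f.map (algebraMap (FractionRing k[X]) L)).Splits := SplittingField.splits f
  have t2 : IsScalarTower k[X] (FractionRing k[X]) L := inferInstance
  have t1 : IsScalarTower k k[X] L := by
    refine IsScalarTower.of_algebraMap_eq fun c => ?_
    rw [IsScalarTower.algebraMap_apply k[X] (FractionRing k[X]) L,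
      ← IsScalarTower.algebraMap_apply k k[X] (FractionRing k[X])]
    rfl
  have hmap : f.map (algebraMap (FractionRing k[X]) L) = h.map (algebraMap k[X] L) := by
    simp only [f]
    rw [Polynomial.map_map, ← IsScalarTower.algebraMap_eq]
  obtain ⟨T, hT⟩ := exists_roots (d := d) (f.map (algebraMap (FractionRing k[X]) L)) ((hm.map _).map _)
    (by rw [(hm.map _).natDegree_map, hm.natDegree_map, hd]) hsp
  have hc : Core k (FractionRing k[X]) L h T := by
    refine ⟨hw, ?_, ?_⟩
    · rw [← hmap]; exact hT
    · have h1 := SplittingField.adjoin_rootSet f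
      rw [eq_top_iff, ← h1]
      refine Algebra.adjoin_mono ?_
      intro y hy
      rw [mem_rootSet'] at hy
      have h2 := hy.2
      rw [aeval_def, ← eval_map, hT, eval_prod, Finset.prod_eq_zero_iff] at h2
      obtain ⟨i, -, hi⟩ := h2
      refine ⟨i, ?_⟩
      simp only [eval_sub, eval_X, eval_C] at hi
      exact (sub_eq_zero.1 hi).symm
  have hi : Function.Injective T := by
    rcases hs with hs | hs
    · exact inj_of_top hc hs
    · have h1 : (f.map (algebraMap (FractionRing k[X]) L)).Separable := hs.map
      rw [hT] at h1
      exact separable_prod_X_sub_C_iff.1 h1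
  have hsep : f.Separable := by
    rw [← separable_map (algebraMap (FractionRing k[X]) L), hT]
    exact sep_of_inj hi
  have hgal : IsGalois (FractionRing k[X]) L := IsGalois.of_separable_splitting_field (p := f) hsep
  exact ⟨@Pack.mk k _ d h L _ _ _ _ t1 t2 T inferInstance hgal ⟨hi⟩ hc⟩

end LineIrr
set_option linter.unusedSectionVars false
set_option linter.unusedVariables false
set_option linter.style.haveILetI false

namespace LineIrr

section Count

variable {K k : Type} [Field K] [Fintype K] [Field k] [Algebra K k] {d : ℕ}

/-- points with a labelling of the fibre -/
def PP (K : Type) {k : Type} [Field K] [Field k] [Algebra K k] (d : ℕ) (h : k[X][X]) : Type :=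
  {y : K × (Fin d → k) // Function.Injective y.2 ∧ sp h (algebraMap K k y.1) = ∏ i, (X - C (y.2 i))}

instance (h : k[X][X]) : Finite (PP K d h) := by
  classical
  let S : Finset k := Finset.univ.biUnion (fun x0 : K => (sp h (algebraMap K k x0)).roots.toFinset)
  have hS : ∀ (y : PP K d h) (i : Fin d), y.1.2 i ∈ S := by
    intro y i
    simp only [S, Finset.mem_biUnion, Finset.mem_univ, true_and, Multiset.mem_toFinset]
    refine ⟨y.1.1, ?_⟩
    rw [mem_roots', y.2.2]
    refine ⟨(monic_prod_X_sub_C _ _).ne_zero, ?_⟩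
    rw [IsRoot, eval_prod]
    exact Finset.prod_eq_zero (Finset.mem_univ i) (by simp)
  refine Finite.of_injective (β := K × (Fin d → S)) (fun y => (y.1.1, fun i => ⟨y.1.2 i, hS y i⟩)) ?_
  intro y z hyz
  simp only [Prod.mk.injEq] at hyz
  apply Subtype.ext
  refine Prod.ext hyz.1 ?_
  funext i
  exact congrArg Subtype.val (congrFun hyz.2 i)

/-- points with Frobenius class `σ` -/
def PS (K : Type) {k : Type} [Field K] [Fintype K] [Field k] [Algebra K k] (d : ℕ) (h : k[X][X])
    (σ : Equiv.Perm (Fin d)) : Type :=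
  {y : PP K d h // ∀ i, y.1.2 i ^ Fintype.card K = y.1.2 (σ i)}

instance (h : k[X][X]) (σ : Equiv.Perm (Fin d)) : Finite (PS K d h σ) := Subtype.finite

theorem sigma_le (d : ℕ) : ∃ C Q0 : ℕ, ∀ (K k : Type) [Field K] [Fintype K] [Field k] [Algebra K k]
    [IsAlgClosed k] (h : k[X][X]), Q0 ≤ Fintype.card K → h.Monic → h.natDegree = d →
    (∀ i, i ≤ d → (h.coeff i).natDegree ≤ d - i) → TopSep d h → SmoothH h → SimpleBr d h →
    ∀ σ : Equiv.Perm (Fin d), (Nat.card (PS K d h σ) : ℝ) ≤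
      (Fintype.card K : ℕ) + C * √((Fintype.card K : ℕ)) := by
  obtain ⟨C, Q0, hCQ⟩ := stepanov_bound d
  refine ⟨C, Q0, ?_⟩
  intro K k _ _ _ _ _ h hQ hm hd hw hB hs hbr σ
  obtain ⟨⟨L, T, hc⟩⟩ := exists_pack h hm hd hw (Or.inl hB)
  obtain ⟨p, hp⟩ := CharP.exists K
  obtain ⟨e, hpp, hq⟩ := FiniteField.card K p
  have : Fact p.Prime := ⟨hpp⟩
  have : CharP k p := charP_of_injective_algebraMap (algebraMap K k).injective p
  obtain ⟨g, hg⟩ := monodromy hc hB hs hbr σ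
  have hall := fun τ => monodromy hc hB hs hbr τ
  have h1 : ∀ y : PS K d h σ, ∃ φ : RR k T →ₐ[k] k, φ (xR k T) = algebraMap K k y.1.1.1 ∧
      ∀ i, φ (tR k T i) = y.1.1.2 i := fun y => exists_phi_t hc hall _ _ y.1.2.2
  choose Φ hΦx hΦt using h1
  have : Fintype (PS K d h σ) := Fintype.ofFinite _
  rw [Nat.card_eq_fintype_card, hq]
  refine hCQ k (FractionRing k[X]) L h T hc p e (by rw [← hq]; exact hQ) g (PS K d h σ) Φ ?_ ?_ ?_ ?_
  · intro y z hyz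
    apply Subtype.ext
    apply Subtype.ext
    refine Prod.ext ?_ ?_
    · apply (algebraMap K k).injective
      rw [← hΦx, ← hΦx, hyz]
    · funext i
      rw [← hΦt, ← hΦt, hyz]
  · intro y
    rw [hΦx, ← map_pow, ← hq, FiniteField.pow_card]
  · intro y j
    have h2 : galR hc g (tR k T j) = tR k T (σ j) := Subtype.ext (hg j)
    rw [h2, hΦt, hΦt, ← hq]
    exact y.2 j
  · intro y i j hij
    simp only [hΦt] at hij
    exact y.1.2.1 hij

lemma good_points [IsAlgClosed k] (h : k[X][X]) (hm : h.Monic) (hd : h.natDegree = d)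
    (hw : ∀ i, i ≤ d → (h.coeff i).natDegree ≤ d - i)
    (hs : TopSep d h ∨ (h.map (algebraMap k[X] (FractionRing k[X]))).Separable) :
    ∃ P : k[X], P ≠ 0 ∧ P.natDegree ≤ d ^ d * (d * d) ∧ ∀ x0, P.eval x0 ≠ 0 →
      ∃ t : Fin d → k, Function.Injective t ∧ sp h x0 = ∏ i, (X - C (t i)) := by
  obtain ⟨⟨L, T, hc⟩⟩ := exists_pack h hm hd hw hs
  obtain ⟨P, hP0, hPd, hP⟩ := norm_lemma hc (DelR k T) (DelR_ne hc) DelR_mem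
  refine ⟨P, hP0, hPd.trans (Nat.mul_le_mul_right _ (finrank_le hc)), fun x0 hx0 => ?_⟩
  obtain ⟨φ, hφ⟩ := exists_phi hc x0
  refine ⟨fun i => φ (tR k T i), ?_, by rw [← hφ]; exact phi_split hc φ⟩
  have h1 : φ (DelR k T) ≠ 0 := fun h0 => hx0 (by rw [← hφ]; exact hP φ h0)
  intro i j hij
  by_contra hne
  apply h1
  rw [DelR, map_prod]
  exact Finset.prod_eq_zero (i := (i, j)) (by simp [hne]) (by simpa [sub_eq_zero] using hij)

lemma PP_lower [IsAlgClosed k] (h : k[X][X]) (hm : h.Monic) (hd : h.natDegree = d)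
    (hw : ∀ i, i ≤ d → (h.coeff i).natDegree ≤ d - i) (hB : TopSep d h) :
    d.factorial * Fintype.card K ≤ Nat.card (PP K d h) + d.factorial * (d ^ d * (d * d)) := by
  classical
  obtain ⟨P, hP0, hPd, hP⟩ := good_points h hm hd hw (Or.inl hB)
  let G0 : Finset K := Finset.univ.filter fun x => P.eval (algebraMap K k x) ≠ 0
  let B0 : Finset K := Finset.univ.filter fun x => P.eval (algebraMap K k x) = 0
  have hcard : Fintype.card K ≤ G0.card + B0.card := by
    have := Finset.card_filter_add_card_filter_not (s := (Finset.univ : Finset K)) (fun x => P.eval (algebraMap K k x) = 0)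
    rw [Finset.card_univ] at this
    simp only [G0, B0, ne_eq]
    omega
  have hB0 : B0.card ≤ d ^ d * (d * d) := by
    refine le_trans ?_ ((card_roots' P).trans hPd)
    rw [← Finset.card_map ⟨algebraMap K k, (algebraMap K k).injective⟩]
    refine le_trans (Finset.card_le_card ?_) (Multiset.toFinset_card_le P.roots)
    intro y hy
    simp only [Finset.mem_map, Function.Embedding.coeFn_mk, B0, Finset.mem_filter, Finset.mem_univ, true_and] at hy
    obtain ⟨x, hx, rfl⟩ := hy
    rw [Multiset.mem_toFinset, mem_roots hP0]
    exact hx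
  have ht : ∀ x : G0, ∃ t : Fin d → k, Function.Injective t ∧ sp h (algebraMap K k x) = ∏ i, (X - C (t i)) := by
    intro x
    have := x.2
    simp only [G0, Finset.mem_filter, Finset.mem_univ, true_and] at this
    exact hP _ this
  choose t ht1 ht2 using ht
  let f : Equiv.Perm (Fin d) × G0 → PP K d h := fun z => ⟨(z.2, fun i => t z.2 (z.1 i)),
    (ht1 z.2).comp z.1.injective, by
      simp only
      rw [ht2 z.2]
      exact (Equiv.prod_comp z.1 (fun i => (X - C (t z.2 i)))).symm⟩
  have hf : Function.Injective f := by
    rintro ⟨π, x⟩ ⟨τ, y⟩ hxy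
    have h1 := congrArg (fun z : PP K d h => z.1) hxy
    simp only [f, Prod.mk.injEq] at h1
    have h2 : x = y := Subtype.ext h1.1
    subst h2
    refine Prod.ext ?_ rfl
    ext i
    have := ht1 x (congrFun h1.2 i)
    simp [this]
  have h3 := Nat.card_le_card_of_injective f hf
  rw [Nat.card_prod, Nat.card_eq_fintype_card, Fintype.card_perm, Fintype.card_fin,
    Nat.card_eq_fintype_card, Fintype.card_coe] at h3
  calc d.factorial * Fintype.card K ≤ d.factorial * (G0.card + d ^ d * (d * d)) := by
        gcongr; omega
    _ ≤ _ := by rw [mul_add]; omega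

lemma frob_sp (hK : K[X][X]) (x0 : K) (y : k) :
    (sp (hK.map (mapRingHom (algebraMap K k))) (algebraMap K k x0)) =
      (hK.map (evalRingHom x0)).map (algebraMap K k) := by
  rw [sp, Polynomial.map_map, Polynomial.map_map]
  congr 1
  ext <;> simp

lemma aeval_frob (g : K[X]) (y : k) : aeval (y ^ Fintype.card K) g = (aeval y g) ^ Fintype.card K := by
  have h5 := congrArg (aeval y) (FiniteField.expand_card (K := K) g)
  rwa [expand_aeval, map_pow] at h5

lemma frob_perm (g : K[X]) (t : Fin d → k) (ht : Function.Injective t)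
    (hg : g.map (algebraMap K k) = ∏ i, (X - C (t i))) :
    ∃ σ : Equiv.Perm (Fin d), ∀ i, t i ^ Fintype.card K = t (σ i) := by
  have h1 : ∀ i, ∃ j, t i ^ Fintype.card K = t j := by
    intro i
    have h2 : (g.map (algebraMap K k)).eval (t i) = 0 := by
      rw [hg, eval_prod]; exact Finset.prod_eq_zero (Finset.mem_univ i) (by simp)
    have h3 : (g.map (algebraMap K k)).eval (t i ^ Fintype.card K) = 0 := by
      rw [eval_map_algebraMap] at h2 ⊢
      rw [aeval_frob, h2, zero_pow Fintype.card_ne_zero]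
    rw [hg, eval_prod, Finset.prod_eq_zero_iff] at h3
    obtain ⟨j, -, hj⟩ := h3
    exact ⟨j, by simpa [sub_eq_zero] using hj⟩
  choose f hf using h1
  have hfi : Function.Injective f := by
    intro i j hij
    apply ht
    have h6 : t i ^ Fintype.card K = t j ^ Fintype.card K := by rw [hf, hf, hij]
    obtain ⟨p, hp⟩ := CharP.exists K
    obtain ⟨e, hpp, hq⟩ := FiniteField.card K p
    have : Fact p.Prime := ⟨hpp⟩
    have : CharP k p := charP_of_injective_algebraMap (algebraMap K k).injective p
    rw [hq] at h6
    exact iterateFrobenius_inj k p e (by simpa [iterateFrobenius_def] using h6)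
  exact ⟨Equiv.ofBijective f (Finite.injective_iff_bijective.1 hfi), fun i => hf i⟩

lemma PP_eq_sum (hK : K[X][X]) :
    Nat.card (PP K d (hK.map (mapRingHom (algebraMap K k)))) =
      ∑ σ : Equiv.Perm (Fin d), Nat.card (PS K d (hK.map (mapRingHom (algebraMap K k))) σ) := by
  classical
  set h := hK.map (mapRingHom (algebraMap K k)) with hh
  have h1 : ∀ y : PP K d h, ∃ σ : Equiv.Perm (Fin d), ∀ i, y.1.2 i ^ Fintype.card K = y.1.2 (σ i) := by
    intro y
    refine frob_perm (hK.map (evalRingHom y.1.1)) _ y.2.1 ?_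
    rw [← frob_sp hK y.1.1 (0 : k)]
    exact y.2.2
  choose s hs using h1
  have h2 : ∀ σ, Nat.card (PS K d h σ) = Nat.card {y : PP K d h // s y = σ} := by
    intro σ
    refine Nat.card_congr (Equiv.subtypeEquivRight fun y => ⟨fun h3 => ?_, fun h3 i => by rw [hs, h3]⟩)
    ext i
    have := y.2.1 ((hs y i).symm.trans (h3 i))
    simp [this]
  simp only [h2]
  rw [← Nat.card_sigma]
  exact Nat.card_congr (Equiv.sigmaFiberEquiv s).symm

end Count
end LineIrr
set_option linter.unusedSectionVars false
set_option linter.unusedVariables false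
set_option linter.style.haveILetI false

namespace LineIrr

section Count

variable {K k : Type} [Field K] [Fintype K] [Field k] [Algebra K k] {d : ℕ}

lemma aeval_frob_pow (g : K[X]) (y : k) (n : ℕ) :
    aeval (y ^ Fintype.card K ^ n) g = (aeval y g) ^ Fintype.card K ^ n := by
  induction n with
  | zero => simp
  | succ n ih => rw [pow_succ, pow_mul, aeval_frob, ih, ← pow_mul]

lemma frob_inj {y z : k} (n : ℕ) (h : y ^ Fintype.card K ^ n = z ^ Fintype.card K ^ n) : y = z := by
  obtain ⟨p, hp⟩ := CharP.exists K
  obtain ⟨e, hpp, hq⟩ := FiniteField.card K p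
  have : Fact p.Prime := ⟨hpp⟩
  have : CharP k p := charP_of_injective_algebraMap (algebraMap K k).injective p
  rw [hq, ← pow_mul] at h
  exact iterateFrobenius_inj k p (e * n) (by simpa [iterateFrobenius_def] using h)

lemma cyc_eq [NeZero d] (t : Fin d → k) (ht : ∀ i, t i ^ Fintype.card K = t (i + 1)) (i : Fin d) :
    t i = t 0 ^ Fintype.card K ^ (i : ℕ) := by
  have h1 : ∀ n : ℕ, t (Fin.ofNat d n) = t 0 ^ Fintype.card K ^ n := by
    intro n
    induction n with
    | zero => simp
    | succ n ih =>
      rw [pow_succ, pow_mul, ← ih, ht]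
      congr 1
      apply Fin.ext
      simp [Fin.val_add]
  rw [← h1]
  congr 1
  apply Fin.ext
  simp [Nat.mod_eq_of_lt i.2]

lemma irr_of_cycle [NeZero d] (g : K[X]) (hm : g.Monic) (t : Fin d → k) (hinj : Function.Injective t)
    (hg : g.map (algebraMap K k) = ∏ i, (X - C (t i)))
    (ht : ∀ i, t i ^ Fintype.card K = t (i + 1)) : Irreducible g := by
  have hroot : ∀ i, aeval (t i) g = 0 := by
    intro i
    rw [← eval_map_algebraMap, hg, eval_prod]; exact Finset.prod_eq_zero (Finset.mem_univ i) (by simp)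
  have hIntg : IsIntegral K (t 0) := ⟨g, hm, by rw [← aeval_def]; exact hroot 0⟩
  have hmr : ∀ i, aeval (t i) (minpoly K (t 0)) = 0 := by
    intro i
    rw [cyc_eq t ht i, aeval_frob_pow, minpoly.aeval, zero_pow (pow_pos Fintype.card_pos _).ne']
  have hgd : g.natDegree = d := by
    have := congrArg natDegree hg
    rwa [natDegree_map, natDegree_finsetProd_X_sub_C_eq_card, Finset.card_univ, Fintype.card_fin] at this
  have hmd : d ≤ (minpoly K (t 0)).natDegree := by
    have h2 : ((minpoly K (t 0)).map (algebraMap K k)) ≠ 0 := ((minpoly.monic hIntg).map _).ne_zero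
    have h3 : (Finset.univ.map ⟨t, hinj⟩).val ⊆ ((minpoly K (t 0)).map (algebraMap K k)).roots := by
      intro y hy
      rw [Finset.mem_val, Finset.mem_map] at hy
      obtain ⟨i, -, rfl⟩ := hy
      rw [mem_roots h2, IsRoot, eval_map_algebraMap]
      exact hmr i
    have h4 := card_le_degree_of_subset_roots h3
    rwa [Finset.card_map, Finset.card_univ, Fintype.card_fin, natDegree_map] at h4
  have h5 : minpoly K (t 0) = g := by
    refine eq_of_monic_of_dvd_of_natDegree_le (minpoly.monic hIntg) hm (minpoly.dvd K _ (hroot 0)) (by omega) |>.symm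
  rw [← h5]
  exact minpoly.irreducible hIntg

lemma cycle_of_irr [NeZero d] (g : K[X]) (hm : g.Monic) (hgd : g.natDegree = d) (hirr : Irreducible g)
    (θ : k) (hθ : aeval θ g = 0) : ∃ t : Fin d → k, t 0 = θ ∧ Function.Injective t ∧
      g.map (algebraMap K k) = ∏ i, (X - C (t i)) ∧ ∀ i, t i ^ Fintype.card K = t (i + 1) := by
  have hper : ∀ n, θ ^ Fintype.card K ^ n = θ ↔ d ∣ n := by
    intro n
    rw [← hgd, hirr.natDegree_dvd_iff_dvd_X_pow_card_pow_sub_X, ← hirr.dvd_iff_aeval_eq_zero hθ,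
      Nat.card_eq_fintype_card]
    simp [sub_eq_zero]
  have hmod : ∀ n, θ ^ Fintype.card K ^ n = θ ^ Fintype.card K ^ (n % d) := by
    intro n
    conv_lhs => rw [← Nat.div_add_mod n d]
    rw [pow_add, pow_mul, (hper _).2 (dvd_mul_right _ _)]
  have hinj : Function.Injective fun i : Fin d => θ ^ Fintype.card K ^ (i : ℕ) := by
    have key : ∀ i j : ℕ, i < j → j < d → θ ^ Fintype.card K ^ i ≠ θ ^ Fintype.card K ^ j := by
      intro i j hij hj h0
      obtain ⟨n, rfl⟩ := Nat.exists_eq_add_of_lt hij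
      rw [show i + n + 1 = (n + 1) + i by ring, pow_add, pow_mul] at h0
      have h1 := (hper (n + 1)).1 (frob_inj (K := K) i h0).symm
      have := Nat.le_of_dvd (by omega) h1
      omega
    intro i j hij
    by_contra hne
    rcases lt_or_gt_of_ne (fun h0 => hne (Fin.ext h0) : (i : ℕ) ≠ j) with h0 | h0
    · exact key _ _ h0 j.2 hij
    · exact key _ _ h0 i.2 hij.symm
  refine ⟨fun i => θ ^ Fintype.card K ^ (i : ℕ), by simp, hinj, ?_, ?_⟩
  · symm
    refine eq_of_monic_of_dvd_of_natDegree_le (monic_prod_X_sub_C _ _) (hm.map _) ?_ ?_ |>.symm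
    · refine Finset.prod_dvd_of_coprime ?_ ?_
      · intro i _ j _ hij
        exact isCoprime_X_sub_C_of_isUnit_sub (sub_ne_zero.2 fun h0 => hij (hinj h0)).isUnit
      · intro i _
        rw [dvd_iff_isRoot, IsRoot, eval_map_algebraMap, aeval_frob_pow, hθ,
          zero_pow (pow_pos Fintype.card_pos _).ne']
    · rw [natDegree_finsetProd_X_sub_C_eq_card, Finset.card_univ, Fintype.card_fin, natDegree_map, hgd]
  · intro i
    simp only
    rw [← pow_mul, ← pow_succ, hmod, Fin.val_add, Fin.val_one', Nat.add_mod_mod]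

lemma card_roots_irr [IsAlgClosed k] [NeZero d] (g : K[X]) (hm : g.Monic) (hgd : g.natDegree = d) (hirr : Irreducible g) :
    Nat.card {θ : k // aeval θ g = 0} = d := by
  obtain ⟨θ, hθ⟩ := IsAlgClosed.exists_aeval_eq_zero k g (by
    rw [degree_eq_natDegree hm.ne_zero, hgd]; exact_mod_cast NeZero.ne d)
  obtain ⟨t, -, hinj, hg, -⟩ := cycle_of_irr g hm hgd hirr θ hθ
  have h1 : ∀ y, aeval y g = 0 ↔ ∃ i, t i = y := by
    intro y
    rw [← eval_map_algebraMap, hg, eval_prod, Finset.prod_eq_zero_iff]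
    simp [sub_eq_zero, eq_comm]
  have e : Fin d ≃ {θ : k // aeval θ g = 0} := Equiv.ofBijective (fun i => ⟨t i, (h1 _).2 ⟨i, rfl⟩⟩) (by
    constructor
    · intro i j hij; exact hinj (congrArg Subtype.val hij)
    · rintro ⟨y, hy⟩
      obtain ⟨i, hi⟩ := (h1 y).1 hy
      exact ⟨i, Subtype.ext hi⟩)
  rw [← Nat.card_congr e, Nat.card_eq_fintype_card, Fintype.card_fin]

lemma rot_count [IsAlgClosed k] [NeZero d] (hK : K[X][X]) (hm : hK.Monic) (hd : hK.natDegree = d) :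
    Nat.card (PS K d (hK.map (mapRingHom (algebraMap K k))) (Equiv.addRight 1)) =
      d * Nat.card {x0 : K // Irreducible (hK.map (evalRingHom x0))} := by
  have hmx : ∀ x0, (hK.map (evalRingHom x0)).Monic := fun x0 => hm.map _
  have hdx : ∀ x0, (hK.map (evalRingHom x0)).natDegree = d := fun x0 => by rw [hm.natDegree_map, hd]
  have h2 : ∀ y : PS K d (hK.map (mapRingHom (algebraMap K k))) (Equiv.addRight 1),
      (hK.map (evalRingHom y.1.1.1)).map (algebraMap K k) = ∏ i, (X - C (y.1.1.2 i)) := by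
    intro y
    rw [← frob_sp hK y.1.1.1 (0 : k)]
    exact y.1.2.2
  let f : PS K d (hK.map (mapRingHom (algebraMap K k))) (Equiv.addRight 1) →
      Σ a : {x0 : K // Irreducible (hK.map (evalRingHom x0))}, {θ : k // aeval θ (hK.map (evalRingHom a.1)) = 0} :=
    fun y => ⟨⟨y.1.1.1, irr_of_cycle _ (hmx _) _ y.1.2.1 (h2 y) y.2⟩, ⟨y.1.1.2 0, by
      rw [← eval_map_algebraMap, h2, eval_prod]; exact Finset.prod_eq_zero (Finset.mem_univ 0) (by simp)⟩⟩
  have hf : Function.Bijective f := by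
    constructor
    · rintro ⟨⟨⟨x, t⟩, h3⟩, h4⟩ ⟨⟨⟨x', t'⟩, h3'⟩, h4'⟩ hy
      simp only [f, Sigma.mk.injEq, Subtype.mk.injEq] at hy
      obtain ⟨h5, h6⟩ := hy
      subst h5
      have h7 := congrArg Subtype.val (eq_of_heq h6)
      simp only at h7
      have h8 : t = t' := by
        funext i
        rw [cyc_eq t h4 i, cyc_eq t' h4' i, h7]
      subst h8
      rfl
    · rintro ⟨⟨x, hx⟩, ⟨θ, hθ⟩⟩
      obtain ⟨t, ht0, hinj, hg, ht⟩ := cycle_of_irr _ (hmx x) (hdx x) hx θ hθ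
      refine ⟨⟨⟨(x, t), hinj, ?_⟩, ht⟩, ?_⟩
      · rw [frob_sp hK x (0 : k)]; exact hg
      · subst ht0
        rfl
  have hfr : ∀ a : {x0 : K // Irreducible (hK.map (evalRingHom x0))},
      Nat.card {θ : k // aeval θ (hK.map (evalRingHom a.1)) = 0} = d :=
    fun a => card_roots_irr _ (hmx _) (hdx _) a.2
  have : Fintype {x0 : K // Irreducible (hK.map (evalRingHom x0))} := Fintype.ofFinite _
  have : ∀ a : {x0 : K // Irreducible (hK.map (evalRingHom x0))},
      Finite {θ : k // aeval θ (hK.map (evalRingHom a.1)) = 0} :=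
    fun a => Nat.finite_of_card_ne_zero (by rw [hfr]; exact NeZero.ne d)
  rw [Nat.card_congr (Equiv.ofBijective f hf), Nat.card_sigma]
  simp only [hfr]
  rw [Finset.sum_const, Finset.card_univ, smul_eq_mul, mul_comm, Nat.card_eq_fintype_card]

theorem count_irr (d : ℕ) (hd2 : 0 < d) : ∃ C Q0 : ℕ, ∀ (K k : Type) [Field K] [Fintype K] [Field k] [Algebra K k]
    [IsAlgClosed k] (hK : K[X][X]) (h : k[X][X]), h = hK.map (mapRingHom (algebraMap K k)) →
    Q0 ≤ Fintype.card K → hK.Monic → hK.natDegree = d →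
    (∀ i, i ≤ d → (h.coeff i).natDegree ≤ d - i) → TopSep d h → SmoothH h → SimpleBr d h →
    |(Nat.card {x0 : K // Irreducible (hK.map (evalRingHom x0))} : ℝ) - (Fintype.card K : ℕ) / (d : ℝ)| ≤
      C * √((Fintype.card K : ℕ)) := by
  have : NeZero d := ⟨hd2.ne'⟩
  obtain ⟨C, Q0, hCQ⟩ := sigma_le d
  refine ⟨C * d.factorial + d.factorial * (d ^ d * (d * d)), Q0, ?_⟩
  intro K k _ _ _ _ _ hK h hh hQ hm hd hw hB hs hbr
  have hmk : h.Monic := by rw [hh]; exact hm.map _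
  have hdk : h.natDegree = d := by rw [hh, hm.natDegree_map, hd]
  have h1 := hCQ K k h hQ hmk hdk hw hB hs hbr
  have h2 := PP_lower (K := K) h hmk hdk hw hB
  have h3 : Nat.card (PP K d h) = ∑ σ : Equiv.Perm (Fin d), Nat.card (PS K d h σ) := by
    rw [hh]; exact PP_eq_sum hK
  have h4 : Nat.card (PS K d h (Equiv.addRight 1)) =
      d * Nat.card {x0 : K // Irreducible (hK.map (evalRingHom x0))} := by
    rw [hh]; exact rot_count hK hm hd
  set A := Nat.card {x0 : K // Irreducible (hK.map (evalRingHom x0))}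
  set q := Fintype.card K
  set E := d ^ d * (d * d)
  set D := d.factorial
  have hq1 : (1 : ℝ) ≤ √q := by
    rw [Real.one_le_sqrt]; exact_mod_cast Fintype.card_pos (α := K)
  set s := √(q : ℝ)
  have h5 : ∑ σ ∈ Finset.univ.erase (Equiv.addRight (1 : Fin d)), (Nat.card (PS K d h σ) : ℝ) ≤ (D - 1) * (q + C * s) := by
    refine (Finset.sum_le_card_nsmul _ _ _ fun σ _ => h1 σ).trans (le_of_eq ?_)
    rw [Finset.card_erase_of_mem (Finset.mem_univ _), Finset.card_univ, Fintype.card_perm, Fintype.card_fin,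
      nsmul_eq_mul, Nat.cast_sub (Nat.factorial_pos d)]
    simp [D]
  have h6 : (Nat.card (PP K d h) : ℝ) = d * A +
      ∑ σ ∈ Finset.univ.erase (Equiv.addRight (1 : Fin d)), (Nat.card (PS K d h σ) : ℝ) := by
    rw [h3, Nat.cast_sum, ← Finset.add_sum_erase _ _ (Finset.mem_univ (Equiv.addRight (1 : Fin d))), h4]
    push_cast; rfl
  have h7 : (D : ℝ) * q ≤ Nat.card (PP K d h) + D * E := by exact_mod_cast h2
  have h8 := h1 (Equiv.addRight (1 : Fin d))
  rw [h4] at h8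
  push_cast at h8
  have hd1 : (1 : ℝ) ≤ d := by exact_mod_cast hd2
  have hD1 : (1 : ℝ) ≤ D := by exact_mod_cast Nat.factorial_pos d
  have hC0 : (0 : ℝ) ≤ C := Nat.cast_nonneg C
  have hE0 : (0 : ℝ) ≤ E := Nat.cast_nonneg E
  have h9 : |(d : ℝ) * A - q| ≤ (C * D + D * E : ℝ) * s := by
    rw [abs_le]
    constructor
    · have e1 : (D : ℝ) * E ≤ D * E * s := le_mul_of_one_le_right (by positivity) hq1
      have e2 : 0 ≤ C * s := by positivity
      nlinarith
    · have e1 : C * s ≤ C * D * s := by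
        have : (C : ℝ) ≤ C * D := le_mul_of_one_le_right hC0 hD1
        gcongr
      have e2 : 0 ≤ D * E * s := by positivity
      nlinarith
  have h10 : (A : ℝ) - q / d = (d * A - q) / d := by field_simp
  rw [h10, abs_div, abs_of_pos (by linarith : (0 : ℝ) < d), div_le_iff₀ (by linarith)]
  push_cast
  refine h9.trans ?_
  exact le_mul_of_one_le_right (by positivity) hd1

end Count
end LineIrr
set_option linter.unusedSectionVars false
set_option linter.unusedVariables false
set_option linter.style.haveILetI false

namespace LineIrr

section Core

variable {k F L : Type} [Field k] [Field F] [Field L]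
  [Algebra k[X] F] [IsFractionRing k[X] F] [Algebra k L] [Algebra k[X] L] [Algebra F L]
  [IsScalarTower k k[X] L] [IsScalarTower k[X] F L]
variable {d : ℕ} {h : k[X][X]} {T : Fin d → L} [hinj : Fact (Function.Injective T)]


lemma dx_mul (P Q : k[X][X]) : dx (P * Q) = dx P * Q + P * dx Q := by
  ext1 n
  simp only [coeff_dx, coeff_mul, coeff_add, derivative_sum, derivative_mul, Finset.sum_add_distrib]

/-- value at a point -/
noncomputable def pt (x0 t : k) : k[X][X] →+* k :=
  (evalRingHom t).comp (mapRingHom (evalRingHom x0))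

lemma pt_def (x0 t : k) (P : k[X][X]) : pt x0 t P = (sp P x0).eval t := rfl

/-- value at the root -/
noncomputable def ev (T : Fin d → L) (i : Fin d) : k[X][X] →+* L :=
  eval₂RingHom (algebraMap k[X] L) (T i)

/-- value at the root, integral version -/
noncomputable def evR (T : Fin d → L) (i : Fin d) : k[X][X] →+* RR k T :=
  eval₂RingHom (algebraMap k[X] (RR k T)) (tR k T i)

lemma evR_coe (i : Fin d) (P : k[X][X]) : (evR T i P : L) = ev T i P := by
  show (algebraMap (RR k T) L) (eval₂ _ _ P) = eval₂ _ _ P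
  rw [hom_eval₂, ← IsScalarTower.algebraMap_eq k[X] (RR k T) L]; rfl

lemma phi_evR (φ : RR k T →ₐ[k] k) (i : Fin d) (P : k[X][X]) :
    φ (evR T i P) = pt (φ (xR k T)) (φ (tR k T i)) P := by
  show (φ : RR k T →+* k) (eval₂ _ _ P) = _
  rw [hom_eval₂, pt_def, sp, eval_map]
  congr 1
  ext P
  · have := phi_poly φ (C P)
    simpa using this
  · simp [xR]

lemma gal_ev (g : L ≃ₐ[F] L) {i j : Fin d} (hg : g (T i) = T j) (P : k[X][X]) :
    g (ev T i P) = ev T j P := by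
  show (g : L →+* L) (eval₂ _ _ P) = eval₂ _ _ P
  rw [hom_eval₂]
  congr 1
  ext P
  · simp [gal_poly]
  · simp [gal_poly]

lemma ev_h (hc : Core k F L h T) (i : Fin d) : ev T i h = 0 := core_root hc i

lemma smooth_pt (hs : SmoothH h) (x0 t : k) (h0 : pt x0 t h = 0) (h1 : pt x0 t (derivative h) = 0) :
    pt x0 t (dx h) ≠ 0 := by
  have := hs x0 t h0 (by rw [← h1, pt_def, sp, sp, derivative_map])
  rw [derivative_eval_C] at this
  convert this using 1
  rw [pt_def, sp, ← coe_evalRingHom x0, eval_map, eval, hom_eval₂]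
  simp

lemma gal_trans [IsAlgClosed k] [FiniteDimensional F L] [IsGalois F L] (hc : Core k F L h T)
    (hB : TopSep d h) (hs : SmoothH h) (i j : Fin d) : ∃ g : L ≃ₐ[F] L, g (T i) = T j := by
  classical
  by_contra hcon
  obtain ⟨φ, ⟨a, b⟩, hp, hφ⟩ := exists_phi_coll hc hB
    (Finset.univ.filter fun p : Fin d × Fin d => ¬ ∃ g : L ≃ₐ[F] L, g (T p.1) = T p.2)
    ⟨(i, j), by simpa using hcon⟩ (by
      rintro ⟨a, b⟩ hp hab
      simp only at hab
      subst hab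
      simp only [Finset.mem_filter] at hp
      exact hp.2 ⟨1, rfl⟩) (by
      rintro π ⟨g0, hg0⟩ ⟨a, b⟩ hp
      simp only [Finset.mem_filter, Finset.mem_univ, true_and] at hp ⊢
      rintro ⟨g, hg⟩
      refine hp ⟨g0⁻¹ * g * g0, ?_⟩
      rw [AlgEquiv.mul_apply, AlgEquiv.mul_apply, hg0, hg, ← hg0]
      exact g0.symm_apply_apply _)
  simp only [Finset.mem_filter, Finset.mem_univ, true_and] at hp
  simp only at hφ
  have hia : IsIntegral k[X] (T a) := T_integral hc a
  have hroot : aeval (T a) h = 0 := by rw [aeval_def]; exact core_root hc a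
  have := algMap_inj k F L
  have hnz : Module.IsTorsionFree k[X] L := by
    have : FaithfulSMul k[X] L := (faithfulSMul_iff_algebraMap_injective _ _).2 this
    infer_instance
  obtain ⟨Q, hQ⟩ := (minpoly.isIntegrallyClosed_dvd_iff hia h).1 hroot
  have hb1 : ev T b (minpoly k[X] (T a)) ≠ 0 := by
    intro h0
    apply hp
    have h1 : aeval (T b) (minpoly F (T a)) = 0 := by
      have h3 := minpoly.isIntegrallyClosed_eq_field_fractions F L hia
      rw [Algebra.algebraMap_self_apply] at h3
      rw [h3, aeval_map_algebraMap]
      exact h0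
    have h2 : minpoly F (T a) = minpoly F (T b) :=
      minpoly.eq_of_irreducible_of_monic (minpoly.irreducible (IsIntegral.of_finite F _)) h1 
        (minpoly.monic (IsIntegral.of_finite F _))
    obtain ⟨g, hg⟩ := (isConjRoot_iff_exists_algEquiv (K := F) (x := T b) (y := T a)).1 h2.symm
    exact ⟨g, hg⟩
  have hb2 : ev T b Q = 0 := by
    have h1 := ev_h hc b
    rw [hQ, map_mul] at h1
    exact (mul_eq_zero.1 h1).resolve_left hb1
  have ha2 : ev T a (minpoly k[X] (T a)) = 0 := minpoly.aeval k[X] (T a)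
  set x0 := φ (xR k T)
  set t := φ (tR k T a) with ht
  have e1 : pt x0 t (minpoly k[X] (T a)) = 0 := by
    rw [← phi_evR, show evR T a (minpoly k[X] (T a)) = 0 from Subtype.ext (by rw [evR_coe, ha2]; rfl), map_zero]
  have e2 : pt x0 t Q = 0 := by
    rw [hφ, ← phi_evR, show evR T b Q = 0 from Subtype.ext (by rw [evR_coe, hb2]; rfl), map_zero]
  refine smooth_pt hs x0 t ?_ ?_ ?_
  · rw [hQ, map_mul, e1, zero_mul]
  · rw [hQ, derivative_mul, map_add, map_mul, map_mul, e1, e2]; simp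
  · rw [hQ, dx_mul, map_add, map_mul, map_mul, e1, e2]; simp

end Core
end LineIrr
set_option linter.unusedSectionVars false
set_option linter.unusedVariables false
set_option linter.style.haveILetI false

namespace LineIrr

section Core

variable {k F L : Type} [Field k] [Field F] [Field L]
  [Algebra k[X] F] [IsFractionRing k[X] F] [Algebra k L] [Algebra k[X] L] [Algebra F L]
  [IsScalarTower k k[X] L] [IsScalarTower k[X] F L]
variable {d : ℕ} {h : k[X][X]} {T : Fin d → L} [hinj : Fact (Function.Injective T)]

lemma bezout [IsAlgClosed k] (hs : SmoothH h) :
    ∃ a b e : k[X][X], 1 = a * derivative h + b * dx h + e * h := by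
  by_contra hcon
  have hI : Ideal.span {derivative h, dx h, h} ≠ ⊤ := by
    intro htop
    have h1 : (1 : k[X][X]) ∈ Ideal.span {derivative h, dx h, h} := by rw [htop]; trivial
    obtain ⟨a, b, e, h2⟩ := Submodule.mem_span_triple.1 h1
    exact hcon ⟨a, b, e, by rw [← h2]; simp⟩
  obtain ⟨φ, hφ⟩ := exists_point (k := k) _ hI
  have key : ∀ P : k[X][X], φ P = pt (φ (C X)) (φ X) P := by
    intro P
    have : (φ : k[X][X] →+* k) = pt (φ (C X)) (φ X) := by
      ext a
      · have := φ.commutes a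
        simpa [pt_def, sp] using this
      · simp [pt_def, sp]
      · simp [pt_def, sp]
    exact DFunLike.congr_fun this P
  have g1 := hφ (derivative h) (Ideal.subset_span (by simp))
  have g2 := hφ (dx h) (Ideal.subset_span (by simp))
  have g3 := hφ h (Ideal.subset_span (by simp))
  rw [key] at g1 g2 g3
  exact smooth_pt hs _ _ g3 g1 g2

/-- Lagrange: the trace of `w` over the derivative of `h` is a polynomial. -/
lemma lagrange_sum (hc : Core k F L h T) (w : k[X][X]) :
    ∃ s : k[X], ∑ i, ev T i w / ev T i (derivative h) = algebraMap k[X] L s := by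
  classical
  by_cases hd : d = 0
  · subst hd; exact ⟨0, by simp⟩
  have hm := core_monic hc
  refine ⟨(w %ₘ h).coeff (d - 1), ?_⟩
  have h1 : ∀ i, ev T i w = ev T i (w %ₘ h) := by
    intro i
    conv_lhs => rw [← modByMonic_add_div w h]
    rw [map_add, map_mul, ev_h hc, zero_mul, add_zero]
  have hdeg : ((w %ₘ h).map (algebraMap k[X] L)).degree < (Finset.univ : Finset (Fin d)).card := by
    refine lt_of_le_of_lt degree_map_le ?_
    have := degree_modByMonic_lt w hm
    rw [degree_eq_natDegree hm.ne_zero, core_natDegree hc] at this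
    simpa using this
  have h2 := Lagrange.coeff_eq_sum (s := Finset.univ) (v := T) (hinj.out.injOn) hdeg
  simp only [Finset.card_univ, Fintype.card_fin, coeff_map] at h2
  rw [h2]
  refine Finset.sum_congr rfl fun i _ => ?_
  rw [h1 i, show ev T i (derivative h) = _ from hT_eq hc i, eval_map]
  rfl

lemma disc_poly [FiniteDimensional F L] [IsGalois F L] (hc : Core k F L h T) (hB : TopSep d h) :
    ∃ P : k[X], P ≠ 0 ∧ P.natDegree = d * (d - 1) ∧
      algebraMap k[X] L P = ∏ i, ev T i (derivative h) := by
  have hinv : ∀ g : L ≃ₐ[F] L, g (∏ i, ev T i (derivative h)) = ∏ i, ev T i (derivative h) := by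
    intro g
    obtain ⟨π, hπ⟩ := gal_perm hc g
    rw [map_prod, ← Equiv.prod_comp π (fun i => ev T i (derivative h))]
    exact Finset.prod_congr rfl fun i _ => gal_ev g (hπ i) _
  have hi : IsIntegral k[X] (∏ i, ev T i (derivative h)) := by
    have := RR_integral hc (∏ i, evR T i (derivative h))
    convert this using 1
    rw [← Subalgebra.coe_val, map_prod]
    exact Finset.prod_congr rfl fun i _ => (evR_coe i _).symm
  obtain ⟨P, hP⟩ := desc_int hi hinv
  have hP0 : P ≠ 0 := by
    rintro rfl
    rw [map_zero, eq_comm, Finset.prod_eq_zero_iff] at hP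
    obtain ⟨i, _, hi⟩ := hP
    exact hT_ne hc i hi
  refine ⟨P, hP0, ?_, hP⟩
  obtain ⟨A, hA⟩ := place_exists hc
  have h1 := place_poly hA P hP0
  rw [hP, map_prod] at h1
  have h2 : ∀ i, A.valuation (ev T i (derivative h)) = A.valuation (xx k L) ^ (d - 1) := by
    intro i
    rw [show ev T i (derivative h) = _ from hT_eq hc i, map_prod,
      Finset.prod_congr rfl fun b hb => place_top hc hA hB (Finset.mem_erase.1 hb).1.symm,
      Finset.prod_const, Finset.card_erase_of_mem (Finset.mem_univ _)]
    simp
  simp only [h2, Finset.prod_const, Finset.card_univ, Fintype.card_fin, ← pow_mul] at h1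
  have := pow_right_injective₀ (zero_lt_one.trans hA.big) hA.big.ne' h1
  rw [← this, mul_comm]

/-- the Hessian-type form -/
noncomputable def WP (h : k[X][X]) : k[X][X] :=
  derivative (derivative h) * dx h ^ 2 - 2 * (dx (derivative h) * derivative h * dx h) +
    dx (dx h) * derivative h ^ 2

lemma dx_derivative (P : k[X][X]) : derivative (dx P) = dx (derivative P) := by
  ext1 n
  simp only [coeff_dx, coeff_derivative, derivative_mul, derivative_add, derivative_one,
    derivative_natCast]
  simp

lemma u_Du (hc : Core k F L h T) (D : Derivation k L L)
    (hD : ∀ P : k[X], D (algebraMap k[X] L P) = algebraMap k[X] L (derivative P)) (i : Fin d)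
    (P : k[X][X]) : ev T i (derivative h) * D (ev T i P) =
      ev T i (dx P * derivative h - derivative P * dx h) := by
  have h1 : D (ev T i P) = ev T i (dx P) + ev T i (derivative P) * D (T i) := D_eval₂ D hD P (T i)
  have h2 : ev T i (derivative h) * D (T i) = - ev T i (dx h) := D_T hc D hD i
  rw [h1, map_sub, map_mul, map_mul]
  linear_combination ev T i (derivative P) * h2

lemma W_eq (hc : Core k F L h T) (D : Derivation k L L)
    (hD : ∀ P : k[X], D (algebraMap k[X] L P) = algebraMap k[X] L (derivative P)) (i : Fin d) :
    ev T i (WP h) = - ev T i (derivative h) * (ev T i (dx h) * D (ev T i (derivative h)) -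
      ev T i (derivative h) * D (ev T i (dx h))) := by
  have h1 := u_Du hc D hD i (derivative h)
  have h2 := u_Du hc D hD i (dx h)
  rw [dx_derivative] at h2
  have h3 : ev T i (WP h) = ev T i (-(dx h * (dx (derivative h) * derivative h - derivative (derivative h) * dx h)
    - derivative h * (dx (dx h) * derivative h - dx (derivative h) * dx h))) := by
    congr 1; rw [WP]; ring
  rw [h3, map_neg, map_sub, map_mul, map_mul (ev T i) (derivative h), ← h1, ← h2]
  ring

lemma der_prod (D : Derivation k L L) {ι : Type} (s : Finset ι) (f : ι → L) (hf : ∀ i, f i ≠ 0) :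
    D (∏ i ∈ s, f i) = (∏ i ∈ s, f i) * ∑ i ∈ s, D (f i) / f i := by
  classical
  induction s using Finset.induction_on with
  | empty => simp
  | insert a s ha ih =>
    rw [Finset.prod_insert ha, Finset.sum_insert ha, Derivation.leibniz, ih]
    simp only [smul_eq_mul]
    have := hf a
    field_simp
    ring

lemma W_ne [IsAlgClosed k] [FiniteDimensional F L] [IsGalois F L] (hc : Core k F L h T)
    (hB : TopSep d h) (hs : SmoothH h) (hp : ((d * (d - 1) : ℕ) : k) ≠ 0) (i : Fin d) :
    ev T i (WP h) ≠ 0 := by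
  classical
  intro h0
  have hall : ∀ j, ev T j (WP h) = 0 := by
    intro j
    obtain ⟨g, hg⟩ := gal_trans hc hB hs i j
    rw [← gal_ev g hg, h0, map_zero]
  obtain ⟨D, hD⟩ := exists_der (k := k) (F := F) (L := L)
  obtain ⟨a, b, e, hbez⟩ := bezout hs
  let w : k[X][X] := a * (dx (derivative h) * derivative h - derivative (derivative h) * dx h) +
    b * (dx (dx h) * derivative h - derivative (dx h) * dx h)
  have hw : ∀ j, D (ev T j (derivative h)) = ev T j w := by
    intro j
    have h1 := hall j
    rw [W_eq hc D hD j, mul_eq_zero] at h1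
    have h2 := h1.resolve_left (neg_ne_zero.2 (hT_ne hc j))
    have h3 := congrArg (ev T j) hbez
    rw [map_add, map_add, map_mul, map_mul, map_mul, ev_h hc, map_one] at h3
    rw [map_add, map_mul, map_mul, ← u_Du hc D hD j, ← u_Du hc D hD j]
    linear_combination D (ev T j (derivative h)) * h3 + ev T j b * h2
  obtain ⟨P, hP0, hPd, hP⟩ := disc_poly hc hB
  obtain ⟨s, hs'⟩ := lagrange_sum hc w
  have hder : derivative P = P * s := by
    apply algMap_inj k F L
    rw [← hD, map_mul, hP, ← hs', der_prod D _ (fun j => ev T j (derivative h)) (fun j => hT_ne hc j)]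
    congr 1
    exact Finset.sum_congr rfl fun j _ => by rw [hw j]
  have hz : derivative P = 0 := by
    by_contra hne
    have h1 : (P * s).natDegree = P.natDegree + s.natDegree := natDegree_mul hP0 (by
      rintro rfl; rw [mul_zero] at hder; exact hne hder)
    have h2 : P.natDegree ≠ 0 := by
      intro h2
      rw [eq_C_of_natDegree_eq_zero h2, derivative_C] at hne
      exact hne rfl
    have h3 := natDegree_derivative_lt h2
    rw [hder] at h3
    omega
  have h4 := congrArg (fun Q => coeff Q (P.natDegree - 1)) hz
  have h5 : P.natDegree ≠ 0 := by
    rw [hPd]; intro h6; rw [h6] at hp; simp at hp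
  simp only [coeff_derivative, coeff_zero] at h4
  rw [Nat.sub_add_cancel (Nat.pos_of_ne_zero h5), mul_eq_zero] at h4
  rcases h4 with h4 | h4
  · exact hP0 (leadingCoeff_eq_zero.1 h4)
  · apply hp
    rw [← hPd]
    have : (P.natDegree : k) = ((P.natDegree - 1 + 1 : ℕ) : k) := by
      rw [Nat.sub_add_cancel (Nat.pos_of_ne_zero h5)]
    rw [this]; push_cast; exact h4

end Core
end LineIrr
set_option linter.unusedSectionVars false
set_option linter.unusedVariables false
set_option linter.style.haveILetI false

namespace LineIrr

section Core

variable {k F L : Type} [Field k] [Field F] [Field L]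
  [Algebra k[X] F] [IsFractionRing k[X] F] [Algebra k L] [Algebra k[X] L] [Algebra F L]
  [IsScalarTower k k[X] L] [IsScalarTower k[X] F L]
variable {d : ℕ} {h : k[X][X]} {T : Fin d → L} [hinj : Fact (Function.Injective T)]

variable {A : Type} [CommRing A] [Algebra k A]

/-- evaluation at a point with coordinates in an algebra -/
noncomputable def ptA (x c : A) : k[X][X] →+* A :=
  eval₂RingHom ((aeval x : k[X] →ₐ[k] A) : k[X] →+* A) c

lemma ptA_CC (x c : A) (a : k) : ptA x c (C (C a)) = algebraMap k A a := by simp [ptA]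
lemma ptA_X (x c : A) : ptA (k := k) x c X = c := by simp [ptA]
lemma ptA_CX (x c : A) : ptA (k := k) x c (C X) = x := by simp [ptA]

lemma hom_ptA (ψ : k[X][X] →+* A) (hψ : ∀ a : k, ψ (C (C a)) = algebraMap k A a) :
    ψ = ptA (ψ (C X)) (ψ X) := by
  ext a
  · simpa [ptA] using hψ a
  · simp [ptA]
  · simp [ptA]

lemma pt_eq_ptA (x c : k) : pt x c = ptA x c := by
  rw [hom_ptA (pt x c) (fun a => by simp [pt_def, sp])]
  simp [pt_def, sp]

lemma ev_eq_ptA (i : Fin d) : ev (k := k) T i = ptA (xx k L) (T i) := by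
  rw [hom_ptA (ev T i) (fun a => by
    simp only [ev, coe_eval₂RingHom, eval₂_C]
    exact (IsScalarTower.algebraMap_apply k k[X] L _).symm)]
  simp [ev, xx]

/-- total degree at most n -/
def TD (n : ℕ) (P : k[X][X]) : Prop := ∀ i j, n < i + j → (P.coeff i).coeff j = 0

lemma TD_derivative {n : ℕ} {P : k[X][X]} (hP : TD (n + 1) P) : TD n (derivative P) := by
  intro i j hij
  have h1 : ((i : k[X]) + 1) = C ((i : k) + 1) := by simp
  rw [coeff_derivative, h1, coeff_mul_C, hP _ _ (by omega), zero_mul]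

lemma TD_dx {n : ℕ} {P : k[X][X]} (hP : TD (n + 1) P) : TD n (dx P) := by
  intro i j hij
  rw [coeff_dx, coeff_derivative, hP _ _ (by omega), zero_mul]

lemma TD_mono {n m : ℕ} (hnm : n ≤ m) {P : k[X][X]} (hP : TD n P) : TD m P :=
  fun i j hij => hP i j (by omega)

lemma TD_derivative' {n : ℕ} {P : k[X][X]} (hP : TD n P) : TD n (derivative P) :=
  TD_derivative (TD_mono (Nat.le_succ n) hP)

lemma TD_dx' {n : ℕ} {P : k[X][X]} (hP : TD n P) : TD n (dx P) :=
  TD_dx (TD_mono (Nat.le_succ n) hP)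

lemma TD_core (hc : Core k F L h T) : TD d h := by
  intro i j hij
  by_cases hi : i ≤ d
  · exact coeff_eq_zero_of_natDegree_lt (lt_of_le_of_lt (hc.wt i hi) (by omega))
  · have h1 : h.coeff i = 0 := coeff_eq_zero_of_natDegree_lt (by rw [core_natDegree hc]; omega)
    rw [h1, coeff_zero]

lemma TD_natDegree {n : ℕ} {P : k[X][X]} (hP : TD n P) : P.natDegree < n + 1 := by
  rw [Nat.lt_succ_iff, natDegree_le_iff_coeff_eq_zero]
  intro i hi
  ext j
  rw [hP i j (by omega), coeff_zero]

lemma TD_coeff {n : ℕ} {P : k[X][X]} (hP : TD n P) (i : ℕ) : (P.coeff i).natDegree ≤ n - i := by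
  rw [natDegree_le_iff_coeff_eq_zero]
  intro j hj
  exact hP i j (by omega)

lemma ev_mem {n : ℕ} {P : k[X][X]} (hP : TD n P) (i : Fin d) : ev T i P ∈ VV k T ^ n := by
  show eval₂ _ _ P ∈ _
  rw [eval₂_eq_sum_range' _ (TD_natDegree hP)]
  refine Submodule.sum_mem _ fun j hj => ?_
  have hj' : j ≤ n := by simpa [Nat.lt_succ_iff] using hj
  have h1 : algebraMap k[X] L (P.coeff j) ∈ VV k T ^ (n - j) := VV_poly _ (TD_coeff hP j)
  have h2 : T i ^ j ∈ VV k T ^ j := Submodule.pow_mem_pow _ (T_mem_VV i) j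
  have := VV_mul h1 h2
  rwa [Nat.sub_add_cancel hj'] at this

lemma ptA_sum {n : ℕ} {P : k[X][X]} (hP : TD n P) (x c : A) :
    ptA x c P = ∑ a ∈ Finset.range (n + 1), ∑ b ∈ Finset.range (n + 1),
      algebraMap k A ((P.coeff a).coeff b) * (x ^ b * c ^ a) := by
  show eval₂ _ _ P = _
  rw [eval₂_eq_sum_range' _ (TD_natDegree hP)]
  refine Finset.sum_congr rfl fun a _ => ?_
  simp only [RingHom.coe_coe]
  rw [aeval_eq_sum_range' (n := n + 1) (by have := TD_coeff hP a; omega), Finset.sum_mul]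
  refine Finset.sum_congr rfl fun b _ => ?_
  rw [Algebra.smul_def, mul_assoc]

lemma D_ptA (D : Derivation k A A) (x c : A) (P : k[X][X]) :
    D (ptA x c P) = ptA x c (dx P) * D x + ptA x c (derivative P) * D c := by
  induction P using Polynomial.induction_on' with
  | add P Q hP hQ =>
    simp only [map_add, dx_add, hP, hQ]; ring
  | monomial n a =>
    rw [dx_monomial, derivative_monomial]
    simp only [ptA, coe_eval₂RingHom, eval₂_monomial]
    rw [Derivation.leibniz, Derivation.leibniz_pow]
    simp only [smul_eq_mul, nsmul_eq_mul, map_mul, map_natCast, RingHom.coe_coe]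
    have : D (aeval x a) = aeval x (derivative a) * D x := by
      rw [Derivation.map_aeval]; simp
    rw [this]
    ring

/-- homogenized substitution of the dual coordinates -/
noncomputable def Gh (h : k[X][X]) (n : ℕ) (P : k[X][X]) : k[X][X] :=
  ∑ a ∈ Finset.range (n + 1), ∑ b ∈ Finset.range (n + 1),
    C (C ((P.coeff a).coeff b)) * ((C X * dx h + X * derivative h) ^ b * (- derivative h) ^ a *
      (dx h) ^ (2 * n - a - b))

lemma Gh_hom {E : Type} [Field E] [Algebra k E] {n : ℕ} {P : k[X][X]} (hP : TD n P)
    (ψ : k[X][X] →+* E) (hψ : ∀ a : k, ψ (C (C a)) = algebraMap k E a) (hv : ψ (dx h) ≠ 0) :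
    ψ (Gh h n P) = ψ (dx h) ^ (2 * n) *
      ptA (ψ (C X) + ψ X * (ψ (derivative h) / ψ (dx h))) (-(ψ (derivative h) / ψ (dx h))) P := by
  rw [ptA_sum hP, Gh, map_sum, Finset.mul_sum]
  refine Finset.sum_congr rfl fun a ha => ?_
  rw [map_sum, Finset.mul_sum]
  refine Finset.sum_congr rfl fun b hb => ?_
  simp only [Finset.mem_range] at ha hb
  have h1 : ψ (dx h) ^ (2 * n) = ψ (dx h) ^ (2 * n - a - b) * ψ (dx h) ^ a * ψ (dx h) ^ b := by
    rw [← pow_add, ← pow_add]; congr 1; omega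
  rw [map_mul, hψ, h1, map_mul, map_mul, map_pow, map_pow, map_pow, map_add, map_mul, map_mul, map_neg]
  have h2 : ψ (C X) * ψ (dx h) + ψ X * ψ (derivative h) =
      ψ (dx h) * (ψ (C X) + ψ X * (ψ (derivative h) / ψ (dx h))) := by field_simp
  have h3 : -ψ (derivative h) = ψ (dx h) * (-(ψ (derivative h) / ψ (dx h))) := by field_simp
  rw [h2, h3, mul_pow, mul_pow]
  ring

lemma xvTu_mem (hc : Core k F L h T) (i : Fin d) :
    xx k L * ev T i (dx h) + T i * ev T i (derivative h) ∈ VV k T ^ (d + 1) := by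
  have h1 := ev_mem (T := T) (TD_dx' (TD_core hc)) i
  have h2 := ev_mem (T := T) (TD_derivative' (TD_core hc)) i
  apply Submodule.add_mem
  · have := VV_mul (m := 1) (by rw [pow_one]; exact xx_mem_VV) h1
    rwa [add_comm] at this
  · have := VV_mul (m := 1) (by rw [pow_one]; exact T_mem_VV i) h2
    rwa [add_comm] at this

lemma term_mem (hc : Core k F L h T) (i : Fin d) (a b n : ℕ) (hab : a + b ≤ n) :
    (xx k L * ev T i (dx h) + T i * ev T i (derivative h)) ^ b * (- ev T i (derivative h)) ^ a *
      (ev T i (dx h)) ^ (n - a - b) ∈ VV k T ^ ((d + 1) * n) := by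
  have h1 := ev_mem (T := T) (TD_dx' (TD_core hc)) i
  have h2 := ev_mem (T := T) (TD_derivative' (TD_core hc)) i
  have e1 := VV_pow (n := b) (xvTu_mem hc i)
  have e2 := VV_pow (n := a) (Submodule.neg_mem _ h2)
  have e3 := VV_pow (n := n - a - b) h1
  refine VV_mono ?_ (VV_mul (VV_mul e1 e2) e3)
  obtain ⟨r, rfl⟩ := Nat.exists_eq_add_of_le hab
  have : a + b + r - a - b = r := by omega
  rw [this]; nlinarith

lemma Gh_mem (hc : Core k F L h T) (i : Fin d) (n : ℕ) (P : k[X][X]) :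
    ev T i (Gh h n P) ∈ VV k T ^ ((d + 1) * (2 * n)) := by
  rw [Gh, map_sum]
  refine Submodule.sum_mem _ fun a ha => ?_
  rw [map_sum]
  refine Submodule.sum_mem _ fun b hb => ?_
  simp only [Finset.mem_range] at ha hb
  have h1 := term_mem hc i a b (2 * n) (by omega)
  have h2 : ev T i (C (C ((P.coeff a).coeff b))) = algebraMap k L ((P.coeff a).coeff b) := by
    rw [ev_eq_ptA, ptA_CC]
  rw [map_mul, h2, ← Algebra.smul_def]
  apply Submodule.smul_mem
  convert h1 using 1
  simp only [map_mul, map_pow, map_add, map_neg]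
  rw [show ev (k := k) T i (C X) = xx k L by rw [ev_eq_ptA, ptA_CX],
    show ev (k := k) T i X = T i by rw [ev_eq_ptA, ptA_X]]

end Core
end LineIrr
set_option linter.unusedSectionVars false
set_option linter.unusedVariables false
set_option linter.style.haveILetI false

namespace LineIrr

section Core

variable {k F L : Type} [Field k] [Field F] [Field L]
  [Algebra k[X] F] [IsFractionRing k[X] F] [Algebra k L] [Algebra k[X] L] [Algebra F L]
  [IsScalarTower k k[X] L] [IsScalarTower k[X] F L]
variable {d : ℕ} {h : k[X][X]} {T : Fin d → L} [hinj : Fact (Function.Injective T)]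

lemma exists_pth_root [IsAlgClosed k] (p : ℕ) [Fact p.Prime] [CharP k p] (c : k[X])
    (hc : derivative c = 0) : ∃ r : k[X], r ^ p = c := by
  have h1 := expand_contract p hc (Fact.out : p.Prime).ne_zero
  have hs : Function.Surjective (frobenius k p) := by
    intro a
    obtain ⟨b, hb⟩ := IsAlgClosed.exists_pow_nat_eq a (Fact.out : p.Prime).pos
    exact ⟨b, hb⟩
  obtain ⟨r, hr⟩ := map_surjective _ hs (contract p c)
  refine ⟨r, ?_⟩
  rw [← map_frobenius_expand, map_expand, hr, h1]

lemma pth_root [IsAlgClosed k] (p : ℕ) [Fact p.Prime] [CharP k p] {n : ℕ} (P : k[X][X])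
    (hP : TD (n + 1) P) (h1 : derivative P = 0) (h2 : dx P = 0) :
    ∃ Q : k[X][X], Q ^ p = P ∧ TD n Q := by
  have hp : p.Prime := Fact.out
  have hr : ∀ i, ∃ r : k[X], r ^ p = P.coeff (p * i) := fun i =>
    exists_pth_root p _ (by rw [← coeff_dx, h2, coeff_zero])
  choose r hr using hr
  have hr0 : ∀ i j, n < i + j → (r i).coeff j = 0 := by
    intro i j hij
    by_contra hne
    have hri : r i ≠ 0 := by rintro h0; rw [h0] at hne; simp at hne
    have hj : j ≤ (r i).natDegree := le_natDegree_of_ne_zero hne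
    have h3 := hP (p * i) (p * (r i).natDegree) (by
      have := hp.two_le
      nlinarith)
    rw [← hr, ← natDegree_pow, coeff_natDegree, leadingCoeff_eq_zero] at h3
    exact hri (eq_zero_of_pow_eq_zero h3)
  refine ⟨∑ i ∈ Finset.range (n + 1), monomial i (r i), ?_, ?_⟩
  · rw [sum_pow_char p]
    ext1 m
    simp only [monomial_pow, hr, finsetSum_coeff, coeff_monomial]
    by_cases hm : p ∣ m
    · obtain ⟨i, rfl⟩ := hm
      have h3 : ∀ j, (j * p = p * i) ↔ j = i := by
        intro j; rw [mul_comm]; exact Nat.mul_right_inj hp.ne_zero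
      simp only [h3]
      rw [Finset.sum_ite_eq']
      split_ifs with h4
      · rfl
      · have : r i = 0 := by
          ext j; rw [hr0 i j (by simp at h4; omega), coeff_zero]
        rw [← hr, this, zero_pow hp.ne_zero]
    · rw [Finset.sum_eq_zero]
      · have h3 : m ≠ 0 := by rintro rfl; simp at hm
        have h4 := congrArg (fun Q => coeff Q (m - 1)) h1
        simp only [coeff_derivative, coeff_zero] at h4
        rw [Nat.sub_add_cancel (Nat.pos_of_ne_zero h3), mul_eq_zero] at h4
        refine (h4.resolve_right ?_).symm
        intro h5
        apply hm
        rw [← CharP.cast_eq_zero_iff k[X] p]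
        have : (m : k[X]) = ((m - 1 + 1 : ℕ) : k[X]) := by rw [Nat.sub_add_cancel (Nat.pos_of_ne_zero h3)]
        rw [this]; push_cast; exact h5
      · intro i _
        rw [if_neg]
        rintro rfl
        exact hm (Dvd.intro_left i rfl)
  · intro i j hij
    rw [finsetSum_coeff]
    simp only [coeff_monomial]
    rw [Finset.sum_ite_eq']
    split_ifs
    · exact hr0 i j hij
    · simp

/-- bound for degree of dual curve -/
def NB (d : ℕ) : ℕ := d ^ d * (2 * (d + 1) + d * d + 1)

variable (k T) in
/-- dual coordinate -/
noncomputable def ct (h : k[X][X]) (i : Fin d) : L := -(ev T i (derivative h) / ev T i (dx h))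
variable (k T) in
/-- dual coordinate -/
noncomputable def xt (h : k[X][X]) (i : Fin d) : L :=
  xx k L + T i * (ev T i (derivative h) / ev T i (dx h))

lemma exists_Phi [FiniteDimensional F L] [IsGalois F L] (hc : Core k F L h T) (i : Fin d)
    (hv : ev T i (dx h) ≠ 0) :
    ∃ P : k[X][X], P ≠ 0 ∧ TD (2 * NB d) P ∧ ptA (xt k T h i) (ct k T h i) P = 0 := by
  classical
  set N := NB d with hN
  set v := ev T i (dx h) with hvd
  set u := ev T i (derivative h) with hud
  let Z := Fin (N + 1) × Fin (N + 1) → k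
  let y : Fin (N + 1) × Fin (N + 1) → L := fun s => (xx k L * v + T i * u) ^ (s.2 : ℕ) * (- u) ^ (s.1 : ℕ) *
      v ^ (2 * N - s.1 - s.2)
  have hy : ∀ s, y s ∈ VV k T ^ ((d + 1) * (2 * N)) := fun s =>
    term_mem hc i s.1 s.2 (2 * N) (by have := s.1.2; have := s.2.2; omega)
  let Λ : Z →ₗ[k] ↥(VV k T ^ ((d + 1) * (2 * N))) :=
    ∑ s, (LinearMap.proj s).smulRight (⟨y s, hy s⟩ : ↥(VV k T ^ ((d + 1) * (2 * N))))
  have hΛ : ∀ z, (Λ z : L) = ∑ s, algebraMap k L (z s) * y s := by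
    intro z
    simp [Λ, Algebra.smul_def]
    rfl
  have hfin : Module.Finite k ↥(VV k T ^ ((d + 1) * (2 * N))) := VV_fin _
  have hlt : Module.finrank k ↥(VV k T ^ ((d + 1) * (2 * N))) < Module.finrank k Z := by
    refine lt_of_le_of_lt (dim_upper hc _) ?_
    have h1 : Module.finrank k Z = (N + 1) * (N + 1) := by simp [Z]
    rw [h1]
    have h2 := finrank_le hc
    have hNpos : 1 ≤ N := Nat.mul_pos (Nat.pow_pos i.pos) (by omega)
    calc _ ≤ d ^ d * ((d + 1) * (2 * N) + d * d + 1) := Nat.mul_le_mul_right _ h2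
      _ ≤ d ^ d * ((2 * (d + 1) + d * d + 1) * N) := by
        apply Nat.mul_le_mul_left
        nlinarith
      _ = N * N := by rw [← mul_assoc]; rfl
      _ < _ := by nlinarith
  obtain ⟨z, hz, hz0⟩ := Submodule.exists_mem_ne_zero_of_ne_bot (LinearMap.ker_ne_bot_of_finrank_lt hlt)
  let P : k[X][X] := ∑ s : Fin (N + 1) × Fin (N + 1), monomial (s.1 : ℕ) (monomial (s.2 : ℕ) (z s))
  have hPc : ∀ a b : ℕ, (P.coeff a).coeff b = if hab : a < N + 1 ∧ b < N + 1 then z (⟨a, hab.1⟩, ⟨b, hab.2⟩) else 0 := by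
    intro a b
    simp only [P, finsetSum_coeff, coeff_monomial]
    split_ifs with hab
    · rw [Finset.sum_eq_single (⟨a, hab.1⟩, ⟨b, hab.2⟩)]
      · simp
      · rintro ⟨⟨a', ha'⟩, ⟨b', hb'⟩⟩ _ hne
        by_cases e1 : a' = a
        · by_cases e2 : b' = b
          · subst e1; subst e2; exact absurd rfl hne
          · simp [e1, e2, coeff_monomial]
        · simp [e1]
      · simp
    · apply Finset.sum_eq_zero
      rintro ⟨⟨a', ha'⟩, ⟨b', hb'⟩⟩ _
      by_cases e1 : a' = a
      · by_cases e2 : b' = b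
        · subst e1; subst e2; exact absurd ⟨ha', hb'⟩ hab
        · simp [e1, e2, coeff_monomial]
      · simp [e1]
  refine ⟨P, ?_, ?_, ?_⟩
  · intro h0
    apply hz0
    ext ⟨⟨a, ha⟩, ⟨b, hb⟩⟩
    have := hPc a b
    rw [h0, dif_pos ⟨ha, hb⟩] at this
    rw [coeff_zero, coeff_zero] at this
    exact this.symm
  · intro a b hab
    rw [hPc, dif_neg (by omega)]
  · have h1 := hΛ z
    rw [LinearMap.mem_ker.1 hz] at h1
    have h2 : v ^ (2 * N) * ptA (xt k T h i) (ct k T h i) P = ∑ s, algebraMap k L (z s) * y s := by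
      simp only [P]
      rw [map_sum, Finset.mul_sum]
      refine Finset.sum_congr rfl fun s _ => ?_
      obtain ⟨⟨a, ha⟩, ⟨b, hb⟩⟩ := s
      simp only [y]
      have h1 : v ^ (2 * N) = v ^ (2 * N - a - b) * v ^ a * v ^ b := by
        rw [← pow_add, ← pow_add]; congr 1; omega
      have h2 : xx k L * v + T i * u = v * xt k T h i := by rw [xt, ← hvd, ← hud]; field_simp
      have h3 : -u = v * ct k T h i := by rw [ct, ← hvd, ← hud]; field_simp
      rw [h1, h2, h3, mul_pow, mul_pow, ptA, coe_eval₂RingHom, eval₂_monomial, RingHom.coe_coe, aeval_monomial]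
      ring
    rw [← h1] at h2
    simpa [hv] using h2

end Core
end LineIrr
set_option linter.unusedSectionVars false
set_option linter.unusedVariables false
set_option linter.style.haveILetI false

namespace LineIrr

section Core

variable {k F L : Type} [Field k] [Field F] [Field L]
  [Algebra k[X] F] [IsFractionRing k[X] F] [Algebra k L] [Algebra k[X] L] [Algebra F L]
  [IsScalarTower k k[X] L] [IsScalarTower k[X] F L]
variable {d : ℕ} {h : k[X][X]} {T : Fin d → L} [hinj : Fact (Function.Injective T)]

lemma gal_xt (g : L ≃ₐ[F] L) {i j : Fin d} (hg : g (T i) = T j) : g (xt k T h i) = xt k T h j := by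
  rw [xt, xt, map_add, map_mul, map_div₀, gal_ev g hg, gal_ev g hg, hg, xx, gal_poly]

lemma gal_ct (g : L ≃ₐ[F] L) {i j : Fin d} (hg : g (T i) = T j) : g (ct k T h i) = ct k T h j := by
  rw [ct, ct, map_neg, map_div₀, gal_ev g hg, gal_ev g hg]

lemma gal_ptA (g : L ≃ₐ[F] L) (x c : L) (P : k[X][X]) : g (ptA x c P) = ptA (g x) (g c) P := by
  have h1 := hom_ptA (((g : L →+* L).comp (ptA x c)) : k[X][X] →+* L) (fun a => by
    rw [RingHom.comp_apply, ptA_CC]; exact gal_const g a)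
  have h2 := DFunLike.congr_fun h1 P
  rw [RingHom.comp_apply, RingHom.comp_apply, RingHom.comp_apply, ptA_X, ptA_CX] at h2
  exact h2

lemma dual_facts [IsAlgClosed k] [FiniteDimensional F L] [IsGalois F L] (hc : Core k F L h T)
    (hB : TopSep d h) (hs : SmoothH h) (hp : ((d * (d - 1) : ℕ) : k) ≠ 0) (D : Derivation k L L)
    (hD : ∀ P : k[X], D (algebraMap k[X] L P) = algebraMap k[X] L (derivative P)) (i : Fin d) :
    ev T i (dx h) ≠ 0 ∧ D (ct k T h i) ≠ 0 ∧ D (xt k T h i) = - (T i * D (ct k T h i)) := by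
  have hW := W_ne hc hB hs hp i
  rw [W_eq hc D hD] at hW
  have hu : ev T i (derivative h) ≠ 0 := hT_ne hc i
  set u := ev T i (derivative h) with hud
  have hv : ev T i (dx h) ≠ 0 := by
    intro h0
    rw [h0, map_zero] at hW
    simp at hW
  set v := ev T i (dx h) with hvd
  have h1 : ct k T h i * v = - u := by rw [ct, ← hud, ← hvd]; field_simp
  have h2 := congrArg D h1
  rw [Derivation.leibniz, map_neg] at h2
  simp only [smul_eq_mul] at h2
  have hDT : u * D (T i) = - v := D_T hc D hD i
  refine ⟨hv, ?_, ?_⟩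
  · intro h0
    apply hW
    rw [h0] at h2
    have : v * D u - u * D v = 0 := by
      linear_combination v * h2 - h1 * D v
    rw [this, mul_zero]
  · have h3 : xt k T h i = xx k L - T i * ct k T h i := by rw [xt, ct]; ring
    have h4 : D (xx k L) = 1 := by rw [xx, hD]; simp
    have h5 : ct k T h i * D (T i) = 1 := by
      have : v * (ct k T h i * D (T i)) = v * 1 := by linear_combination h1 * D (T i) - hDT
      exact mul_left_cancel₀ hv this
    rw [h3, map_sub, Derivation.leibniz, h4]
    simp only [smul_eq_mul]
    linear_combination -h5

lemma min_Phi [IsAlgClosed k] [FiniteDimensional F L] [IsGalois F L] (hc : Core k F L h T)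
    (p : ℕ) [Fact p.Prime] [CharP k p] (hB : TopSep d h) (hs : SmoothH h)
    (hp : ((d * (d - 1) : ℕ) : k) ≠ 0) (i : Fin d) :
    ∃ n ≤ 2 * NB d, ∃ P : k[X][X], TD n P ∧
      ptA (xt k T h i) (ct k T h i) (derivative P) = T i * ptA (xt k T h i) (ct k T h i) (dx P) ∧
      ptA (xt k T h i) (ct k T h i) (dx P) ≠ 0 := by
  classical
  obtain ⟨D, hD⟩ := exists_der (k := k) (F := F) (L := L)
  obtain ⟨hv, hDc, hDx⟩ := dual_facts hc hB hs hp D hD i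
  have hex : ∃ n, ∃ P : k[X][X], P ≠ 0 ∧ TD n P ∧ ptA (xt k T h i) (ct k T h i) P = 0 :=
    ⟨_, exists_Phi hc i hv⟩
  obtain ⟨P, hP0, hPT, hPz⟩ := Nat.find_spec hex
  have hmin : ∀ m < Nat.find hex, ∀ Q : k[X][X], TD m Q → ptA (xt k T h i) (ct k T h i) Q = 0 → Q = 0 := by
    intro m hm Q hQ hQz
    by_contra hne
    exact Nat.find_min hex hm ⟨Q, hne, hQ, hQz⟩
  have hle : Nat.find hex ≤ 2 * NB d := Nat.find_min' hex (exists_Phi hc i hv)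
  set n := Nat.find hex with hn
  have hrel : ptA (xt k T h i) (ct k T h i) (derivative P) = T i * ptA (xt k T h i) (ct k T h i) (dx P) := by
    have h1 := D_ptA D (xt k T h i) (ct k T h i) P
    rw [hPz, map_zero, hDx] at h1
    have : D (ct k T h i) * ptA (xt k T h i) (ct k T h i) (derivative P) =
        D (ct k T h i) * (T i * ptA (xt k T h i) (ct k T h i) (dx P)) := by linear_combination -h1
    exact mul_left_cancel₀ hDc this
  refine ⟨n, hle, P, hPT, hrel, ?_⟩
  intro h0
  rw [h0, mul_zero] at hrel
  rcases Nat.eq_zero_or_eq_succ_pred n with hm | hm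
  · rw [hm] at hPT
    have hPC : P = C (C ((P.coeff 0).coeff 0)) := by
      ext a b
      by_cases hab : 0 < a + b
      · rw [hPT a b hab, coeff_C]
        split_ifs with ha
        · subst ha
          rw [coeff_C, if_neg (by omega)]
        · simp
      · obtain ⟨rfl, rfl⟩ : a = 0 ∧ b = 0 := by omega
        simp
    rw [hPC, ptA_CC, map_eq_zero] at hPz
    rw [hPz] at hPC
    apply hP0
    rw [hPC]; simp
  · set m := n.pred
    rw [hm] at hPT hmin
    have e1 := hmin m (Nat.lt_succ_self m) _ (TD_derivative hPT) hrel
    have e2 := hmin m (Nat.lt_succ_self m) _ (TD_dx hPT) h0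
    obtain ⟨Q, hQ, hQT⟩ := pth_root p P hPT e1 e2
    rw [← hQ, map_pow] at hPz
    have := hmin m (Nat.lt_succ_self m) Q hQT (eq_zero_of_pow_eq_zero hPz)
    rw [this, zero_pow (Fact.out : p.Prime).ne_zero] at hQ
    exact hP0 hQ.symm

lemma exists_phi_pt [IsAlgClosed k] [FiniteDimensional F L] [IsGalois F L] (hc : Core k F L h T)
    (x0 t : k) (h0 : pt x0 t h = 0) :
    ∃ (φ : RR k T →ₐ[k] k) (i : Fin d), φ (xR k T) = x0 ∧ φ (tR k T i) = t := by
  obtain ⟨φ, hφ⟩ := exists_phi hc x0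
  have h1 := phi_split hc φ
  rw [pt_def, ← hφ, h1, eval_prod, Finset.prod_eq_zero_iff] at h0
  obtain ⟨i, _, hi⟩ := h0
  refine ⟨φ, i, hφ, ?_⟩
  simp only [eval_sub, eval_X, eval_C] at hi
  exact (sub_eq_zero.1 hi).symm

lemma pt_zero_of_ev [IsAlgClosed k] [FiniteDimensional F L] [IsGalois F L] (hc : Core k F L h T)
    (x0 t : k) (h0 : pt x0 t h = 0) (G : k[X][X]) (hG : ∀ i, ev T i G = 0) : pt x0 t G = 0 := by
  obtain ⟨φ, i, rfl, rfl⟩ := exists_phi_pt hc x0 t h0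
  rw [← phi_evR, show evR T i G = 0 from Subtype.ext (by rw [evR_coe, hG]; rfl), map_zero]

lemma zero_set [IsAlgClosed k] [FiniteDimensional F L] [IsGalois F L] (hc : Core k F L h T)
    (G : k[X][X]) (n : ℕ) (hG0 : ∀ i, ev T i G ≠ 0) (hG : ∀ i, ev T i G ∈ VV k T ^ n)
    (f : k → k → k) :
    ∃ S : Finset k, S.card ≤ d ^ d * (d * n) * d ∧
      ∀ x0 t, pt x0 t h = 0 → pt x0 t G = 0 → f x0 t ∈ S := by
  classical
  let y : RR k T := ∏ i, evR T i G
  have hy : (y : L) = ∏ i, ev T i G := by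
    rw [← Subalgebra.coe_val, map_prod]
    exact Finset.prod_congr rfl fun i _ => (evR_coe i _)
  have hy0 : y ≠ 0 := by
    intro h0
    rw [h0] at hy
    exact Finset.prod_ne_zero_iff.2 (fun i _ => hG0 i) hy.symm
  have hyV : (y : L) ∈ VV k T ^ (d * n) := by
    rw [hy]
    have := VV_prod (k := k) (T := T) Finset.univ (fun i => ev T i G) (fun _ => n) fun i _ => hG i
    simpa using this
  obtain ⟨P, hP0, hPd, hP⟩ := norm_lemma hc y hy0 hyV
  refine ⟨P.roots.toFinset.biUnion fun x0 => (sp h x0).roots.toFinset.image (f x0), ?_, ?_⟩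
  · have h1 : P.roots.toFinset.card ≤ d ^ d * (d * n) :=
      (Multiset.toFinset_card_le _).trans ((card_roots' P).trans (hPd.trans (Nat.mul_le_mul_right _ (finrank_le hc))))
    refine (Finset.card_biUnion_le_card_mul _ _ d fun x0 _ => ?_).trans (Nat.mul_le_mul_right _ h1)
    refine Finset.card_image_le.trans ((Multiset.toFinset_card_le _).trans ((card_roots' _).trans ?_))
    exact natDegree_map_le.trans (core_natDegree hc).le
  · intro x0 t h1 h2
    obtain ⟨φ, i, hx, ht⟩ := exists_phi_pt hc x0 t h1
    have hφ : φ y = 0 := by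
      rw [map_prod]
      apply Finset.prod_eq_zero (Finset.mem_univ i)
      rw [phi_evR, hx, ht, h2]
    have h3 := hP φ hφ
    rw [hx] at h3
    refine Finset.mem_biUnion.2 ⟨x0, ?_, Finset.mem_image.2 ⟨t, ?_, rfl⟩⟩
    · simp [hP0, h3]
    · have : sp h x0 ≠ 0 := ((core_monic hc).map _).ne_zero
      simp only [Multiset.mem_toFinset, mem_roots this]
      exact h1

/-- bound for bad directions -/
def BB (d : ℕ) : ℕ := d ^ d * (d * (d + d + d)) * d + d ^ d * (d * ((d + 1) * (2 * (2 * NB d)))) * d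

lemma bad_dirs [IsAlgClosed k] [FiniteDimensional F L] [IsGalois F L] (hc : Core k F L h T)
    (p : ℕ) [Fact p.Prime] [CharP k p] (hB : TopSep d h) (hs : SmoothH h)
    (hp : ((d * (d - 1) : ℕ) : k) ≠ 0) :
    ∃ S : Finset k, S.card ≤ BB d ∧
      (∀ c x0 t, pt x0 t h = 0 → pt x0 t (derivative h) + c * pt x0 t (dx h) = 0 →
        pt x0 t (derivative (derivative h)) + 2 * c * pt x0 t (dx (derivative h)) +
          c ^ 2 * pt x0 t (dx (dx h)) = 0 → c ∈ S) ∧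
      (∀ c x t s, pt (x + c * t) t h = 0 → pt (x + c * t) t (derivative h) + c * pt (x + c * t) t (dx h) = 0 →
        pt (x + c * s) s h = 0 → pt (x + c * s) s (derivative h) + c * pt (x + c * s) s (dx h) = 0 →
        t ≠ s → c ∈ S) := by
  classical
  have hd0 : d ≠ 0 := by rintro rfl; simp at hp
  obtain ⟨D, hD⟩ := exists_der (k := k) (F := F) (L := L)
  have hTD := TD_core hc
  let fc : k → k → k := fun x0 t => -(pt x0 t (derivative h) / pt x0 t (dx h))
  have hv0 : ∀ c x0 t, pt x0 t h = 0 → pt x0 t (derivative h) + c * pt x0 t (dx h) = 0 →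
      pt x0 t (dx h) ≠ 0 := by
    intro c x0 t h1 h2 h3
    rw [h3, mul_zero, add_zero] at h2
    exact smooth_pt hs x0 t h1 h2 h3
  have hfc : ∀ c x0 t, pt x0 t h = 0 → pt x0 t (derivative h) + c * pt x0 t (dx h) = 0 →
      fc x0 t = c := by
    intro c x0 t h1 h2
    have := hv0 c x0 t h1 h2
    simp only [fc]
    field_simp
    linear_combination -h2
  obtain ⟨S1, hS1, hS1'⟩ := zero_set hc (WP h) (d + d + d) (fun i => W_ne hc hB hs hp i) (fun i => by
    have a1 := ev_mem (T := T) (TD_derivative' hTD) i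
    have a2 := ev_mem (T := T) (TD_dx' hTD) i
    have a3 := ev_mem (T := T) (TD_derivative' (TD_derivative' hTD)) i
    have a4 := ev_mem (T := T) (TD_dx' (TD_derivative' hTD)) i
    have a5 := ev_mem (T := T) (TD_dx' (TD_dx' hTD)) i
    have e1 := VV_mul (VV_mul a3 a2) a2
    have e2 := VV_mul (VV_mul a4 a1) a2
    have e3 := VV_mul (VV_mul a5 a1) a1
    have : ev T i (WP h) = ev T i (derivative (derivative h)) * ev T i (dx h) * ev T i (dx h)
      - (ev T i (dx (derivative h)) * ev T i (derivative h) * ev T i (dx h) +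
        ev T i (dx (derivative h)) * ev T i (derivative h) * ev T i (dx h)) +
      ev T i (dx (dx h)) * ev T i (derivative h) * ev T i (derivative h) := by
      simp only [WP, map_add, map_sub, map_mul, map_pow, map_ofNat]; ring
    rw [this]
    exact Submodule.add_mem _ (Submodule.sub_mem _ e1 (Submodule.add_mem _ e2 e2)) e3) fc
  let i0 : Fin d := ⟨0, Nat.pos_of_ne_zero hd0⟩
  obtain ⟨n, hn, P, hPT, hP1, hP2⟩ := min_Phi hc p hB hs hp i0
  have hP1' : ∀ i, ptA (xt k T h i) (ct k T h i) (derivative P) = T i * ptA (xt k T h i) (ct k T h i) (dx P) := by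
    intro i
    obtain ⟨g, hg⟩ := gal_trans hc hB hs i0 i
    have := congrArg g hP1
    rwa [map_mul, gal_ptA, gal_ptA, gal_xt g hg, gal_ct g hg, hg] at this
  have hP2' : ∀ i, ptA (xt k T h i) (ct k T h i) (dx P) ≠ 0 := by
    intro i
    obtain ⟨g, hg⟩ := gal_trans hc hB hs i0 i
    intro h0
    rw [← gal_xt g hg, ← gal_ct g hg, ← gal_ptA, map_eq_zero] at h0
    exact hP2 h0
  have hvi : ∀ i, ev T i (dx h) ≠ 0 := fun i => (dual_facts hc hB hs hp D hD i).1
  have hG : ∀ Q : k[X][X], TD n Q → ∀ i, ev T i (Gh h n Q) =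
      ev T i (dx h) ^ (2 * n) * ptA (xt k T h i) (ct k T h i) Q := by
    intro Q hQ i
    rw [Gh_hom hQ (ev T i) (fun a => by rw [ev_eq_ptA, ptA_CC]) (hvi i)]
    rw [show ev (k := k) T i (C X) = xx k L by rw [ev_eq_ptA, ptA_CX],
      show ev (k := k) T i X = T i by rw [ev_eq_ptA, ptA_X]]
    rfl
  obtain ⟨S2, hS2, hS2'⟩ := zero_set hc (Gh h n (dx P)) ((d + 1) * (2 * (2 * NB d))) (fun i => by
    rw [hG _ (TD_dx' hPT)]
    exact mul_ne_zero (pow_ne_zero _ (hvi i)) (hP2' i)) (fun i =>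
    VV_mono (Nat.mul_le_mul_left _ (by omega)) (Gh_mem hc i n (dx P))) fc
  have hpt : ∀ c x t, pt (x + c * t) t h = 0 →
      pt (x + c * t) t (derivative h) + c * pt (x + c * t) t (dx h) = 0 →
      ∀ Q : k[X][X], TD n Q → pt (x + c * t) t (Gh h n Q) = pt (x + c * t) t (dx h) ^ (2 * n) * pt x c Q := by
    intro c x t h1 h2 Q hQ
    rw [Gh_hom hQ (pt (x + c * t) t) (fun a => by rw [pt_eq_ptA, ptA_CC]) (hv0 c _ t h1 h2)]
    have h3 := hfc c _ t h1 h2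
    simp only [fc] at h3
    rw [h3, pt_eq_ptA x c]
    congr 2
    rw [show pt (k := k) (x + c * t) t (C X) = x + c * t by rw [pt_eq_ptA, ptA_CX],
      show pt (k := k) (x + c * t) t X = t by rw [pt_eq_ptA, ptA_X]]
    congr 1
    linear_combination -t * h3
  have hlin : ∀ c x t, pt (x + c * t) t h = 0 →
      pt (x + c * t) t (derivative h) + c * pt (x + c * t) t (dx h) = 0 →
      pt x c (derivative P) = t * pt x c (dx P) := by
    intro c x t h1 h2
    have h3 := pt_zero_of_ev hc _ _ h1 (Gh h n (derivative P) - X * Gh h n (dx P)) (fun i => by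
      rw [map_sub, map_mul, hG _ (TD_derivative' hPT), hG _ (TD_dx' hPT), hP1',
        show ev (k := k) T i X = T i by rw [ev_eq_ptA, ptA_X]]
      ring)
    rw [map_sub, map_mul, hpt c x t h1 h2 _ (TD_derivative' hPT), hpt c x t h1 h2 _ (TD_dx' hPT),
      show pt (k := k) (x + c * t) t X = t by rw [pt_eq_ptA, ptA_X]] at h3
    have h4 := pow_ne_zero (2 * n) (hv0 c _ t h1 h2)
    apply mul_left_cancel₀ h4
    linear_combination h3
  refine ⟨S1 ∪ S2, (Finset.card_union_le _ _).trans (Nat.add_le_add hS1 hS2), ?_, ?_⟩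
  · intro c x0 t h1 h2 h3
    apply Finset.mem_union_left
    rw [← hfc c x0 t h1 h2]
    apply hS1' x0 t h1
    simp only [WP, map_add, map_sub, map_mul, map_pow, map_ofNat]
    have h4 : pt x0 t (derivative h) = - (c * pt x0 t (dx h)) := by linear_combination h2
    rw [h4]
    linear_combination pt x0 t (dx h) ^ 2 * h3
  · intro c x t s h1 h2 h3 h4 hts
    apply Finset.mem_union_right
    rw [← hfc c _ t h1 h2]
    apply hS2' _ t h1
    have e1 := hlin c x t h1 h2
    have e2 := hlin c x s h3 h4
    have e3 : (t - s) * pt x c (dx P) = 0 := by linear_combination e2 - e1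
    have e4 := (mul_eq_zero.1 e3).resolve_left (sub_ne_zero.2 hts)
    rw [hpt c x t h1 h2 _ (TD_dx' hPT), e4, mul_zero]

end Core
end LineIrr
set_option linter.unusedSectionVars false
set_option linter.unusedVariables false
set_option linter.style.haveILetI false

namespace LineIrr

section Core

variable {k F L : Type} [Field k] [Field F] [Field L]
  [Algebra k[X] F] [IsFractionRing k[X] F] [Algebra k L] [Algebra k[X] L] [Algebra F L]
  [IsScalarTower k k[X] L] [IsScalarTower k[X] F L]
variable {d : ℕ} {h : k[X][X]} {T : Fin d → L} [hinj : Fact (Function.Injective T)]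

variable {A : Type} [CommRing A] [Algebra k A]

lemma TD_mul {n m : ℕ} {P Q : k[X][X]} (hP : TD n P) (hQ : TD m Q) : TD (n + m) (P * Q) := by
  intro i j hij
  rw [coeff_mul, finsetSum_coeff]
  refine Finset.sum_eq_zero fun a ha => ?_
  rw [coeff_mul]
  refine Finset.sum_eq_zero fun b hb => ?_
  rw [Finset.HasAntidiagonal.mem_antidiagonal] at ha hb
  by_cases h1 : n < a.1 + b.1
  · rw [hP _ _ h1, zero_mul]
  · rw [hQ _ _ (by omega), mul_zero]

lemma TD_add {n : ℕ} {P Q : k[X][X]} (hP : TD n P) (hQ : TD n Q) : TD n (P + Q) := by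
  intro i j hij
  rw [coeff_add, coeff_add, hP _ _ hij, hQ _ _ hij, add_zero]

lemma TD_sum {n : ℕ} {ι : Type} (s : Finset ι) (P : ι → k[X][X]) (hP : ∀ i ∈ s, TD n (P i)) :
    TD n (∑ i ∈ s, P i) := by
  intro i j hij
  rw [finsetSum_coeff, finsetSum_coeff]
  exact Finset.sum_eq_zero fun a ha => hP a ha _ _ hij

lemma TD_CC (a : k) : TD 0 (C (C a) : k[X][X]) := by
  intro i j hij
  rw [coeff_C]
  split_ifs with h1
  · rw [coeff_C, if_neg (by omega)]
  · simp

lemma TD_X : TD 1 (X : k[X][X]) := by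
  intro i j hij
  rw [coeff_X]
  split_ifs with h1
  · rw [coeff_one, if_neg (by omega)]
  · simp

lemma TD_CX : TD 1 (C X : k[X][X]) := by
  intro i j hij
  rw [coeff_C]
  split_ifs with h1
  · rw [coeff_X, if_neg (by omega)]
  · simp

lemma TD_pow {n : ℕ} {P : k[X][X]} (hP : TD n P) (m : ℕ) : TD (m * n) (P ^ m) := by
  induction m with
  | zero => simpa using TD_CC (1 : k)
  | succ m ih => rw [pow_succ, Nat.succ_mul]; exact TD_mul ih hP

/-- the top form of degree n -/
noncomputable def Top (n : ℕ) (P : k[X][X]) (x s : k) : k :=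
  ∑ i ∈ Finset.range (n + 1), (P.coeff i).coeff (n - i) * (x ^ (n - i) * s ^ i)

lemma Top_one (n : ℕ) (P : k[X][X]) (s : k) :
    Top n P 1 s = ∑ i ∈ Finset.range (n + 1), (P.coeff i).coeff (n - i) * s ^ i := by
  simp [Top]

lemma Top_zero (n : ℕ) (P : k[X][X]) : Top n P 0 1 = (P.coeff n).coeff 0 := by
  rw [Top, Finset.sum_eq_single n]
  · simp
  · intro i hi hin
    rw [Finset.mem_range] at hi
    rw [zero_pow (by omega)]; simp
  · simp

lemma Top_smul (n : ℕ) (P : k[X][X]) (l x s : k) : Top n P (l * x) (l * s) = l ^ n * Top n P x s := by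
  rw [Top, Top, Finset.mul_sum]
  refine Finset.sum_congr rfl fun i hi => ?_
  rw [Finset.mem_range] at hi
  have : l ^ n = l ^ (n - i) * l ^ i := by rw [← pow_add]; congr 1; omega
  rw [this, mul_pow, mul_pow]; ring

lemma Top_CC_mul (n : ℕ) (P : k[X][X]) (l x s : k) : Top n (C (C l) * P) x s = l * Top n P x s := by
  rw [Top, Top, Finset.mul_sum]
  refine Finset.sum_congr rfl fun i hi => ?_
  rw [coeff_C_mul, coeff_C_mul]; ring

lemma Psi_coeff {n : ℕ} {P : k[X][X]} (hP : TD n P) (x s : k) :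
    (ptA (C x * X : k[X]) (C s * X) P).coeff n = Top n P x s := by
  rw [ptA_sum hP, finsetSum_coeff, Top]
  refine Finset.sum_congr rfl fun a ha => ?_
  rw [Finset.mem_range] at ha
  rw [finsetSum_coeff, Finset.sum_eq_single (n - a)]
  · have : (algebraMap k k[X] ((P.coeff a).coeff (n - a)) * ((C x * X) ^ (n - a) * (C s * X) ^ a) : k[X])
      = C ((P.coeff a).coeff (n - a) * (x ^ (n - a) * s ^ a)) * X ^ n := by
      have e : (X : k[X]) ^ n = X ^ (n - a) * X ^ a := by rw [← pow_add]; congr 1; omega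
      rw [e, algebraMap_eq]; simp only [map_mul, map_pow, mul_pow]; ring
    rw [this, coeff_C_mul_X_pow, if_pos rfl]
  · intro b hb hba
    have : (algebraMap k k[X] ((P.coeff a).coeff b) * ((C x * X) ^ b * (C s * X) ^ a) : k[X])
      = C ((P.coeff a).coeff b * (x ^ b * s ^ a)) * X ^ (a + b) := by
      rw [algebraMap_eq]; simp only [map_mul, map_pow, mul_pow]; ring
    rw [this, coeff_C_mul_X_pow, if_neg (by omega)]
  · intro h1; exfalso; apply h1; rw [Finset.mem_range]; omega

/-- shear substitution x ↦ x + cT -/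
noncomputable def twist (c : k) : k[X][X] →+* k[X][X] := ptA (C X + C (C c) * X) X

lemma algMap_CC (a : k) : algebraMap k k[X][X] a = C (C a) := rfl

lemma twist_CC (c a : k) : twist c (C (C a)) = C (C a) := by rw [twist, ptA_CC, algMap_CC]

lemma pt_twist (c x t : k) (P : k[X][X]) : pt x t (twist c P) = pt (x + c * t) t P := by
  have := hom_ptA (A := k) ((pt x t).comp (twist c)) (fun a => by
    rw [RingHom.comp_apply, twist_CC, pt_eq_ptA, ptA_CC])
  have h2 := congrArg (fun ψ => ψ P) this
  simp only [RingHom.comp_apply] at h2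
  rw [h2, twist, ptA_CX, ptA_X, pt_eq_ptA, pt_eq_ptA]
  simp only [map_add, map_mul, ptA_CX, ptA_X, ptA_CC, Algebra.algebraMap_self, RingHom.id_apply]

lemma Psi_twist (c x s : k) (P : k[X][X]) :
    ptA (C x * X : k[X]) (C s * X) (twist c P) = ptA (C (x + c * s) * X : k[X]) (C s * X) P := by
  have := hom_ptA (A := k[X]) ((ptA (C x * X : k[X]) (C s * X)).comp (twist c)) (fun a => by
    rw [RingHom.comp_apply, twist_CC, ptA_CC])
  have h2 := congrArg (fun ψ => ψ P) this
  simp only [RingHom.comp_apply] at h2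
  rw [h2, twist, ptA_CX, ptA_X]
  simp only [map_add, map_mul, ptA_CX, ptA_X, ptA_CC, algebraMap_eq]
  congr 2; ring

lemma TD_twist (c : k) {n : ℕ} {P : k[X][X]} (hP : TD n P) : TD n (twist c P) := by
  rw [twist, ptA_sum hP]
  refine TD_sum _ _ fun a _ => TD_sum _ _ fun b _ => ?_
  by_cases hab : n < a + b
  · rw [hP _ _ hab, map_zero, zero_mul]; intro i j _; simp
  · rw [algMap_CC]
    have h1 : TD 1 (C X + C (C c) * X : k[X][X]) := by
      refine TD_add TD_CX ?_
      have := TD_mul (TD_CC c) (TD_X (k := k)); simpa using this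
    refine TD_mono (n := 0 + (b * 1 + a * 1)) (by omega) ?_
    exact TD_mul (TD_CC _) (TD_mul (TD_pow h1 _) (TD_pow TD_X _))

lemma Top_twist (c : k) {n : ℕ} {P : k[X][X]} (hP : TD n P) (x s : k) :
    Top n (twist c P) x s = Top n P (x + c * s) s := by
  rw [← Psi_coeff (TD_twist c hP), Psi_twist, Psi_coeff hP]

lemma dx_smul (a : k) (P : k[X][X]) : dx (a • P) = a • dx P := by
  ext1 j; simp only [coeff_dx, coeff_smul, derivative_smul]

/-- dx as a derivation -/
noncomputable def dxD : Derivation k k[X][X] k[X][X] :=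
  Derivation.mk' { toFun := dx, map_add' := dx_add, map_smul' := dx_smul } (fun P Q => by
      simp only [LinearMap.coe_mk, AddHom.coe_mk, smul_eq_mul, dx_mul]; ring)

lemma dxD_apply (P : k[X][X]) : dxD P = dx P := rfl

/-- derivative as a derivation over the constants -/
noncomputable def dTD : Derivation k k[X][X] k[X][X] :=
  Derivation.mk' { toFun := fun P => derivative P, map_add' := fun P Q => by simp,
                   map_smul' := fun a P => by simp [derivative_smul] } (fun P Q => by
      simp only [LinearMap.coe_mk, AddHom.coe_mk, smul_eq_mul, derivative_mul]; ring)

lemma dTD_apply (P : k[X][X]) : dTD P = derivative P := rfl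

lemma dx_C (a : k[X]) : dx (C a) = C (derivative a) := by
  rw [← monomial_zero_left, dx_monomial, monomial_zero_left]

lemma dx_X : dx (X : k[X][X]) = 0 := by
  ext1 j; rw [coeff_dx, coeff_X]; split_ifs <;> simp

lemma derivative_twist (c : k) (P : k[X][X]) :
    derivative (twist c P) = twist c (derivative P + C (C c) * dx P) := by
  rw [← dTD_apply, twist, D_ptA]
  simp only [dTD_apply, derivative_add, derivative_C, derivative_mul, derivative_X, map_add, map_mul, ptA_CC,
    algMap_CC]
  ring

lemma dx_twist (c : k) (P : k[X][X]) : dx (twist c P) = twist c (dx P) := by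
  rw [← dxD_apply, twist, D_ptA]
  simp only [dxD_apply, dx_add, dx_mul, dx_C, dx_X, derivative_C, derivative_X, map_zero, map_one]
  ring

lemma smoothH_iff : SmoothH h ↔ ∀ x t, pt x t h = 0 → pt x t (derivative h) = 0 → pt x t (dx h) ≠ 0 := by
  refine ⟨smooth_pt, fun hh x0 t h0 h1 => ?_⟩
  have := hh x0 t h0 (by rw [← h1, pt_def, sp, sp, derivative_map])
  rw [derivative_eval_C]
  convert this using 1
  rw [pt_def, sp, ← coe_evalRingHom x0, eval_map, eval, hom_eval₂]
  simp

lemma smooth_twist (c l : k) (hl : l ≠ 0) (hs : SmoothH h) : SmoothH (C (C l) * twist c h) := by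
  rw [smoothH_iff] at hs ⊢
  intro x t h0 h1 h2
  have e : ∀ Q : k[X][X], pt x t (C (C l) * Q) = l * pt x t Q := by
    intro Q; rw [map_mul, pt_eq_ptA, ptA_CC]; rfl
  have e' : ∀ (x t : k) (Q : k[X][X]), pt x t (C (C c) * Q) = c * pt x t Q := by
    intro x t Q; rw [map_mul, pt_eq_ptA, ptA_CC]; rfl
  rw [e, mul_eq_zero_iff_left hl, pt_twist] at h0
  rw [derivative_C_mul, e, mul_eq_zero_iff_left hl, derivative_twist, pt_twist, map_add, e'] at h1
  have : dx (C (C l) * twist c h) = C (C l) * dx (twist c h) := by rw [dx_mul, dx_C]; simp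
  rw [this, e, mul_eq_zero_iff_left hl, dx_twist, pt_twist] at h2
  rw [h2, mul_zero, add_zero] at h1
  exact hs _ _ h0 h1 h2

lemma TD_monic {P : k[X][X]} (hP : TD d P) (h1 : (P.coeff d).coeff 0 = 1) : P.Monic ∧ P.natDegree = d := by
  have h2 : P.coeff d = 1 := by
    ext j
    rcases Nat.eq_zero_or_pos j with rfl | hj
    · rw [h1]; simp
    · rw [hP _ _ (by omega), coeff_one, if_neg (by omega)]
  have h3 : P.natDegree ≤ d := Nat.lt_succ_iff.mp (TD_natDegree hP)
  have h4 : P.natDegree = d := le_antisymm h3 (le_natDegree_of_ne_zero (by rw [h2]; exact one_ne_zero))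
  exact ⟨by rw [Monic, leadingCoeff, h4, h2], h4⟩

lemma topSep_twist (c l : k) (hTD : TD d h) (hB : TopSep d h) (hc0 : Top d h c 1 ≠ 0) :
    TopSep d (C (C l) * twist c h) := by
  obtain ⟨s, hs, hs'⟩ := hB
  have hne : ∀ j, 1 - c * s j ≠ 0 := by
    intro j hj
    have h1 : c * s j = 1 := by linear_combination -hj
    have h2 := Top_smul d h (s j) c 1
    rw [mul_comm, h1, mul_one, Top_one, hs'] at h2
    have : s j ≠ 0 := by intro h3; rw [h3] at h1; simp at h1
    exact (mul_ne_zero (pow_ne_zero _ this) hc0) h2.symm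
  refine ⟨fun j => s j / (1 - c * s j), fun i j hij => hs ?_, fun j => ?_⟩
  · have hij : s i / (1 - c * s i) = s j / (1 - c * s j) := hij
    rw [div_eq_div_iff (hne _) (hne _)] at hij
    linear_combination hij
  · rw [← Top_one, Top_CC_mul, Top_twist c hTD]
    have e : (1 + c * (s j / (1 - c * s j))) = (1 - c * s j)⁻¹ * 1 := by
      have := hne j
      field_simp; ring
    have e2 : s j / (1 - c * s j) = (1 - c * s j)⁻¹ * s j := div_eq_inv_mul _ _
    show l * Top d h (1 + c * (s j / (1 - c * s j))) (s j / (1 - c * s j)) = 0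
    rw [e, e2, Top_smul, Top_one, hs', mul_zero, mul_zero]

lemma triple_root {t : Fin d → k} {P : k[X]} (hP : P = ∏ i, (X - C (t i))) {i j a : Fin d} (hij : i ≠ j)
    (hia : i ≠ a) (hja : j ≠ a) (h1 : t i = t j) (h2 : t i = t a) :
    (derivative (derivative P)).eval (t i) = 0 := by
  classical
  have : ∃ Q, P = (X - C (t i)) ^ 3 * Q := by
    refine ⟨∏ b ∈ ((Finset.univ.erase i).erase j).erase a, (X - C (t b)), ?_⟩
    rw [hP, ← Finset.mul_prod_erase _ _ (Finset.mem_univ i),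
      ← Finset.mul_prod_erase _ _ (Finset.mem_erase.mpr ⟨hij.symm, Finset.mem_univ j⟩),
      ← Finset.mul_prod_erase _ _ (Finset.mem_erase.mpr ⟨hja.symm, Finset.mem_erase.mpr ⟨hia.symm, Finset.mem_univ a⟩⟩),
      ← h1, ← h2]
    ring
  obtain ⟨Q, rfl⟩ := this
  simp [derivative_mul, derivative_pow]

lemma double_root {t : Fin d → k} {P : k[X]} (hP : P = ∏ i, (X - C (t i))) {i j : Fin d} (hij : i ≠ j)
    (h1 : t i = t j) : P.eval (t i) = 0 ∧ (derivative P).eval (t i) = 0 := by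
  classical
  have : ∃ Q, P = (X - C (t i)) ^ 2 * Q := by
    refine ⟨∏ b ∈ ((Finset.univ.erase i).erase j), (X - C (t b)), ?_⟩
    rw [hP, ← Finset.mul_prod_erase _ _ (Finset.mem_univ i),
      ← Finset.mul_prod_erase _ _ (Finset.mem_erase.mpr ⟨hij.symm, Finset.mem_univ j⟩),
      ← h1]
    ring
  obtain ⟨Q, rfl⟩ := this
  simp [derivative_mul, derivative_pow]

lemma simple_twist [IsAlgClosed k] [FiniteDimensional F L] [IsGalois F L] (hc : Core k F L h T)
    (p : ℕ) [Fact p.Prime] [CharP k p] (hB : TopSep d h) (hs : SmoothH h)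
    (hp : ((d * (d - 1) : ℕ) : k) ≠ 0) :
    ∃ S : Finset k, S.card ≤ BB d ∧ ∀ c ∉ S, ∀ l ≠ 0, SimpleBr d (C (C l) * twist c h) := by
  obtain ⟨S, hS, h1, h2⟩ := bad_dirs hc p hB hs hp
  refine ⟨S, hS, fun c hcS l hl x0 t ht => ?_⟩
  intro i j a b hij hab eij eab
  by_contra hcon
  have e : ∀ (x t : k) (Q : k[X][X]), pt x t (C (C l) * Q) = l * pt x t Q := by
    intro x t Q; rw [map_mul, pt_eq_ptA, ptA_CC]; rfl
  have e' : ∀ (x t : k) (Q : k[X][X]), pt x t (C (C c) * Q) = c * pt x t Q := by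
    intro x t Q; rw [map_mul, pt_eq_ptA, ptA_CC]; rfl
  have key : ∀ i j : Fin d, i ≠ j → t i = t j → pt (x0 + c * t i) (t i) h = 0 ∧
      pt (x0 + c * t i) (t i) (derivative h) + c * pt (x0 + c * t i) (t i) (dx h) = 0 := by
    intro i j hij eij
    obtain ⟨h3, h4⟩ := double_root ht hij eij
    constructor
    · rw [← pt_def, e, mul_eq_zero_iff_left hl, pt_twist] at h3; exact h3
    · rw [sp, derivative_map] at h4
      change pt x0 (t i) _ = 0 at h4
      rw [derivative_C_mul, e, mul_eq_zero_iff_left hl, derivative_twist, pt_twist, map_add, e'] at h4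
      exact h4
  by_cases hia : t i = t a
  · have : ∃ m, i ≠ m ∧ j ≠ m ∧ t i = t m := by
      by_cases h5 : a = i ∨ a = j
      · refine ⟨b, ?_, ?_, hia.trans eab⟩
        · rintro rfl
          rcases h5 with h5 | h5
          · exact hab h5
          · exact hcon (Or.inr ⟨h5, rfl⟩)
        · rintro rfl
          rcases h5 with h5 | h5
          · exact hcon (Or.inl ⟨h5, rfl⟩)
          · exact hab h5
      · push Not at h5
        exact ⟨a, h5.1.symm, h5.2.symm, hia⟩
    obtain ⟨m, him, hjm, htm⟩ := this
    have h6 := triple_root ht hij him hjm eij htm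
    rw [sp, derivative_map, derivative_map] at h6
    change pt x0 (t i) _ = 0 at h6
    rw [derivative_C_mul, derivative_C_mul, e, mul_eq_zero_iff_left hl, derivative_twist, derivative_twist, pt_twist,
      map_add, e', derivative_add, derivative_C_mul, dx_add, dx_mul, dx_C] at h6
    simp only [derivative_C, map_zero, zero_mul, zero_add, map_add, e', dx_derivative] at h6
    obtain ⟨h3, h4⟩ := key i j hij eij
    refine hcS (h1 c _ _ h3 h4 ?_)
    rw [← h6, ← dx_derivative]; ring
  · obtain ⟨h3, h4⟩ := key i j hij eij
    obtain ⟨h5, h6⟩ := key a b hab eab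
    exact hcS (h2 c _ _ _ h3 h4 h5 h6 hia)

end Core
end LineIrr
set_option linter.unusedSectionVars false
set_option linter.unusedVariables false
set_option linter.style.haveILetI false

namespace LineIrr

section Core

variable {k F L : Type} [Field k] [Field F] [Field L]
  [Algebra k[X] F] [IsFractionRing k[X] F] [Algebra k L] [Algebra k[X] L] [Algebra F L]
  [IsScalarTower k k[X] L] [IsScalarTower k[X] F L]
variable {d : ℕ} {h : k[X][X]} {T : Fin d → L} [hinj : Fact (Function.Injective T)]

lemma TD_map {K : Type} [Field K] [Algebra K k] {n : ℕ} {P : K[X][X]} (hP : TD n P) :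
    TD n (P.map (mapRingHom (algebraMap K k))) := by
  intro i j hij
  rw [coeff_map, coe_mapRingHom, coeff_map, hP _ _ hij, map_zero]

lemma Top_map {K : Type} [Field K] [Algebra K k] (n : ℕ) (P : K[X][X]) (x s : K) :
    Top n (P.map (mapRingHom (algebraMap K k))) (algebraMap K k x) (algebraMap K k s) =
      algebraMap K k (Top n P x s) := by
  simp [Top]

lemma twist_map {K : Type} [Field K] [Algebra K k] (c : K) (P : K[X][X]) :
    (twist c P).map (mapRingHom (algebraMap K k)) =
      twist (algebraMap K k c) (P.map (mapRingHom (algebraMap K k))) := by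
  have : (mapRingHom (mapRingHom (algebraMap K k))).comp (twist c) =
      (twist (algebraMap K k c)).comp (mapRingHom (mapRingHom (algebraMap K k))) := by
    ext1
    · ext1
      · ext1 a
        simp only [RingHom.comp_apply, twist_CC, coe_mapRingHom, map_C]
      · simp [RingHom.comp_apply, twist, ptA_CX]
    · simp [RingHom.comp_apply, twist, ptA_X]
  exact congrArg (fun ψ => ψ P) this

lemma twist_eval (a b : k) (P : k[X][X]) :
    (twist a P).map (evalRingHom b) = ptA (C a * X + C b : k[X]) X P := by
  have := hom_ptA (A := k[X]) ((mapRingHom (evalRingHom b)).comp (twist a)) (fun c => by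
    rw [RingHom.comp_apply, twist_CC]; simp)
  have h2 := congrArg (fun ψ => ψ P) this
  simp only [RingHom.comp_apply] at h2
  rw [← coe_mapRingHom, h2, twist, ptA_CX, ptA_X]
  simp [add_comm]

lemma Top_roots {n : ℕ} {P : k[X][X]} (h0 : (P.coeff n).coeff 0 ≠ 0) :
    ∃ S : Finset k, S.card ≤ n ∧ ∀ c ∉ S, Top n P c 1 ≠ 0 := by
  classical
  let Q : k[X] := ∑ i ∈ Finset.range (n + 1), C ((P.coeff i).coeff (n - i)) * X ^ (n - i)
  have hQe : ∀ c, Q.eval c = Top n P c 1 := by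
    intro c; simp [Q, Top, eval_finsetSum]
  have hQ0 : Q ≠ 0 := by
    intro hQ
    have := hQe 0
    rw [hQ, Top_zero, eval_zero] at this
    exact h0 this.symm
  have hQd : Q.natDegree ≤ n := by
    refine natDegree_sum_le_of_forall_le _ _ fun i hi => ?_
    refine (natDegree_C_mul_X_pow_le _ _).trans (by omega)
  refine ⟨Q.roots.toFinset, (Multiset.toFinset_card_le _).trans ((card_roots' _).trans hQd), fun c hc => ?_⟩
  rw [← hQe]
  intro h1
  apply hc
  rw [Multiset.mem_toFinset, mem_roots hQ0]
  exact h1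

lemma irr_const_mul {a : k} (ha : a ≠ 0) (P : k[X]) : Irreducible (C a * P) ↔ Irreducible P := by
  have hu : IsUnit (C a : k[X]) := isUnit_C.mpr ha.isUnit
  exact (associated_unit_mul_left P (C a) hu).irreducible_iff

end Core

theorem count_norm (d : ℕ) (hd2 : 0 < d) : ∃ Cc Q0 : ℕ, ∀ (K k : Type) [Field K] [Fintype K] [Field k] [Algebra K k]
    [IsAlgClosed k] (p : ℕ) [Fact p.Prime] [CharP k p] (hK : K[X][X]) (h : k[X][X]),
    h = hK.map (mapRingHom (algebraMap K k)) →
    Q0 ≤ Fintype.card K → TD d hK → (hK.coeff d).coeff 0 = 1 →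
    TopSep d h → SmoothH h → ((d * (d - 1) : ℕ) : k) ≠ 0 →
    |(Nat.card {a : K × K // Irreducible (ptA (C a.1 * X + C a.2 : K[X]) X hK)} : ℝ) -
      (Fintype.card K : ℝ) ^ 2 / (d : ℝ)| ≤ Cc * ((Fintype.card K : ℝ) * √(Fintype.card K : ℝ)) := by
  classical
  obtain ⟨C1, Q0, hC1⟩ := count_irr d hd2
  refine ⟨C1 + (BB d + d), Q0, ?_⟩
  intro K k _ _ _ _ _ p _ _ hK h hh hq hTD h1 hB hs hp
  have hTDk : TD d h := by rw [hh]; exact TD_map hTD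
  have h1k : (h.coeff d).coeff 0 = 1 := by rw [hh, coeff_map, coe_mapRingHom, coeff_map, h1, map_one]
  obtain ⟨hm, hd⟩ := TD_monic hTDk h1k
  obtain ⟨⟨L, T, hc⟩⟩ := exists_pack h hm hd (fun i _ => TD_coeff hTDk i) (Or.inl hB)
  obtain ⟨S, hS, hSb⟩ := simple_twist hc p hB hs hp
  obtain ⟨S', hS', hSb'⟩ := Top_roots (n := d) (P := hK) (by rw [h1]; exact one_ne_zero)
  set q : ℝ := (Fintype.card K : ℝ) with hqdef
  have hq1 : 1 ≤ q := by
    have : 0 < Fintype.card K := Fintype.card_pos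
    rw [hqdef]; exact_mod_cast this
  let N : K → ℕ := fun a => Nat.card {b : K // Irreducible (ptA (C a * X + C b : K[X]) X hK)}
  have hN : Nat.card {a : K × K // Irreducible (ptA (C a.1 * X + C a.2 : K[X]) X hK)} = ∑ a, N a := by
    rw [← Nat.card_sigma]
    exact Nat.card_congr
      { toFun := fun a => ⟨a.1.1, ⟨a.1.2, a.2⟩⟩
        invFun := fun a => ⟨(a.1, a.2.1), a.2.2⟩
        left_inv := fun a => rfl
        right_inv := fun a => rfl }
  let bad : Finset K := Finset.univ.filter (fun a => algebraMap K k a ∈ S) ∪ S'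
  have hbad : bad.card ≤ BB d + d := by
    refine (Finset.card_union_le _ _).trans (Nat.add_le_add ?_ hS')
    refine le_trans ?_ hS
    refine Finset.card_le_card_of_injOn (algebraMap K k) ?_ ((algebraMap K k).injective.injOn)
    intro a ha
    exact (Finset.mem_filter.mp (Finset.mem_coe.mp ha)).2
  have hgood : ∀ a, a ∉ bad → |(N a : ℝ) - q / d| ≤ C1 * √q := by
    intro a ha
    have ha1 : algebraMap K k a ∉ S := fun h2 => ha (Finset.mem_union_left _ (by simp [h2]))
    have ha2 : Top d hK a 1 ≠ 0 := hSb' a (fun h2 => ha (Finset.mem_union_right _ h2))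
    set l := Top d hK a 1 with hl
    have hlk : algebraMap K k l⁻¹ ≠ 0 := by simpa using ha2
    have e1 : (C (C l⁻¹) * twist a hK).map (mapRingHom (algebraMap K k)) =
        C (C (algebraMap K k l⁻¹)) * twist (algebraMap K k a) h := by
      rw [Polynomial.map_mul, twist_map, ← hh, map_C, coe_mapRingHom, map_C]
    have hTD' : TD d (C (C l⁻¹) * twist a hK) := by
      have := TD_mul (TD_CC l⁻¹) (TD_twist a hTD); simpa using this
    have hc0 : ((C (C l⁻¹) * twist a hK).coeff d).coeff 0 = 1 := by
      rw [← Top_zero, Top_CC_mul, Top_twist a hTD]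
      simp only [mul_one, zero_add]
      exact inv_mul_cancel₀ ha2
    obtain ⟨hm', hd'⟩ := TD_monic hTD' hc0
    have := hC1 K k (C (C l⁻¹) * twist a hK) _ rfl hq hm' hd' (fun i _ => TD_coeff (TD_map hTD') i) (by
      rw [e1]
      refine topSep_twist _ _ hTDk hB ?_
      have h5 := Top_map (k := k) d hK a 1
      rw [← hh, map_one] at h5
      rw [h5]
      simpa using ha2) (by rw [e1]; exact smooth_twist _ _ hlk hs) (by rw [e1]; exact hSb _ ha1 _ hlk)
    have e2 : Nat.card {x0 : K // Irreducible ((C (C l⁻¹) * twist a hK).map (evalRingHom x0))} = N a := by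
      refine Nat.card_congr (Equiv.subtypeEquivRight fun b => ?_)
      rw [Polynomial.map_mul, twist_eval, map_C, coe_evalRingHom, eval_C]
      exact irr_const_mul (inv_ne_zero ha2) _
    rw [e2] at this
    exact this
  have hd1 : (1 : ℝ) ≤ d := by exact_mod_cast hd2
  have htriv : ∀ a, |(N a : ℝ) - q / d| ≤ q := by
    intro a
    have h3 : (N a : ℝ) ≤ q := by
      have : N a ≤ Fintype.card K := by
        rw [← Nat.card_eq_fintype_card]
        exact Nat.card_le_card_of_injective _ Subtype.val_injective
      rw [hqdef]; exact_mod_cast this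
    have h4 : q / d ≤ q := div_le_self (by linarith) hd1
    have h5 : 0 ≤ q / d := by positivity
    have h6 : (0 : ℝ) ≤ N a := by positivity
    rw [abs_le]; constructor <;> linarith
  have hsum : ((∑ a, N a : ℕ) : ℝ) - q ^ 2 / d = ∑ a, ((N a : ℝ) - q / d) := by
    rw [Finset.sum_sub_distrib, Finset.sum_const, Finset.card_univ, nsmul_eq_mul, ← hqdef]
    push_cast; ring
  rw [hN, hsum]
  refine (Finset.abs_sum_le_sum_abs _ _).trans ?_
  have hsq : 1 ≤ √q := Real.one_le_sqrt.mpr hq1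
  rw [← Finset.sum_add_sum_compl bad]
  have hA : ∑ a ∈ bad, |(N a : ℝ) - q / d| ≤ (BB d + d) * q := by
    refine (Finset.sum_le_card_nsmul _ _ q (fun a _ => htriv a)).trans ?_
    rw [nsmul_eq_mul]
    have : (bad.card : ℝ) ≤ BB d + d := by exact_mod_cast hbad
    gcongr
  have hBb : ∑ a ∈ badᶜ, |(N a : ℝ) - q / d| ≤ q * (C1 * √q) := by
    refine (Finset.sum_le_card_nsmul _ _ (C1 * √q) (fun a ha => hgood a (Finset.mem_compl.mp ha))).trans ?_
    rw [nsmul_eq_mul]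
    have : ((badᶜ).card : ℝ) ≤ q := by rw [hqdef]; exact_mod_cast Finset.card_le_univ _
    gcongr
  have hC : (BB d + d : ℝ) * q ≤ (BB d + d) * (q * √q) := by
    have : q ≤ q * √q := le_mul_of_one_le_right (by linarith) hsq
    gcongr
  push_cast
  nlinarith

end LineIrr
set_option linter.unusedSectionVars false
set_option linter.unusedVariables false
set_option linter.style.haveILetI false

namespace LineIrr

section MvP

variable {K k : Type} [Field K] [Field k] {d : ℕ}

lemma hom_aeval {σ A B : Type} [CommRing A] [CommRing B] [Algebra K B] [Algebra k A] (φ : K →+* k) (ψ : B →+* A)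
    (hψ : ∀ a, ψ (algebraMap K B a) = algebraMap k A (φ a)) (u : σ → B) (F : MvPolynomial σ K) :
    ψ (MvPolynomial.aeval u F) = MvPolynomial.aeval (fun i => ψ (u i)) (MvPolynomial.map φ F) := by
  induction F using MvPolynomial.induction_on with
  | C a => simp [hψ]
  | add P Q hP hQ => simp only [map_add, hP, hQ]
  | mul_X P i hP => simp only [map_mul, hP, MvPolynomial.aeval_X, MvPolynomial.map_X]

lemma hom_aeval' {σ A B : Type} [CommRing A] [CommRing B] [Algebra K B] [Algebra K A] (ψ : B →+* A)
    (hψ : ∀ a, ψ (algebraMap K B a) = algebraMap K A a) (u : σ → B) (F : MvPolynomial σ K) :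
    ψ (MvPolynomial.aeval u F) = MvPolynomial.aeval (fun i => ψ (u i)) F := by
  rw [hom_aeval (RingHom.id K) ψ hψ, MvPolynomial.map_id]

lemma chain_rule {A : Type} [CommRing A] [Algebra k A] (D : Derivation k A A) (u : Fin 3 → A)
    (F : MvPolynomial (Fin 3) k) :
    D (MvPolynomial.aeval u F) = ∑ j, MvPolynomial.aeval u (MvPolynomial.pderiv j F) * D (u j) := by
  induction F using MvPolynomial.induction_on with
  | C a => simp
  | add P Q hP hQ => simp only [map_add, hP, hQ, add_mul, Finset.sum_add_distrib]
  | mul_X P i hP =>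
    rw [map_mul, MvPolynomial.aeval_X, Derivation.leibniz, hP]
    simp only [Derivation.leibniz, smul_eq_mul, map_add, map_mul, MvPolynomial.aeval_X, add_mul,
      Finset.sum_add_distrib, MvPolynomial.pderiv_X]
    rw [Finset.sum_eq_single (s := Finset.univ) (a := i) (f := fun j => MvPolynomial.aeval u P *
      MvPolynomial.aeval u (Pi.single (M := fun _ => MvPolynomial (Fin 3) k) j 1 i) * D (u j))]
    · simp only [Pi.single_eq_same, map_one, mul_one, Finset.mul_sum]
      congr 1
      refine Finset.sum_congr rfl fun j _ => ?_
      ring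
    · intro j _ hj
      rw [Pi.single_eq_of_ne' hj]; simp
    · simp

lemma homog_sum {F : MvPolynomial (Fin 3) k} (hF : F.IsHomogeneous d) {m : Fin 3 →₀ ℕ} (hm : m ∈ F.support) :
    m 0 + m 1 + m 2 = d := by
  have := hF.degree_eq_sum_deg_support hm
  rw [this, ← Fin.sum_univ_three (fun i => m i)]
  refine (Finset.sum_subset (Finset.subset_univ _) fun i _ hi => ?_).symm
  simpa using hi

lemma aeval_sum {A : Type} [CommRing A] [Algebra k A] (u : Fin 3 → A) (F : MvPolynomial (Fin 3) k) :
    MvPolynomial.aeval u F = ∑ m ∈ F.support, algebraMap k A (F.coeff m) *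
      (u 0 ^ m 0 * u 1 ^ m 1 * u 2 ^ m 2) := by
  rw [MvPolynomial.aeval_def, MvPolynomial.eval₂_eq']
  simp only [Fin.prod_univ_three]

lemma homog_scale {A : Type} [CommRing A] [Algebra k A] {F : MvPolynomial (Fin 3) k} (hF : F.IsHomogeneous d)
    (c : A) (u : Fin 3 → A) :
    MvPolynomial.aeval (fun i => c * u i) F = c ^ d * MvPolynomial.aeval u F := by
  rw [aeval_sum, aeval_sum, Finset.mul_sum]
  refine Finset.sum_congr rfl fun m hm => ?_
  rw [← homog_sum hF hm]; ring

lemma homog_coeff {F : MvPolynomial (Fin 3) k} (hF : F.IsHomogeneous d) (u : Fin 3 → k[X])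
    (hu : ∀ i, (u i).natDegree ≤ 1) :
    (MvPolynomial.aeval u F).natDegree ≤ d ∧
      (MvPolynomial.aeval u F).coeff d = MvPolynomial.aeval (fun i => (u i).coeff 1) F := by
  have hp : ∀ i n, (u i ^ n).natDegree ≤ n := fun i n => by
    have := natDegree_pow_le_of_le n (hu i); simpa using this
  have hc : ∀ i n, (u i ^ n).coeff n = (u i).coeff 1 ^ n := fun i n => by
    have := coeff_pow_of_natDegree_le (m := n) (hu i); simpa using this
  have h01 : ∀ a b, (u 0 ^ a * u 1 ^ b).natDegree ≤ a + b := fun a b =>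
    natDegree_mul_le_of_le (hp _ _) (hp _ _)
  constructor
  · rw [aeval_sum]
    refine natDegree_sum_le_of_forall_le _ _ fun m hm => ?_
    rw [← homog_sum hF hm]
    refine (natDegree_C_mul_le _ _).trans ?_
    exact natDegree_mul_le_of_le (h01 _ _) (hp _ _)
  · rw [aeval_sum, aeval_sum, finsetSum_coeff]
    refine Finset.sum_congr rfl fun m hm => ?_
    rw [algebraMap_eq, coeff_C_mul, ← homog_sum hF hm, coeff_mul_add_eq_of_natDegree_le (h01 _ _) (hp _ _),
      coeff_mul_add_eq_of_natDegree_le (hp _ _) (hp _ _), hc, hc, hc]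
    rfl

lemma homog_TD {F : MvPolynomial (Fin 3) k} (hF : F.IsHomogeneous d) (u : Fin 3 → k[X][X])
    (hu : ∀ i, TD 1 (u i)) : TD d (MvPolynomial.aeval u F) := by
  rw [aeval_sum]
  refine TD_sum _ _ fun m hm => ?_
  have h1 : TD (0 + (m 0 * 1 + m 1 * 1 + m 2 * 1)) _ :=
    TD_mul (TD_CC (F.coeff m)) (TD_mul (TD_mul (TD_pow (hu 0) (m 0)) (TD_pow (hu 1) (m 1))) (TD_pow (hu 2) (m 2)))
  refine TD_mono ?_ h1
  rw [← homog_sum hF hm]; omega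

lemma top_nonzero {F : MvPolynomial (Fin 3) K} (hF : F.IsHomogeneous d) (hd : 0 < d)
    (hdeg : (MvPolynomial.aeval ![1, MvPolynomial.X 0, MvPolynomial.X 1] F : MvPolynomial (Fin 2) K).totalDegree = d) :
    (MvPolynomial.aeval ![0, 1, X] F : K[X]) ≠ 0 := by
  intro hG
  have hm0 : ∀ n ∈ F.support, n 0 ≠ 0 := by
    intro n hn hn0
    have h1 := congrArg (fun Q => coeff Q (n 2)) hG
    simp only [coeff_zero] at h1
    rw [aeval_sum, finsetSum_coeff, Finset.sum_eq_single n] at h1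
    · simp only [algebraMap_eq, coeff_C_mul, hn0] at h1
      simp at h1
      exact (MvPolynomial.mem_support_iff.mp hn) h1
    · intro m hm hmn
      rw [algebraMap_eq, coeff_C_mul]
      by_cases hm0 : m 0 = 0
      · simp only [hm0, Matrix.cons_val_zero, Matrix.cons_val_one, Matrix.cons_val, pow_zero, one_pow, one_mul,
          coeff_X_pow]
        rw [if_neg, mul_zero]
        intro h2
        apply hmn
        have e1 := homog_sum hF hm
        have e2 := homog_sum hF hn
        ext i
        fin_cases i
        · exact hm0.trans hn0.symm
        · show m 1 = n 1
          omega
        · exact h2.symm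
      · simp [zero_pow hm0]
    · intro h; exact absurd hn h
  have : (MvPolynomial.aeval ![1, MvPolynomial.X 0, MvPolynomial.X 1] F : MvPolynomial (Fin 2) K).totalDegree ≤ d - 1 := by
    rw [aeval_sum]
    refine MvPolynomial.totalDegree_finsetSum_le fun m hm => ?_
    refine (MvPolynomial.totalDegree_mul _ _).trans ?_
    rw [MvPolynomial.algebraMap_eq, MvPolynomial.totalDegree_C, zero_add]
    refine (MvPolynomial.totalDegree_mul _ _).trans ?_
    have h1 : ((![1, MvPolynomial.X 0, MvPolynomial.X 1] 0 ^ m 0 * ![1, MvPolynomial.X 0, MvPolynomial.X 1] 1 ^ m 1 :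
      MvPolynomial (Fin 2) K)).totalDegree ≤ m 1 := by
      simp [MvPolynomial.totalDegree_X_pow]
    have h2 : ((![1, MvPolynomial.X 0, MvPolynomial.X 1] 2 ^ m 2 : MvPolynomial (Fin 2) K)).totalDegree ≤ m 2 := by
      simp [MvPolynomial.totalDegree_X_pow]
    have := homog_sum hF hm
    have := hm0 m hm
    omega
  omega

end MvP

end LineIrr
set_option linter.unusedSectionVars false
set_option linter.unusedVariables false
set_option linter.style.haveILetI false

namespace LineIrr

section Chg

variable {K k : Type} [Field K] [Field k] {d : ℕ}

/-- the coordinate change -/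
noncomputable def uu (c x0 : k) : Fin 3 → k[X][X] :=
  ![C X, X, 1 + C (C c) * X + C (C x0) * C X]

lemma TD_uu (c x0 : k) (i : Fin 3) : TD 1 (uu c x0 i) := by
  have h1 : TD 1 (1 + C (C c) * X + C (C x0) * C X : k[X][X]) := by
    refine TD_add (TD_add (TD_mono (n := 0) (by omega) (by simpa using TD_CC (1 : k))) ?_) ?_
    · simpa using TD_mul (TD_CC c) (TD_X (k := k))
    · simpa using TD_mul (TD_CC x0) (TD_CX (k := k))
  fin_cases i
  · exact TD_CX
  · exact TD_X
  · exact h1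

lemma pt_aeval (x t : k) (u : Fin 3 → k[X][X]) (F : MvPolynomial (Fin 3) k) :
    pt x t (MvPolynomial.aeval u F) = MvPolynomial.aeval (fun i => pt x t (u i)) F :=
  hom_aeval' (pt x t) (fun a => by rw [pt_eq_ptA, algMap_CC, ptA_CC]) u F

lemma smooth_uu {F : MvPolynomial (Fin 3) k} (hF : F.IsHomogeneous d)
    (hsm : ∀ x : Fin 3 → k, x ≠ 0 → MvPolynomial.aeval x F = (0 : k) →
      ∃ j, MvPolynomial.aeval x (MvPolynomial.pderiv j F) ≠ (0 : k)) (c x0 l : k) (hl : l ≠ 0) :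
    SmoothH (C (C l) * MvPolynomial.aeval (uu c x0) F) := by
  rw [smoothH_iff]
  intro x t h0 h1 h2
  have e : ∀ Q : k[X][X], pt x t (C (C l) * Q) = l * pt x t Q := by
    intro Q; rw [map_mul, pt_eq_ptA, ptA_CC]; rfl
  have hdl : dx (C (C l) * MvPolynomial.aeval (uu c x0) F) = C (C l) * dx (MvPolynomial.aeval (uu c x0) F) := by
    rw [dx_mul, dx_C]; simp
  rw [e, mul_eq_zero_iff_left hl] at h0
  rw [derivative_C_mul, e, mul_eq_zero_iff_left hl, ← dTD_apply, chain_rule] at h1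
  rw [hdl, e, mul_eq_zero_iff_left hl, ← dxD_apply, chain_rule] at h2
  have hone : dx (1 : k[X][X]) = 0 := by
    have := dx_C (1 : k[X]); simpa using this
  have hp : (fun i => pt x t (uu c x0 i)) = ![x, t, 1 + c * t + x0 * x] := by
    funext i
    fin_cases i <;> simp [uu, pt_eq_ptA, ptA_X, ptA_CX, ptA_CC]
  simp only [Fin.sum_univ_three, map_add, map_mul, pt_aeval, hp] at h0 h1 h2
  simp [uu, dTD_apply, dxD_apply, dx_C, dx_X, dx_add, dx_mul, hone, pt_eq_ptA, ptA_CC] at h1 h2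
  have hne : (![x, t, 1 + c * t + x0 * x] : Fin 3 → k) ≠ 0 := by
    intro h3
    have a0 := congrFun h3 0
    have a1 := congrFun h3 1
    have a2 := congrFun h3 2
    simp at a0 a1 a2
    rw [a0, a1] at a2; simp at a2
  obtain ⟨j, hj⟩ := hsm _ hne h0
  have eul := congrArg (MvPolynomial.aeval (![x, t, 1 + c * t + x0 * x] : Fin 3 → k)) hF.sum_X_mul_pderiv
  rw [map_nsmul, h0, smul_zero, Fin.sum_univ_three] at eul
  simp at eul
  have z2 : MvPolynomial.eval (![x, t, 1 + c * t + x0 * x] : Fin 3 → k) (MvPolynomial.pderiv 2 F) = 0 := by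
    linear_combination eul - t * h1 - x * h2
  have z1 : MvPolynomial.eval (![x, t, 1 + c * t + x0 * x] : Fin 3 → k) (MvPolynomial.pderiv 1 F) = 0 := by
    rw [z2] at h1; simpa using h1
  have z0 : MvPolynomial.eval (![x, t, 1 + c * t + x0 * x] : Fin 3 → k) (MvPolynomial.pderiv 0 F) = 0 := by
    rw [z2] at h2; simpa using h2
  have hj' : MvPolynomial.eval (![x, t, 1 + c * t + x0 * x] : Fin 3 → k) (MvPolynomial.pderiv j F) ≠ 0 := by
    intro h; apply hj; rw [← h]; simp
  apply hj'
  fin_cases j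
  · exact z0
  · exact z1
  · exact z2

lemma Top_aeval {F : MvPolynomial (Fin 3) k} (hF : F.IsHomogeneous d) (u : Fin 3 → k[X][X])
    (hu : ∀ i, TD 1 (u i)) (x s : k) :
    Top d (MvPolynomial.aeval u F) x s = MvPolynomial.aeval (fun i => Top 1 (u i) x s) F := by
  rw [← Psi_coeff (homog_TD hF u hu), hom_aeval' _ (fun a => by rw [algMap_CC, ptA_CC]), (homog_coeff hF _ ?_).2]
  · simp only [Psi_coeff (hu _)]
  · intro i
    rw [ptA_sum (hu i)]
    refine natDegree_sum_le_of_forall_le _ _ fun a _ => natDegree_sum_le_of_forall_le _ _ fun b _ => ?_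
    by_cases hab : 1 < a + b
    · rw [hu i _ _ hab]; simp
    · refine (natDegree_C_mul_le _ _).trans ?_
      refine (natDegree_mul_le_of_le (natDegree_pow_le_of_le b (natDegree_C_mul_le x X))
        (natDegree_pow_le_of_le a (natDegree_C_mul_le s X))).trans ?_
      rw [natDegree_X]; omega

lemma Top_uu (c x0 x s : k) : (fun i => Top 1 (uu c x0 i) x s) = ![x, s, c * s + x0 * x] := by
  funext i
  fin_cases i <;> simp [uu, Top, Finset.sum_range_succ, coeff_X, coeff_C, coeff_one]
  ring

end Chg

section Irr

variable {K k : Type} [Field K] [Field k] [Algebra K k] {d : ℕ}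

lemma irr_iff {P : K[X]} (hd : 0 < d) (hP : P.natDegree = d) {α : k} (hα : aeval α P = 0) :
    Irreducible P ↔ (minpoly K α).natDegree = d := by
  have hP0 : P ≠ 0 := by rintro rfl; simp at hP; omega
  constructor
  · intro h
    rw [← minpoly.eq_of_irreducible h hα, natDegree_mul_C (inv_ne_zero (leadingCoeff_ne_zero.mpr hP0)), hP]
  · intro h
    have hIntg : IsIntegral K α := by
      rw [← isAlgebraic_iff_isIntegral]; exact ⟨P, hP0, hα⟩
    have := associated_of_dvd_of_natDegree_le (minpoly.dvd K α hα) hP0 (by rw [hP, h])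
    exact this.irreducible_iff.mp (minpoly.irreducible hIntg)

lemma irr_transfer [IsAlgClosed k] {F : MvPolynomial (Fin 3) K} (hF : F.IsHomogeneous d) (hd : 0 < d)
    (a b c x0 : K) (hb : b ≠ 0)
    (h1 : MvPolynomial.aeval ![0, 1, c - a * b⁻¹] F ≠ (0 : K))
    (h2 : MvPolynomial.aeval ![a, 1, c + x0 * a] F ≠ (0 : K)) :
    Irreducible (MvPolynomial.aeval ![1, X, C (c - a * b⁻¹) * X + C (b⁻¹ + x0)] F : K[X]) ↔
    Irreducible (MvPolynomial.aeval ![C a * X + C b, X, 1 + C c * X + C x0 * (C a * X + C b)] F : K[X]) := by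
  set P : K[X] := MvPolynomial.aeval ![1, X, C (c - a * b⁻¹) * X + C (b⁻¹ + x0)] F with hPdef
  set Q : K[X] := MvPolynomial.aeval ![C a * X + C b, X, 1 + C c * X + C x0 * (C a * X + C b)] F with hQdef
  have hPd : P.natDegree = d := by
    obtain ⟨h3, h4⟩ := homog_coeff hF ![1, X, C (c - a * b⁻¹) * X + C (b⁻¹ + x0)] (by
      intro i; fin_cases i
      · simp
      · simp
      · exact natDegree_linear_le)
    refine le_antisymm h3 (le_natDegree_of_ne_zero ?_)
    rw [hPdef, h4]
    convert h1 using 2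
    congr 1
    funext i
    fin_cases i <;> simp [coeff_one, coeff_X, coeff_C]
  have hQd : Q.natDegree = d := by
    obtain ⟨h3, h4⟩ := homog_coeff hF ![C a * X + C b, X, 1 + C c * X + C x0 * (C a * X + C b)] (by
      intro i; fin_cases i
      · exact natDegree_linear_le
      · simp
      · have : (1 + C c * X + C x0 * (C a * X + C b) : K[X]) = C (c + x0 * a) * X + C (1 + x0 * b) := by
          simp only [map_add, map_mul, map_one]; ring
        show (1 + C c * X + C x0 * (C a * X + C b) : K[X]).natDegree ≤ 1
        rw [this]
        exact natDegree_linear_le)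
    refine le_antisymm h3 (le_natDegree_of_ne_zero ?_)
    rw [hQdef, h4]
    convert h2 using 2
    congr 1
    funext i
    fin_cases i <;> simp [coeff_one, coeff_X, coeff_C]
  obtain ⟨α, hα⟩ := IsAlgClosed.exists_aeval_eq_zero k P (by
    rw [degree_eq_natDegree (by intro h; rw [h] at hPd; simp at hPd; omega), hPd]
    exact_mod_cast hd.ne')
  set φ := algebraMap K k with hφ
  have hev : ∀ (u : Fin 3 → K[X]) (y : k), aeval y (MvPolynomial.aeval u F) =
      MvPolynomial.aeval (fun i => aeval y (u i)) F := fun u y =>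
    hom_aeval' ((aeval y : K[X] →ₐ[K] k) : K[X] →+* k) (fun r => by simp) u F
  have h_al2 := hα
  rw [hPdef, hev] at hα
  have hu1 : (fun i => aeval α (![1, X, C (c - a * b⁻¹) * X + C (b⁻¹ + x0)] i : K[X])) =
      ![1, α, φ (c - a * b⁻¹) * α + φ (b⁻¹ + x0)] := by
    funext i
    fin_cases i <;> simp [hφ]
  rw [hu1] at hα
  have hbk : φ b ≠ 0 := by simpa [hφ] using hb
  have hden : 1 - φ a * α ≠ 0 := by
    intro h3
    have h4 : φ a * α = 1 := by linear_combination -h3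
    apply h2
    have h5 := homog_scale hF (φ a) ![1, α, φ (c - a * b⁻¹) * α + φ (b⁻¹ + x0)]
    rw [hα, mul_zero] at h5
    have h6 : (fun i => φ a * ![1, α, φ (c - a * b⁻¹) * α + φ (b⁻¹ + x0)] i) =
        fun i => φ (![a, 1, c + x0 * a] i) := by
      funext i
      fin_cases i
      · simp
      · simp [h4]
      · simp only [map_sub, map_add, map_mul, map_inv₀, Fin.reduceFinMk, Matrix.cons_val]
        linear_combination (φ c - φ a * (φ b)⁻¹) * h4
    rw [h6, ← hom_aeval' φ (fun r => rfl)] at h5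
    exact (map_eq_zero φ).mp h5
  have hden' : 1 - α * φ a ≠ 0 := by rwa [mul_comm]
  set β := φ b * α / (1 - φ a * α) with hβ
  have hβ2 : φ a * β + φ b = φ b / (1 - φ a * α) := by
    rw [hβ]; field_simp; ring
  have hβ0 : aeval β Q = 0 := by
    rw [hQdef, hev]
    have h5 := homog_scale hF (φ b / (1 - φ a * α)) ![1, α, φ (c - a * b⁻¹) * α + φ (b⁻¹ + x0)]
    rw [hα, mul_zero] at h5
    rw [← h5]
    congr 2
    funext i
    fin_cases i
    · simpa [hφ] using hβ2
    · simp [hβ]; ring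
    · simp only [Fin.reduceFinMk, Matrix.cons_val, map_add, map_mul, map_one, aeval_X, aeval_C, map_sub, map_inv₀]
      rw [← hφ, hβ2, hβ]
      field_simp
      ring
  have hαβ : α = β / (φ a * β + φ b) := by
    rw [hβ2, hβ]; field_simp
  have hPne : P ≠ 0 := by intro h; rw [h] at hPd; simp at hPd; omega
  have hQne : Q ≠ 0 := by intro h; rw [h] at hQd; simp at hQd; omega
  have iα : IsIntegral K α := by rw [← isAlgebraic_iff_isIntegral]; exact ⟨P, hPne, h_al2⟩
  have iβ : IsIntegral K β := by rw [← isAlgebraic_iff_isIntegral]; exact ⟨Q, hQne, hβ0⟩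
  have hadj : IntermediateField.adjoin K {α} = IntermediateField.adjoin K {β} := by
    apply le_antisymm
    · rw [IntermediateField.adjoin_le_iff, Set.singleton_subset_iff]
      have hmem : β ∈ IntermediateField.adjoin K {β} := IntermediateField.mem_adjoin_simple_self K β
      show α ∈ IntermediateField.adjoin K {β}
      rw [hαβ]
      exact div_mem hmem (add_mem (mul_mem (algebraMap_mem _ a) hmem) (algebraMap_mem _ b))
    · rw [IntermediateField.adjoin_le_iff, Set.singleton_subset_iff]
      have hmem : α ∈ IntermediateField.adjoin K {α} := IntermediateField.mem_adjoin_simple_self K α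
      show β ∈ IntermediateField.adjoin K {α}
      rw [hβ]
      exact div_mem (mul_mem (algebraMap_mem _ b) hmem) (sub_mem (one_mem _) (mul_mem (algebraMap_mem _ a) hmem))
  rw [irr_iff hd hPd h_al2, irr_iff hd hQd hβ0, ← IntermediateField.adjoin.finrank iα,
    ← IntermediateField.adjoin.finrank iβ, hadj]

end Irr

end LineIrr
set_option linter.unusedSectionVars false
set_option linter.unusedVariables false
set_option linter.style.haveILetI false

namespace LineIrr

section Sep

variable {K k : Type} [Field K] [Field k] {d : ℕ}

/-- the affine coordinate ring isomorphism -/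
noncomputable def shearEquiv (c : k) : MvPolynomial (Fin 2) k ≃+* k[X][X] :=
  RingEquiv.ofRingHom
    ((MvPolynomial.aeval ![X, C (C c) * X + C X] : MvPolynomial (Fin 2) k →ₐ[k] k[X][X]) :
      MvPolynomial (Fin 2) k →+* k[X][X])
    (ptA (MvPolynomial.X 1 - MvPolynomial.C c * MvPolynomial.X 0 : MvPolynomial (Fin 2) k) (MvPolynomial.X 0))
    (by
      ext1
      · ext1
        · ext1 a
          simp only [RingHom.comp_apply, ptA_CC, RingHom.coe_coe, MvPolynomial.algebraMap_eq, MvPolynomial.aeval_C,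
            algMap_CC, RingHom.id_apply]
        · simp only [RingHom.comp_apply, ptA_CX, RingHom.coe_coe, map_sub, map_mul, MvPolynomial.aeval_C,
            MvPolynomial.aeval_X, algMap_CC, RingHom.id_apply]
          simp
      · simp only [RingHom.comp_apply, ptA_X, RingHom.coe_coe, MvPolynomial.aeval_X, RingHom.id_apply]
        simp)
    (by
      apply MvPolynomial.ringHom_ext
      · intro a
        simp only [RingHom.comp_apply, RingHom.coe_coe, MvPolynomial.aeval_C, algMap_CC, ptA_CC, RingHom.id_apply,
          MvPolynomial.algebraMap_eq]
      · intro i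
        fin_cases i
        · simp [ptA_X]
        · simp [ptA_X, ptA_CX, ptA_CC])

lemma shearEquiv_apply (c : k) (f : MvPolynomial (Fin 2) k) :
    shearEquiv c f = MvPolynomial.aeval ![X, C (C c) * X + C X] f := rfl

/-- the sheared coordinates -/
noncomputable def vv (c : k) : Fin 3 → k[X][X] := ![1, X, C (C c) * X + C X]

lemma TD_vv (c : k) (i : Fin 3) : TD 1 (vv c i) := by
  have h1 : TD 1 (C (C c) * X + C X : k[X][X]) := by
    refine TD_add ?_ TD_CX
    simpa using TD_mul (TD_CC c) (TD_X (k := k))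
  fin_cases i
  · have h2 : TD 0 (1 : k[X][X]) := by simpa using TD_CC (1 : k)
    exact TD_mono (n := 0) (by omega) h2
  · exact TD_X
  · exact h1

lemma Top_vv (c x s : k) : (fun i => Top 1 (vv c i) x s) = ![0, s, c * s + x] := by
  funext i
  fin_cases i <;> simp [vv, Top, Finset.sum_range_succ, coeff_X, coeff_C, coeff_one]
  ring

lemma exists_sep [IsAlgClosed k] {F : MvPolynomial (Fin 3) k} (hF : F.IsHomogeneous d)
    (hirr : Irreducible (MvPolynomial.aeval ![1, MvPolynomial.X 0, MvPolynomial.X 1] F : MvPolynomial (Fin 2) k))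
    (hd : (d : k) ≠ 0) (c : k) (hc : MvPolynomial.aeval ![0, 1, c] F ≠ (0 : k)) :
    ∃ P : k[X], P ≠ 0 ∧ P.natDegree ≤ d ^ d * (d * d) ∧ ∀ x0, P.eval x0 ≠ 0 →
      ∃ t : Fin d → k, Function.Injective t ∧ ∀ j, MvPolynomial.aeval ![1, t j, c * t j + x0] F = (0 : k) := by
  set l := MvPolynomial.aeval ![0, 1, c] F with hl
  have hTD := homog_TD hF (vv c) (TD_vv c)
  let h : k[X][X] := C (C l⁻¹) * MvPolynomial.aeval (vv c) F
  have hTDh : TD d h := by have := TD_mul (TD_CC l⁻¹) hTD; simpa using this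
  have h0 : (h.coeff d).coeff 0 = 1 := by
    rw [← Top_zero, Top_CC_mul, Top_aeval hF _ (TD_vv c), Top_vv, mul_one, add_zero, ← hl]
    exact inv_mul_cancel₀ hc
  obtain ⟨hm, hdeg⟩ := TD_monic hTDh h0
  have hirrh : Irreducible h := by
    have hu : IsUnit (C (C l⁻¹) : k[X][X]) := isUnit_C.mpr (isUnit_C.mpr (inv_ne_zero hc).isUnit)
    refine (associated_unit_mul_left _ _ hu).irreducible_iff.mpr ?_
    rw [← MulEquiv.irreducible_iff (shearEquiv c), shearEquiv_apply] at hirr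
    have := hom_aeval' (K := k) ((MvPolynomial.aeval ![X, C (C c) * X + C X] :
      MvPolynomial (Fin 2) k →ₐ[k] k[X][X]) : MvPolynomial (Fin 2) k →+* k[X][X]) (fun a => by simp)
      ![1, MvPolynomial.X 0, MvPolynomial.X 1] F
    rw [RingHom.coe_coe] at this
    rw [this] at hirr
    have e : (fun i => MvPolynomial.aeval (![X, C (C c) * X + C X] : Fin 2 → k[X][X])
        ((![1, MvPolynomial.X 0, MvPolynomial.X 1] : Fin 3 → MvPolynomial (Fin 2) k) i)) = vv c := by
      funext i
      fin_cases i <;> simp [vv]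
    rw [e] at hirr
    exact hirr
  have hsep : (h.map (algebraMap k[X] (FractionRing k[X]))).Separable := by
    rw [separable_iff_derivative_ne_zero ((hm.irreducible_iff_irreducible_map_fraction_map).mp hirrh)]
    intro h1
    have h2 := congrArg (fun Q => Q.coeff (d - 1)) h1
    have hd1 : d - 1 + 1 = d := by
      have : d ≠ 0 := by rintro rfl; simp at hd
      omega
    have h3 : h.coeff d = 1 := by have := hm.coeff_natDegree; rwa [hdeg] at this
    simp only [coeff_derivative, coeff_map, hd1, h3, map_one, one_mul, coeff_zero] at h2
    rw [← Nat.cast_add_one, hd1] at h2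
    have h4 : algebraMap k[X] (FractionRing k[X]) (C (d : k)) = 0 := by simpa using h2
    rw [IsFractionRing.to_map_eq_zero_iff, C_eq_zero] at h4
    exact hd h4
  obtain ⟨P, hP0, hPd, hP⟩ := good_points h hm hdeg (fun i _ => TD_coeff hTDh i) (Or.inr hsep)
  refine ⟨P, hP0, hPd, fun x0 hx0 => ?_⟩
  obtain ⟨t, ht, hsp⟩ := hP x0 hx0
  refine ⟨t, ht, fun j => ?_⟩
  have h1 : pt x0 (t j) h = 0 := by
    rw [pt_def, hsp, eval_prod]
    exact Finset.prod_eq_zero (Finset.mem_univ j) (by simp)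
  rw [map_mul, pt_aeval, pt_eq_ptA, ptA_CC] at h1
  have h2 : (fun i => ptA x0 (t j) (vv c i)) = ![1, t j, c * t j + x0] := by
    funext i
    fin_cases i <;> simp [vv, ptA_X, ptA_CX, ptA_CC]
  rw [h2] at h1
  exact (mul_eq_zero.mp h1).resolve_left (inv_ne_zero hc)

lemma card_diff {α : Type} [Fintype α] (p r : α → Prop) (bad : Finset α) (hb : ∀ x ∉ bad, p x ↔ r x) :
    |(Nat.card {x // p x} : ℝ) - Nat.card {x // r x}| ≤ bad.card := by
  classical
  have key : ∀ p r : α → Prop, (∀ x ∉ bad, p x ↔ r x) → Nat.card {x // p x} ≤ Nat.card {x // r x} + bad.card := by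
    intro p r hb
    rw [Nat.card_eq_fintype_card, Nat.card_eq_fintype_card, Fintype.card_subtype, Fintype.card_subtype]
    refine (Finset.card_le_card ?_).trans (Finset.card_union_le _ _)
    intro x hx
    rw [Finset.mem_filter] at hx
    by_cases hxb : x ∈ bad
    · exact Finset.mem_union_right _ hxb
    · exact Finset.mem_union_left _ (Finset.mem_filter.mpr ⟨Finset.mem_univ _, (hb x hxb).mp hx.2⟩)
  have h1 := key p r hb
  have h2 := key r p (fun x hx => (hb x hx).symm)
  have h1' : (Nat.card {x // p x} : ℝ) ≤ Nat.card {x // r x} + bad.card := by exact_mod_cast h1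
  have h2' : (Nat.card {x // r x} : ℝ) ≤ Nat.card {x // p x} + bad.card := by exact_mod_cast h2
  rw [abs_le]; constructor <;> linarith

/-- the bijection between parameters of lines -/
noncomputable def lineEquiv (c x0 : K) [DecidableEq K] : K × K ≃ K × K where
  toFun z := (c - z.1 * (if z.2 = 0 then 1 else z.2⁻¹), z.2⁻¹ + x0)
  invFun w := ((c - w.1) * (if w.2 - x0 = 0 then 1 else (w.2 - x0)⁻¹), (w.2 - x0)⁻¹)
  left_inv z := by
    by_cases hz : z.2 = 0
    · ext <;> simp [hz]
    · ext <;> simp [hz]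
  right_inv w := by
    by_cases hw : w.2 - x0 = 0
    · ext
      · simp [hw]
      · simp only [hw, inv_zero, zero_add]; exact (sub_eq_zero.mp hw).symm
    · ext
      · simp [hw]
      · simp

lemma roots_bound {Q : K[X]} (hQ0 : Q ≠ 0) (hQd : Q.natDegree ≤ d) :
    ∃ S : Finset K, S.card ≤ d ∧ ∀ c ∉ S, Q.eval c ≠ 0 := by
  classical
  refine ⟨Q.roots.toFinset, (Multiset.toFinset_card_le _).trans ((card_roots' _).trans hQd), fun c hc h1 => hc ?_⟩
  rw [Multiset.mem_toFinset, mem_roots hQ0]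
  exact h1

lemma compare [IsAlgClosed k] [Algebra K k] [Fintype K] {F : MvPolynomial (Fin 3) K} (hF : F.IsHomogeneous d) (hd : 0 < d)
    (c x0 : K) (hc : MvPolynomial.aeval ![0, 1, c] F ≠ (0 : K)) :
    |(Nat.card {a : K × K // Irreducible (MvPolynomial.aeval ![1, X, C a.1 * X + C a.2] F : K[X])} : ℝ) -
      Nat.card {a : K × K // Irreducible (MvPolynomial.aeval
        ![C a.1 * X + C a.2, X, 1 + C c * X + C x0 * (C a.1 * X + C a.2)] F : K[X])}| ≤
      (2 * d + 1) * Fintype.card K := by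
  classical
  have hev : ∀ (u : Fin 3 → K[X]) (y : K), eval y (MvPolynomial.aeval u F) =
      MvPolynomial.aeval (fun i => eval y (u i)) F := fun u y =>
    hom_aeval' (evalRingHom y) (fun r => by simp) u F
  obtain ⟨S1, hS1, hS1'⟩ := roots_bound (d := d) (Q := MvPolynomial.aeval ![0, 1, X] F) (by
    intro h
    apply hc
    have := hev ![0, 1, X] c
    have e2 : (fun i => eval c ((![0, 1, X] : Fin 3 → K[X]) i)) = ![0, 1, c] := by
      funext i; fin_cases i <;> simp
    rw [h, eval_zero, e2] at this
    exact this.symm) ((homog_coeff hF _ (by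
      intro i; fin_cases i <;> simp)).1)
  obtain ⟨S2, hS2, hS2'⟩ := roots_bound (d := d) (Q := MvPolynomial.aeval ![X, 1, C c + C x0 * X] F) (by
    intro h
    apply hc
    have := hev ![X, 1, C c + C x0 * X] 0
    have e2 : (fun i => eval 0 ((![X, 1, C c + C x0 * X] : Fin 3 → K[X]) i)) = ![0, 1, c] := by
      funext i; fin_cases i <;> simp
    rw [h, eval_zero, e2] at this
    exact this.symm) ((homog_coeff hF _ (by
      intro i; fin_cases i
      · simp
      · simp
      · show (C c + C x0 * X : K[X]).natDegree ≤ 1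
        rw [add_comm]; exact natDegree_linear_le)).1)
  have hcard : Nat.card {a : K × K // Irreducible (MvPolynomial.aeval ![1, X, C a.1 * X + C a.2] F : K[X])} =
      Nat.card {z : K × K // Irreducible (MvPolynomial.aeval ![1, X, C (lineEquiv c x0 z).1 * X +
        C (lineEquiv c x0 z).2] F : K[X])} :=
    (Nat.card_congr ((lineEquiv c x0).subtypeEquiv fun z => Iff.rfl)).symm
  rw [hcard]
  let bad : Finset (K × K) := (Finset.univ ×ˢ {0}) ∪ ((S2 ×ˢ Finset.univ) ∪
    (S1 ×ˢ Finset.univ).map (lineEquiv c x0).symm.toEmbedding)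
  refine (card_diff _ _ bad ?_).trans ?_
  · rintro ⟨a, b⟩ hz
    simp only [bad, Finset.mem_union, not_or, Finset.mem_product, Finset.mem_univ, true_and, Finset.mem_singleton,
      and_true, Finset.mem_map_equiv, Equiv.symm_symm] at hz
    obtain ⟨hb, ha, hab⟩ := hz
    have e1 : lineEquiv c x0 (a, b) = (c - a * b⁻¹, b⁻¹ + x0) := by simp [lineEquiv, hb]
    rw [e1] at hab ⊢
    refine irr_transfer (k := k) hF hd a b c x0 hb ?_ ?_
    · have := hS1' _ hab
      rw [hev] at this
      convert this using 3
      funext i; fin_cases i <;> simp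
    · have := hS2' _ ha
      rw [hev] at this
      convert this using 3
      funext i; fin_cases i <;> simp
  · have h1 : bad.card ≤ Fintype.card K + (d * Fintype.card K + d * Fintype.card K) := by
      refine (Finset.card_union_le _ _).trans (Nat.add_le_add ?_ ((Finset.card_union_le _ _).trans
        (Nat.add_le_add ?_ ?_)))
      · simp [Finset.card_product]
      · rw [Finset.card_product, Finset.card_univ]; gcongr
      · rw [Finset.card_map, Finset.card_product, Finset.card_univ]; gcongr
    have h2 : (bad.card : ℝ) ≤ Fintype.card K + (d * Fintype.card K + d * Fintype.card K) := by exact_mod_cast h1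
    linarith

end Sep

end LineIrr
set_option linter.unusedSectionVars false
set_option linter.unusedVariables false
set_option linter.style.haveILetI false

namespace LineIrr

theorem main_count (d : ℕ) (hd2 : 2 ≤ d) : ∃ Cc Q0 : ℕ, ∀ (K k : Type) [Field K] [Fintype K] [Field k] [Algebra K k]
    [IsAlgClosed k] (p : ℕ) [Fact p.Prime] [CharP k p] (F : MvPolynomial (Fin 3) K),
    F.IsHomogeneous d →
    (∀ x : Fin 3 → k, x ≠ 0 → MvPolynomial.aeval x (F.map (algebraMap K k)) = (0 : k) →
      ∃ j, MvPolynomial.aeval x (MvPolynomial.pderiv j (F.map (algebraMap K k))) ≠ (0 : k)) →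
    (MvPolynomial.aeval ![1, MvPolynomial.X 0, MvPolynomial.X 1] F : MvPolynomial (Fin 2) K).totalDegree = d →
    Irreducible (MvPolynomial.aeval ![1, MvPolynomial.X 0, MvPolynomial.X 1] (F.map (algebraMap K k)) :
      MvPolynomial (Fin 2) k) →
    ((d * (d - 1) : ℕ) : k) ≠ 0 → Q0 ≤ Fintype.card K →
    |(Nat.card {a : K × K // Irreducible (MvPolynomial.aeval ![1, X, C a.1 * X + C a.2] F : K[X])} : ℝ) -
      (Fintype.card K : ℝ) ^ 2 / (d : ℝ)| ≤ Cc * ((Fintype.card K : ℝ) * √(Fintype.card K : ℝ)) := by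
  classical
  have hd0 : 0 < d := by omega
  obtain ⟨C1, Q1, hC1⟩ := count_norm d hd0
  refine ⟨C1 + (2 * d + 1), Q1 + (d + 1) + (d ^ d * (d * d) + 1), ?_⟩
  intro K k _ _ _ _ _ p _ _ F hF hsm htd hirr hp hq
  set φ := algebraMap K k with hφ
  have hFk : (F.map φ).IsHomogeneous d := hF.map φ
  have hdk : (d : k) ≠ 0 := by intro h; apply hp; push_cast; rw [h, zero_mul]
  -- choose the direction
  have hev : ∀ (u : Fin 3 → K[X]) (y : K), eval y (MvPolynomial.aeval u F) =
      MvPolynomial.aeval (fun i => eval y (u i)) F := fun u y =>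
    hom_aeval' (evalRingHom y) (fun r => by simp) u F
  obtain ⟨c, hc⟩ : ∃ c : K, MvPolynomial.aeval ![0, 1, c] F ≠ (0 : K) := by
    obtain ⟨S, hS, hS'⟩ := roots_bound (d := d) (top_nonzero hF hd0 htd) ((homog_coeff hF _ (by
      intro i; fin_cases i <;> simp)).1)
    obtain ⟨c, hcS⟩ : ∃ c, c ∉ S := by
      by_contra hcon
      push Not at hcon
      have : Fintype.card K ≤ S.card := by
        rw [← Finset.card_univ]; exact Finset.card_le_card fun x _ => hcon x
      omega
    refine ⟨c, ?_⟩
    have := hS' c hcS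
    rw [hev] at this
    convert this using 3
    funext i; fin_cases i <;> simp
  have hmapv : ∀ (u : Fin 3 → K), φ (MvPolynomial.aeval u F) =
      MvPolynomial.aeval (fun i => φ (u i)) (F.map φ) := fun u =>
    hom_aeval φ φ (fun a => rfl) u F
  have hck : MvPolynomial.aeval ![0, 1, φ c] (F.map φ) ≠ (0 : k) := by
    have h1 := hmapv ![0, 1, c]
    have e2 : (fun i => φ ((![0, 1, c] : Fin 3 → K) i)) = ![0, 1, φ c] := by
      funext i; fin_cases i <;> simp
    rw [e2] at h1
    rw [← h1]
    exact (_root_.map_ne_zero φ).mpr hc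
  obtain ⟨P, hP0, hPd, hP⟩ := exists_sep hFk hirr hdk (φ c) hck
  obtain ⟨x0, hx0⟩ : ∃ x0 : K, P.eval (φ x0) ≠ 0 := by
    obtain ⟨S, hS, hS'⟩ := roots_bound hP0 hPd
    by_contra hcon
    push Not at hcon
    have : Fintype.card K ≤ S.card := by
      rw [← Finset.card_univ]
      refine Finset.card_le_card_of_injOn φ ?_ φ.injective.injOn
      intro x _
      by_contra hx
      exact hS' _ hx (hcon x)
    omega
  obtain ⟨t, ht, hroot⟩ := hP _ hx0
  set l := MvPolynomial.aeval ![0, 1, c] F with hl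
  have hlk : φ l⁻¹ ≠ 0 := (_root_.map_ne_zero φ).mpr (inv_ne_zero hc)
  let hK : K[X][X] := C (C l⁻¹) * MvPolynomial.aeval (uu c x0) F
  have hmap : hK.map (mapRingHom φ) = C (C (φ l⁻¹)) * MvPolynomial.aeval (uu (φ c) (φ x0)) (F.map φ) := by
    have h1 := hom_aeval φ (mapRingHom (mapRingHom φ)) (fun a => by simp [algMap_CC]) (uu c x0) F
    have e2 : (fun i => mapRingHom (mapRingHom φ) (uu c x0 i)) = uu (φ c) (φ x0) := by
      funext i; fin_cases i <;> simp [uu]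
    rw [e2, coe_mapRingHom] at h1
    simp only [hK]
    rw [Polynomial.map_mul, h1, map_C, coe_mapRingHom, map_C]
  have hTD : TD d hK := by
    have := TD_mul (TD_CC l⁻¹) (homog_TD hF (uu c x0) (TD_uu c x0)); simpa using this
  have h1 : (hK.coeff d).coeff 0 = 1 := by
    rw [← Top_zero, Top_CC_mul, Top_aeval hF _ (TD_uu c x0), Top_uu, mul_one, mul_zero, add_zero, ← hl]
    exact inv_mul_cancel₀ hc
  have hcount := hC1 K k p hK _ rfl (by omega) hTD h1 (by
    rw [hmap]
    refine ⟨t, ht, fun j => ?_⟩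
    rw [← Top_one, Top_CC_mul, Top_aeval hFk _ (TD_uu _ _), Top_uu, mul_one, hroot, mul_zero]) (by
    rw [hmap]
    exact smooth_uu hFk hsm _ _ _ hlk) hp
  have e3 : Nat.card {a : K × K // Irreducible (ptA (C a.1 * X + C a.2 : K[X]) X hK)} =
      Nat.card {a : K × K // Irreducible (MvPolynomial.aeval
        ![C a.1 * X + C a.2, X, 1 + C c * X + C x0 * (C a.1 * X + C a.2)] F : K[X])} := by
    refine Nat.card_congr (Equiv.subtypeEquivRight fun a => ?_)
    rw [map_mul, ptA_CC, algebraMap_eq, irr_const_mul (inv_ne_zero hc),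
      hom_aeval' (ptA (C a.1 * X + C a.2 : K[X]) X) (fun r => by rw [algMap_CC, ptA_CC])]
    have e4 : (fun i => ptA (C a.1 * X + C a.2 : K[X]) X (uu c x0 i)) =
        ![C a.1 * X + C a.2, X, 1 + C c * X + C x0 * (C a.1 * X + C a.2)] := by
      funext i; fin_cases i <;> simp [uu, ptA_X, ptA_CX, ptA_CC, algebraMap_eq]
    rw [e4]
  rw [e3] at hcount
  have hcmp := compare (k := k) hF hd0 c x0 hc
  have hq1 : (1 : ℝ) ≤ Fintype.card K := by
    have : 0 < Fintype.card K := Fintype.card_pos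
    exact_mod_cast this
  have hsq : 1 ≤ √(Fintype.card K : ℝ) := Real.one_le_sqrt.mpr hq1
  have hqq : (Fintype.card K : ℝ) ≤ Fintype.card K * √(Fintype.card K : ℝ) :=
    le_mul_of_one_le_right (by linarith) hsq
  have h5 : (2 * d + 1 : ℝ) * Fintype.card K ≤ (2 * d + 1) * (Fintype.card K * √(Fintype.card K : ℝ)) := by
    gcongr
  refine (abs_sub_le _ _ _).trans ((add_le_add hcmp hcount).trans ?_)
  push_cast
  linarith

end LineIrr
end Polynomial

/-- for every `d ≥ 2` there is a constant `C = C(d)` such that for every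
finite field `K` with `q` elements and characteristic `p` and every absolutely
irreducible `f ∈ K[T,X]` of total degree `d` with `p ∤ d(d − 1)` and smooth
homogenization, the number `N` of pairs `(a₁,a₂) ∈ K²` with `f(T, a₁T + a₂)`
irreducible in `K[T]` satisfies `|N − q²/d| ≤ C·q^{3/2}`. -/
theorem card_irreducible_line_substitutions_single (d : ℕ) (hd : 2 ≤ d) :
    ∃ C : ℝ, ∀ (K : Type) (_ : Field K) (_ : Fintype K) (q p : ℕ),
      Fintype.card K = q → CharP K p →
      ∀ f : MvPolynomial (Fin 2) K,
      f.totalDegree = d →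
      ¬ (p ∣ d * (d - 1)) →
      AbsolutelyIrreducible f →
      (∃ F : MvPolynomial (Fin 3) K, IsSmoothHomogenization F f d) →
      |(Nat.card {a : K × K // Irreducible (lineSub f a.1 a.2)} : ℝ) -
          (q : ℝ) ^ 2 / (d : ℝ)| ≤ C * (q : ℝ) ^ ((3 : ℝ) / 2) := by
  classical
  obtain ⟨Cc, Q0, hmain⟩ := Polynomial.LineIrr.main_count d hd
  refine ⟨(Cc : ℝ) + Q0, ?_⟩
  intro K _ _ q p hq hp f hdeg hpd habs hF
  obtain ⟨F, hhom, hFf, hsm⟩ := hF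
  subst hq
  have hq1 : (1 : ℝ) ≤ (Fintype.card K : ℝ) := by
    exact_mod_cast Fintype.card_pos
  have hq0 : (0 : ℝ) < (Fintype.card K : ℝ) := by linarith
  have hpow : (Fintype.card K : ℝ) ^ ((3 : ℝ) / 2)
      = (Fintype.card K : ℝ) * √(Fintype.card K : ℝ) := by
    rw [Real.sqrt_eq_rpow, show (3 : ℝ) / 2 = 1 + 1 / 2 by norm_num, Real.rpow_add hq0,
      Real.rpow_one]
  rw [hpow]
  have hS1 : 1 ≤ √(Fintype.card K : ℝ) := Real.one_le_sqrt.mpr hq1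
  have hSS : √(Fintype.card K : ℝ) * √(Fintype.card K : ℝ) = (Fintype.card K : ℝ) :=
    Real.mul_self_sqrt hq0.le
  have hpos : 0 ≤ (Fintype.card K : ℝ) * √(Fintype.card K : ℝ) := by positivity
  by_cases hQ : Q0 ≤ Fintype.card K
  · have hpp : Fact p.Prime := ⟨CharP.char_is_prime K p⟩
    have hck : CharP (AlgebraicClosure K) p :=
      charP_of_injective_algebraMap (algebraMap K (AlgebraicClosure K)).injective p
    have hcast : ((d * (d - 1) : ℕ) : AlgebraicClosure K) ≠ 0 := by
      intro h
      exact hpd ((CharP.cast_eq_zero_iff (AlgebraicClosure K) p _).mp h)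
    have hline : ∀ a : K × K, lineSub f a.1 a.2 = (MvPolynomial.aeval ![1, Polynomial.X,
        Polynomial.C a.1 * Polynomial.X + Polynomial.C a.2] F : Polynomial K) := by
      intro a
      rw [← hFf]
      unfold lineSub
      have h := Polynomial.LineIrr.hom_aeval'
        ((MvPolynomial.aeval ![Polynomial.X, Polynomial.C a.1 * Polynomial.X + Polynomial.C a.2] :
          MvPolynomial (Fin 2) K →ₐ[K] Polynomial K) : MvPolynomial (Fin 2) K →+* Polynomial K)
        (fun r => by simp) ![1, MvPolynomial.X 0, MvPolynomial.X 1] F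
      refine Eq.trans h ?_
      congr 2
      funext i
      fin_cases i <;> simp
    have hirr : Irreducible (MvPolynomial.aeval ![1, MvPolynomial.X 0, MvPolynomial.X 1]
        (F.map (algebraMap K (AlgebraicClosure K))) :
          MvPolynomial (Fin 2) (AlgebraicClosure K)) := by
      have h := Polynomial.LineIrr.hom_aeval (algebraMap K (AlgebraicClosure K))
        (MvPolynomial.map (algebraMap K (AlgebraicClosure K)) :
          MvPolynomial (Fin 2) K →+* MvPolynomial (Fin 2) (AlgebraicClosure K))
        (fun r => by simp [MvPolynomial.algebraMap_eq]) ![1, MvPolynomial.X 0, MvPolynomial.X 1] F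
      have h2 : (fun i => (MvPolynomial.map (algebraMap K (AlgebraicClosure K)) :
          MvPolynomial (Fin 2) K →+* MvPolynomial (Fin 2) (AlgebraicClosure K))
            ((![1, MvPolynomial.X 0, MvPolynomial.X 1] :
              Fin 3 → MvPolynomial (Fin 2) K) i)) = ![1, MvPolynomial.X 0, MvPolynomial.X 1] := by
        funext i
        fin_cases i <;> simp
      rw [h2, hFf] at h
      rw [← h]
      exact habs
    have hmm := hmain K (AlgebraicClosure K) p F hhom ?_ (by rw [hFf]; exact hdeg) hirr hcast hQ
    · simp only [hline]
      refine hmm.trans ?_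
      have : (0 : ℝ) ≤ Q0 := by positivity
      nlinarith
    · intro x hx h0
      obtain ⟨j, hj⟩ := hsm x hx (by simpa [MvPolynomial.aeval_eq_eval] using h0)
      refine ⟨j, ?_⟩
      rw [MvPolynomial.pderiv_map]
      simpa [MvPolynomial.aeval_eq_eval] using hj
  · push Not at hQ
    have hN : (Nat.card {a : K × K // Irreducible (lineSub f a.1 a.2)} : ℝ)
        ≤ (Fintype.card K : ℝ) ^ 2 := by
      have h1 := Nat.card_le_card_of_injective
        (Subtype.val : {a : K × K // Irreducible (lineSub f a.1 a.2)} → K × K)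
        Subtype.val_injective
      rw [Nat.card_eq_fintype_card (α := K × K), Fintype.card_prod, ← pow_two] at h1
      exact_mod_cast h1
    have hN0 : (0 : ℝ) ≤ (Nat.card {a : K × K // Irreducible (lineSub f a.1 a.2)} : ℝ) := by
      positivity
    have hd0 : (1 : ℝ) ≤ d := by exact_mod_cast (by omega : 1 ≤ d)
    have hdiv : (Fintype.card K : ℝ) ^ 2 / (d : ℝ) ≤ (Fintype.card K : ℝ) ^ 2 :=
      div_le_self (by positivity) hd0
    have hdiv0 : 0 ≤ (Fintype.card K : ℝ) ^ 2 / (d : ℝ) := by positivity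
    have hQ' : (Fintype.card K : ℝ) ≤ Q0 := by exact_mod_cast hQ.le
    have habs' : |(Nat.card {a : K × K // Irreducible (lineSub f a.1 a.2)} : ℝ) -
          (Fintype.card K : ℝ) ^ 2 / (d : ℝ)| ≤ (Fintype.card K : ℝ) ^ 2 := by
      rw [abs_le]
      constructor <;> linarith
    refine habs'.trans ?_
    have hSq : √(Fintype.card K : ℝ) ≤ Q0 := by nlinarith
    have hCc : (0 : ℝ) ≤ Cc := by positivity
    calc (Fintype.card K : ℝ) ^ 2
        = √(Fintype.card K : ℝ) * ((Fintype.card K : ℝ) * √(Fintype.card K : ℝ)) := by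
          rw [mul_left_comm, hSS, pow_two]
      _ ≤ (Q0 : ℝ) * ((Fintype.card K : ℝ) * √(Fintype.card K : ℝ)) :=
          mul_le_mul_of_nonneg_right hSq hpos
      _ ≤ _ := mul_le_mul_of_nonneg_right (by linarith) hpos
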